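/- arXiv:2004.01784 — 2 statements merged into one kernel-verified Lean document; each statement's English description precedes it below -/
import Mathlib

section
/- Let 2 ≤ p < ∞ and k = 2d(1/2 − 1/p). There exists a constant C > 0 such that for all f ∈ 𝓢(ℝ^d): ‖f‖_{M^p} ≤ C ‖f‖_{L^p} and ‖f‖_{L^p_{−k}} ≤ C ‖f‖_{M^p}. (That is, the continuous embeddings L^p(ℝ^d) ↪ M^p(ℝ^d) ↪ L^p_{−k}(ℝ^d) hold.) -/
open MeasureTheory Real Filter
open scoped RealInnerProductSpace ENNReal

noncomputable section

/-- The Gaussian window `g(t) = e^{-π|t|²}`. -/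
def gaussWindow {d : ℕ} (t : EuclideanSpace ℝ (Fin d)) : ℂ :=
  (Real.exp (-π * ‖t‖ ^ 2) : ℝ)

/-- The short-time Fourier transform with Gaussian window:
`V_g f(x,ξ) = ∫ e^{-2πi ξ·t} f(t) g(t-x) dt`. -/
def STFT {d : ℕ} (f : EuclideanSpace ℝ (Fin d) → ℂ)
    (x ξ : EuclideanSpace ℝ (Fin d)) : ℂ :=
  ∫ (t : EuclideanSpace ℝ (Fin d)),
    Complex.exp (-(((2 * π * ⟪ξ, t⟫ : ℝ) : ℂ) * Complex.I)) * f t * gaussWindow (t - x)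

/-- The modulation space norm `‖f‖_{M^p} = (∫∫ |V_g f(x,ξ)|^p dx dξ)^{1/p}`. -/
def MpNorm {d : ℕ} (p : ℝ) (f : EuclideanSpace ℝ (Fin d) → ℂ) : ℝ≥0∞ :=
  eLpNorm (fun z : EuclideanSpace ℝ (Fin d) × EuclideanSpace ℝ (Fin d) =>
    STFT f z.1 z.2) (ENNReal.ofReal p) volume

/-- The Fourier transform `𝓕f(ξ) = ∫ e^{-2πi ξ·x} f(x) dx`. -/
def FT {d : ℕ} (f : EuclideanSpace ℝ (Fin d) → ℂ) (ξ : EuclideanSpace ℝ (Fin d)) : ℂ :=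
  ∫ (x : EuclideanSpace ℝ (Fin d)),
    Complex.exp (-(((2 * π * ⟪ξ, x⟫ : ℝ) : ℂ) * Complex.I)) * f x

/-- The inverse Fourier transform `𝓕⁻¹h(x) = ∫ e^{2πi x·ξ} h(ξ) dξ`. -/
def IFT {d : ℕ} (h : EuclideanSpace ℝ (Fin d) → ℂ) (x : EuclideanSpace ℝ (Fin d)) : ℂ :=
  ∫ (ξ : EuclideanSpace ℝ (Fin d)),
    Complex.exp ((((2 * π * ⟪x, ξ⟫ : ℝ) : ℂ) * Complex.I)) * h ξ

/-- The Bessel potential Sobolev norm `‖f‖_{L^p_k} = ‖𝓕⁻¹(⟨·⟩^k 𝓕f)‖_{L^p}`. -/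
def sobolevNorm {d : ℕ} (p k : ℝ) (f : EuclideanSpace ℝ (Fin d) → ℂ) : ℝ≥0∞ :=
  eLpNorm (IFT fun ξ => (((1 + ‖ξ‖ ^ 2) ^ (k / 2) : ℝ) : ℂ) * FT f ξ)
    (ENNReal.ofReal p) volume

section

open FourierTransform SchwartzMap

section FourierPlancherel

variable {V : Type*} [NormedAddCommGroup V] [InnerProductSpace ℝ V] [FiniteDimensional ℝ V]
  [MeasurableSpace V] [BorelSpace V]

theorem integral_fourier_mul_eq_flip {f g : V → ℂ} (hf : Integrable f) (hg : Integrable g) :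
    ∫ ξ, 𝓕 f ξ * g ξ = ∫ x, f x * 𝓕 g x := by
  have := VectorFourier.integral_fourierIntegral_smul_eq_flip (L := innerₗ V)
    Real.continuous_fourierChar continuous_inner hf hg
  rw [flip_innerₗ] at this
  exact this

theorem continuous_fourier {f : V → ℂ} (hf : Integrable f) : Continuous (𝓕 f) :=
  VectorFourier.fourierIntegral_continuous Real.continuous_fourierChar
    (L := innerₗ V) continuous_inner hf

theorem fourier_toLp_ae_eq {f : V → ℂ} (hf : Integrable f) (hf2 : MemLp f 2) :
    ∀ᵐ ξ, (𝓕 (hf2.toLp f) : Lp ℂ 2 (volume : Measure V)) ξ = 𝓕 f ξ := by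
  apply ae_eq_of_integral_contDiff_smul_eq
  · exact (Lp.memLp _).locallyIntegrable (by norm_num)
  · exact (continuous_fourier hf).locallyIntegrable
  intro g hg hgc
  have h₁ : HasCompactSupport (Complex.ofRealCLM ∘ g) := hgc.comp_left rfl
  have h₂ : ContDiff ℝ ((⊤ : ℕ∞) : WithTop ℕ∞) (Complex.ofRealCLM ∘ g) := by fun_prop
  set G : 𝓢(V, ℂ) := h₁.toSchwartzMap h₂ with hG
  have key := congrArg (fun T => T G) (Lp.fourier_toTemperedDistribution_eq (hf2.toLp f))
  simp only [TemperedDistribution.fourier_apply, Lp.toTemperedDistribution_apply] at key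
  have e1 : ∀ x, g x • (𝓕 (hf2.toLp f) : Lp ℂ 2 (volume : Measure V)) x
      = G x • (𝓕 (hf2.toLp f) : Lp ℂ 2 (volume : Measure V)) x := by
    intro x; simp [hG]
  have e2 : ∀ x, g x • 𝓕 f x = 𝓕 f x * G x := by
    intro x; simp [hG, mul_comm]
  simp_rw [e1, e2]
  rw [← key, integral_fourier_mul_eq_flip hf G.integrable]
  apply integral_congr_ae
  filter_upwards [hf2.coeFn_toLp] with x hx
  rw [hx, smul_eq_mul, mul_comm, SchwartzMap.fourier_coe]

theorem lintegral_fourier_sq {f : V → ℂ} (hf : Integrable f) (hf2 : MemLp f 2) :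
    ∫⁻ ξ, ‖𝓕 f ξ‖ₑ ^ (2 : ℝ) = ∫⁻ x, ‖f x‖ₑ ^ (2 : ℝ) := by
  have h1 := Lp.norm_fourier_eq (hf2.toLp f)
  have h2 : eLpNorm (𝓕 f) 2 = eLpNorm f 2 := by
    rw [← eLpNorm_congr_ae (fourier_toLp_ae_eq hf hf2), ← eLpNorm_congr_ae hf2.coeFn_toLp,
      ← Lp.enorm_def, ← Lp.enorm_def, ← ofReal_norm, ← ofReal_norm, h1]
  rw [eLpNorm_eq_lintegral_rpow_enorm_toReal (by norm_num) (by norm_num),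
    eLpNorm_eq_lintegral_rpow_enorm_toReal (by norm_num) (by norm_num)] at h2
  simp only [ENNReal.toReal_ofNat] at h2
  exact ENNReal.rpow_left_injective (by norm_num) h2

end FourierPlancherel

section Truncation

open Set

theorem lintegral_Ioo_zero_rpow {s x : ℝ} (hs : 0 < s) (hx : 0 ≤ x) :
    ∫⁻ t in Ioo 0 x, ENNReal.ofReal (t ^ (s - 1)) = ENNReal.ofReal (s⁻¹ * x ^ s) := by
  rw [setLIntegral_congr Ioo_ae_eq_Ioc, ← ofReal_integral_eq_lintegral_ofReal]
  · rw [← intervalIntegral.integral_of_le hx, integral_rpow (Or.inl (by linarith))]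
    congr 1
    simp [Real.zero_rpow hs.ne']
    ring
  · exact (intervalIntegrable_iff_integrableOn_Ioc_of_le hx).1
      (intervalIntegral.intervalIntegrable_rpow' (by linarith))
  · filter_upwards [ae_restrict_mem measurableSet_Ioc] with t ht
    exact Real.rpow_nonneg ht.1.le _

theorem lintegral_Ioi_rpow_neg {s x : ℝ} (hs : 0 < s) (hx : 0 < x) :
    ∫⁻ t in Ioi x, ENNReal.ofReal (t ^ (-s - 1)) = ENNReal.ofReal (s⁻¹ * x ^ (-s)) := by
  rw [← ofReal_integral_eq_lintegral_ofReal]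
  · rw [integral_Ioi_rpow_of_lt (by linarith) hx]
    congr 1
    simp
    field_simp
  · exact integrableOn_Ioi_rpow_of_lt (by linarith) hx
  · filter_upwards [ae_restrict_mem measurableSet_Ioi] with t ht
    exact Real.rpow_nonneg (hx.trans ht).le _

variable {α : Type*} [MeasurableSpace α] {μ : Measure α} [SFinite μ]

theorem lintegral_rpow_mul_lintegral_indicator_lt {g : α → ℝ} (hg : Measurable g)
    (hg0 : ∀ a, 0 ≤ g a) {p r : ℝ} (hr : 0 ≤ r) (hrp : r < p) :
    ∫⁻ t in Ioi (0 : ℝ), ENNReal.ofReal (t ^ (p - r - 1)) *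
        ∫⁻ a, {a | t < g a}.indicator (fun a => ENNReal.ofReal (g a ^ r)) a ∂μ =
      ENNReal.ofReal (p - r)⁻¹ * ∫⁻ a, ENNReal.ofReal (g a ^ p) ∂μ := by
  have hm : MeasurableSet {z : ℝ × α | z.1 < g z.2} :=
    measurableSet_lt measurable_fst (hg.comp measurable_snd)
  have hm2 : Measurable (fun z : ℝ × α => ENNReal.ofReal (z.1 ^ (p - r - 1)) *
      {z : ℝ × α | z.1 < g z.2}.indicator (fun z => ENNReal.ofReal (g z.2 ^ r)) z) := by
    apply Measurable.mul (by fun_prop)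
    exact Measurable.indicator (by fun_prop) hm
  calc
    _ = ∫⁻ t in Ioi (0 : ℝ), ∫⁻ a, ENNReal.ofReal (t ^ (p - r - 1)) *
        {z : ℝ × α | z.1 < g z.2}.indicator (fun z => ENNReal.ofReal (g z.2 ^ r)) (t, a) ∂μ := by
      refine lintegral_congr fun t => ?_
      rw [← lintegral_const_mul']
      · rfl
      · exact ENNReal.ofReal_ne_top
    _ = ∫⁻ a, (∫⁻ t in Ioi (0 : ℝ), ENNReal.ofReal (t ^ (p - r - 1)) *
        {z : ℝ × α | z.1 < g z.2}.indicator (fun z => ENNReal.ofReal (g z.2 ^ r)) (t, a)) ∂μ :=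
      lintegral_lintegral_swap hm2.aemeasurable
    _ = ∫⁻ a, ENNReal.ofReal (p - r)⁻¹ * ENNReal.ofReal (g a ^ p) ∂μ := by
      refine lintegral_congr fun a => ?_
      have : ∀ t : ℝ, ENNReal.ofReal (t ^ (p - r - 1)) *
          {z : ℝ × α | z.1 < g z.2}.indicator (fun z => ENNReal.ofReal (g z.2 ^ r)) (t, a) =
          (Iio (g a)).indicator
            (fun t => ENNReal.ofReal (t ^ (p - r - 1)) * ENNReal.ofReal (g a ^ r)) t := by
        intro t
        by_cases h : t < g a <;> simp [h]
      simp_rw [this]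
      rw [setLIntegral_indicator measurableSet_Iio, Set.inter_comm, Ioi_inter_Iio,
        lintegral_mul_const _ (by fun_prop), lintegral_Ioo_zero_rpow (by linarith) (hg0 a),
        ← ENNReal.ofReal_mul (by have := hg0 a; have : 0 < p - r := by linarith
                                 positivity),
        ← ENNReal.ofReal_mul (by simp; linarith), mul_assoc,
        ← Real.rpow_add_of_nonneg (hg0 a) (by linarith) hr]
      simp
    _ = _ := lintegral_const_mul _ (by fun_prop)

theorem lintegral_rpow_mul_lintegral_indicator_le {g : α → ℝ} (hg : Measurable g)
    (hg0 : ∀ a, 0 ≤ g a) {p r : ℝ} (hp : 0 < p) (hrp : p < r) :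
    ∫⁻ t in Ioi (0 : ℝ), ENNReal.ofReal (t ^ (p - r - 1)) *
        ∫⁻ a, {a | g a < t}.indicator (fun a => ENNReal.ofReal (g a ^ r)) a ∂μ =
      ENNReal.ofReal (r - p)⁻¹ * ∫⁻ a, ENNReal.ofReal (g a ^ p) ∂μ := by
  have hm : MeasurableSet {z : ℝ × α | g z.2 < z.1} :=
    measurableSet_lt (hg.comp measurable_snd) measurable_fst
  have hm2 : Measurable (fun z : ℝ × α => ENNReal.ofReal (z.1 ^ (p - r - 1)) *
      {z : ℝ × α | g z.2 < z.1}.indicator (fun z => ENNReal.ofReal (g z.2 ^ r)) z) := by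
    apply Measurable.mul (by fun_prop)
    exact Measurable.indicator (by fun_prop) hm
  calc
    _ = ∫⁻ t in Ioi (0 : ℝ), ∫⁻ a, ENNReal.ofReal (t ^ (p - r - 1)) *
        {z : ℝ × α | g z.2 < z.1}.indicator (fun z => ENNReal.ofReal (g z.2 ^ r)) (t, a) ∂μ := by
      refine lintegral_congr fun t => ?_
      rw [← lintegral_const_mul']
      · rfl
      · exact ENNReal.ofReal_ne_top
    _ = ∫⁻ a, (∫⁻ t in Ioi (0 : ℝ), ENNReal.ofReal (t ^ (p - r - 1)) *
        {z : ℝ × α | g z.2 < z.1}.indicator (fun z => ENNReal.ofReal (g z.2 ^ r)) (t, a)) ∂μ :=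
      lintegral_lintegral_swap hm2.aemeasurable
    _ = ∫⁻ a, ENNReal.ofReal (r - p)⁻¹ * ENNReal.ofReal (g a ^ p) ∂μ := by
      refine lintegral_congr fun a => ?_
      rcases (hg0 a).eq_or_lt with h0 | h0
      · have hr : r ≠ 0 := by linarith
        simp [← h0, Real.zero_rpow hr, Real.zero_rpow hp.ne', indicator_apply]
      have : ∀ t : ℝ, ENNReal.ofReal (t ^ (p - r - 1)) *
          {z : ℝ × α | g z.2 < z.1}.indicator (fun z => ENNReal.ofReal (g z.2 ^ r)) (t, a) =
          (Ioi (g a)).indicator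
            (fun t => ENNReal.ofReal (t ^ (-(r - p) - 1)) * ENNReal.ofReal (g a ^ r)) t := by
        intro t
        by_cases h : g a < t <;> simp [h]
      simp_rw [this]
      rw [setLIntegral_indicator measurableSet_Ioi, Ioi_inter_Ioi, sup_eq_left.2 h0.le,
        lintegral_mul_const _ (by fun_prop), lintegral_Ioi_rpow_neg (by linarith) h0,
        ← ENNReal.ofReal_mul (by have : 0 < r - p := by linarith
                                 positivity),
        ← ENNReal.ofReal_mul (by simp; linarith), mul_assoc,
        ← Real.rpow_add h0]
      simp
    _ = _ := lintegral_const_mul _ (by fun_prop)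

end Truncation

theorem ofReal_norm_rpow {F : Type*} [NormedAddCommGroup F] (z : F) {p : ℝ} (hp : 0 ≤ p) :
    ENNReal.ofReal (‖z‖ ^ p) = ‖z‖ₑ ^ p := by
  rw [← ENNReal.ofReal_rpow_of_nonneg (norm_nonneg _) hp, ofReal_norm]

/-- Chebyshev's inequality in the form used for weak-type bounds. -/
theorem meas_lt_norm_le {α : Type*} [MeasurableSpace α] {μ : Measure α} {F : α → ℂ}
    (hF : AEMeasurable F μ) {t : ℝ} (ht : 0 < t) {r : ℝ} (hr : 0 < r) :
    μ {z | t < ‖F z‖} ≤ ENNReal.ofReal (t ^ (-r)) * ∫⁻ z, ‖F z‖ₑ ^ r ∂μ := by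
  have h1 : {z | t < ‖F z‖} ⊆ {z | ENNReal.ofReal (t ^ r) ≤ ‖F z‖ₑ ^ r} := by
    intro z hz
    simp only [Set.mem_ofPred_eq] at hz ⊢
    rw [← ofReal_norm_rpow _ hr.le]
    exact ENNReal.ofReal_le_ofReal (Real.rpow_le_rpow ht.le hz.le hr.le)
  refine (measure_mono h1).trans ?_
  have h2 := mul_meas_ge_le_lintegral₀ (hF.enorm.pow_const r) (ENNReal.ofReal (t ^ r))
  refine le_trans ?_ (mul_le_mul_right h2 _)
  rw [← mul_assoc, ← ENNReal.ofReal_mul (by positivity), ← Real.rpow_add ht]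
  simp

section ShortTimeFourier

variable {V : Type*} [NormedAddCommGroup V] [InnerProductSpace ℝ V] [FiniteDimensional ℝ V]
  [MeasurableSpace V] [BorelSpace V]

/-- The short-time Fourier transform with a general window `w`. -/
def windowedFourier (w f : V → ℂ) (x ξ : V) : ℂ := 𝓕 (fun t => f t * w (t - x)) ξ

theorem enorm_fourier_le (f : V → ℂ) (ξ : V) : ‖𝓕 f ξ‖ₑ ≤ ∫⁻ t, ‖f t‖ₑ := by
  rw [Real.fourier_eq]
  refine (enorm_integral_le_lintegral_enorm _).trans (le_of_eq ?_)
  refine lintegral_congr fun t => ?_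
  rw [← ofReal_norm, Circle.norm_smul, ofReal_norm]

theorem measurable_windowedFourier {w f : V → ℂ} (hw : Measurable w) (hf : Measurable f) :
    Measurable (fun z : V × V => windowedFourier w f z.1 z.2) := by
  unfold windowedFourier
  simp_rw [Real.fourier_eq]
  have : StronglyMeasurable (fun q : (V × V) × V =>
      Real.fourierChar (-inner ℝ q.2 q.1.2) • (f q.2 * w (q.2 - q.1.1))) := by
    apply StronglyMeasurable.smul (f := fun q : (V × V) × V => Real.fourierChar (-inner ℝ q.2 q.1.2))
    · exact (Real.continuous_fourierChar.comp (by fun_prop)).stronglyMeasurable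
    · exact Measurable.stronglyMeasurable (by fun_prop)
  exact (this.integral_prod_right').measurable

theorem integrable_mul_window {w f : V → ℂ} (hw : Measurable w) (hw1 : ∀ x, ‖w x‖ ≤ 1)
    (hf : Integrable f) (x : V) : Integrable (fun t => f t * w (t - x)) :=
  hf.mul_bdd (c := 1) (Measurable.aestronglyMeasurable (by fun_prop)) (by simp [hw1])

theorem memLp_mul_window {w f : V → ℂ} (hw : Measurable w) (hw1 : ∀ x, ‖w x‖ ≤ 1) {p : ℝ≥0∞}
    (hf : MemLp f p) (x : V) : MemLp (fun t => f t * w (t - x)) p := by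
  refine hf.of_le (hf.1.mul (Measurable.aestronglyMeasurable (by fun_prop))) ?_
  filter_upwards with t
  rw [norm_mul]
  exact mul_le_of_le_one_right (norm_nonneg _) (hw1 _)

theorem lintegral_lintegral_enorm_mul_window {w f : V → ℂ} (hw : Measurable w) (hf : Measurable f)
    {p : ℝ} (hp : 0 ≤ p) :
    ∫⁻ x, ∫⁻ t, ‖f t * w (t - x)‖ₑ ^ p = (∫⁻ t, ‖f t‖ₑ ^ p) * ∫⁻ t, ‖w t‖ₑ ^ p := by
  rw [lintegral_lintegral_swap (by fun_prop)]
  simp_rw [enorm_mul, ENNReal.mul_rpow_of_nonneg _ _ hp]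
  rw [← lintegral_mul_const _ (by fun_prop)]
  refine lintegral_congr fun t => ?_
  rw [lintegral_const_mul _ (by fun_prop),
    lintegral_sub_left_eq_self (fun x => ‖w x‖ₑ ^ p) t]

theorem lintegral_windowedFourier_sq {w f : V → ℂ} (hw : Measurable w) (hw1 : ∀ x, ‖w x‖ ≤ 1)
    (hfm : Measurable f) (hf : Integrable f) (hf2 : MemLp f 2) :
    ∫⁻ z : V × V, ‖windowedFourier w f z.1 z.2‖ₑ ^ (2 : ℝ) =
      (∫⁻ t, ‖f t‖ₑ ^ (2 : ℝ)) * ∫⁻ t, ‖w t‖ₑ ^ (2 : ℝ) := by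
  rw [Measure.volume_eq_prod, lintegral_prod _
    ((measurable_windowedFourier hw hfm).enorm.pow_const _).aemeasurable,
    ← lintegral_lintegral_enorm_mul_window hw hfm (by norm_num)]
  exact lintegral_congr fun x => lintegral_fourier_sq (integrable_mul_window hw hw1 hf x)
    (memLp_mul_window hw hw1 hf2 x)

theorem enorm_windowedFourier_le {w f : V → ℂ} (hw : ∫⁻ t, ‖w t‖ₑ ≤ 1) {M : ℝ}
    (hM : ∀ t, ‖f t‖ ≤ M) (x ξ : V) : ‖windowedFourier w f x ξ‖ₑ ≤ ENNReal.ofReal M := by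
  refine (enorm_fourier_le _ _).trans ?_
  calc ∫⁻ t, ‖f t * w (t - x)‖ₑ ≤ ∫⁻ t, ENNReal.ofReal M * ‖w (t - x)‖ₑ := by
        refine lintegral_mono fun t => ?_
        rw [enorm_mul, ← ofReal_norm (f t)]
        gcongr
        exact hM t
    _ ≤ ENNReal.ofReal M := by
        rw [lintegral_const_mul' _ _ ENNReal.ofReal_ne_top,
          lintegral_sub_right_eq_self (fun t => ‖w t‖ₑ) x]
        exact mul_le_of_le_one_right (by positivity) hw

theorem windowedFourier_add {w f g : V → ℂ} (hw : Measurable w) (hw1 : ∀ x, ‖w x‖ ≤ 1)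
    (hf : Integrable f) (hg : Integrable g) (x ξ : V) :
    windowedFourier w (f + g) x ξ = windowedFourier w f x ξ + windowedFourier w g x ξ := by
  have h := congrFun (VectorFourier.fourierIntegral_add (L := innerₗ V)
    Real.continuous_fourierChar continuous_inner (integrable_mul_window hw hw1 hf x)
    (integrable_mul_window hw hw1 hg x)) ξ
  have e : (fun t => (f + g) t * w (t - x)) =
      (fun t => f t * w (t - x)) + fun t => g t * w (t - x) := by
    ext t; simp [add_mul]
  rw [windowedFourier, e]
  exact h

/-- `L^p` boundedness of the short-time Fourier transform, by real interpolation between the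
`L²` isometry and the trivial `L^∞` bound. -/
theorem lintegral_windowedFourier_rpow_le {w f : V → ℂ} (hw : Measurable w)
    (hw1 : ∀ x, ‖w x‖ ≤ 1) (hwI : ∫⁻ t, ‖w t‖ₑ ≤ 1) (hfm : Measurable f) (hf : Integrable f)
    (hf2 : MemLp f 2) {p : ℝ} (hp : 2 < p) :
    ∫⁻ z : V × V, ‖windowedFourier w f z.1 z.2‖ₑ ^ p ≤
      ENNReal.ofReal (p * (p - 2)⁻¹ * 2 ^ p) * ∫⁻ t, ‖f t‖ₑ ^ p := by
  have hw2 : ∫⁻ t, ‖w t‖ₑ ^ (2 : ℝ) ≤ 1 := by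
    refine (lintegral_mono fun t => ?_).trans hwI
    have : ‖w t‖ₑ ≤ 1 := by
      rw [← ofReal_norm]; exact ENNReal.ofReal_le_one.2 (hw1 t)
    calc ‖w t‖ₑ ^ (2 : ℝ) ≤ ‖w t‖ₑ ^ (1 : ℝ) :=
        ENNReal.rpow_le_rpow_of_exponent_ge this (by norm_num)
      _ = ‖w t‖ₑ := by simp
  set g : V → ℝ := fun a => 2 * ‖f a‖ with hg
  have hgm : Measurable g := by fun_prop
  have weak : ∀ t : ℝ, 0 < t → volume {z : V × V | t < ‖windowedFourier w f z.1 z.2‖} ≤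
      ENNReal.ofReal (t ^ (-2 : ℝ)) *
        ∫⁻ a, {a | t < g a}.indicator (fun a => ENNReal.ofReal (g a ^ (2 : ℝ))) a := by
    intro t ht
    have hs : MeasurableSet {a | t < g a} := measurableSet_lt measurable_const hgm
    set f₂ := {a | t < g a}.indicator f with hf₂
    set f₁ := {a | t < g a}ᶜ.indicator f with hf₁
    have hadd : f = f₁ + f₂ := by rw [hf₁, hf₂, Set.indicator_compl_add_self]
    have hsub : {z : V × V | t < ‖windowedFourier w f z.1 z.2‖} ⊆
        {z : V × V | t / 2 < ‖windowedFourier w f₂ z.1 z.2‖} := by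
      intro z hz
      simp only [Set.mem_ofPred_eq] at hz ⊢
      rw [hadd, windowedFourier_add hw hw1 (hf.indicator hs.compl) (hf.indicator hs)] at hz
      have h1 : ‖windowedFourier w f₁ z.1 z.2‖ ≤ t / 2 := by
        have := enorm_windowedFourier_le (f := f₁) (M := t / 2) hwI (fun a => by
          by_cases ha : t < g a
          · simp only [hf₁, Set.indicator, Set.mem_compl_iff, Set.mem_ofPred_eq, ha,
              not_true_eq_false, if_false, norm_zero]
            positivity
          · simp only [hf₁, Set.indicator, Set.mem_compl_iff, Set.mem_ofPred_eq, ha,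
              not_false_eq_true, if_true]
            simp only [hg, not_lt] at ha
            linarith) z.1 z.2
        rwa [← ofReal_norm, ENNReal.ofReal_le_ofReal_iff (by positivity)] at this
      have := norm_add_le (windowedFourier w f₁ z.1 z.2) (windowedFourier w f₂ z.1 z.2)
      linarith
    refine (measure_mono hsub).trans ((meas_lt_norm_le (measurable_windowedFourier hw
      (hfm.indicator hs)).aemeasurable (half_pos ht) (r := 2) (by norm_num)).trans ?_)
    rw [lintegral_windowedFourier_sq hw hw1 (hfm.indicator hs) (hf.indicator hs)
      (hf2.indicator hs)]
    calc ENNReal.ofReal ((t / 2) ^ (-2 : ℝ)) * ((∫⁻ a, ‖f₂ a‖ₑ ^ (2 : ℝ)) * ∫⁻ t, ‖w t‖ₑ ^ (2 : ℝ))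
        ≤ ENNReal.ofReal ((t / 2) ^ (-2 : ℝ)) * (∫⁻ a, ‖f₂ a‖ₑ ^ (2 : ℝ)) := by
          gcongr
          exact mul_le_of_le_one_right (by positivity) hw2
      _ = _ := by
          rw [← lintegral_const_mul' _ _ ENNReal.ofReal_ne_top,
            ← lintegral_const_mul' _ _ ENNReal.ofReal_ne_top]
          refine lintegral_congr fun a => ?_
          by_cases ha : t < g a
          · simp only [hf₂, Set.indicator, Set.mem_ofPred_eq, ha, if_true]
            rw [← ofReal_norm_rpow _ (by norm_num), ← ENNReal.ofReal_mul (by positivity),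
              ← ENNReal.ofReal_mul (by positivity)]
            congr 1
            rw [hg, Real.rpow_neg (by positivity), Real.rpow_neg (by positivity)]
            norm_num
            field_simp
          · simp [hf₂, Set.indicator, ha]
  calc
    _ = ∫⁻ z : V × V, ENNReal.ofReal (‖windowedFourier w f z.1 z.2‖ ^ p) := by
      simp_rw [ofReal_norm_rpow _ (show 0 ≤ p by linarith)]
    _ = ENNReal.ofReal p * ∫⁻ t in Set.Ioi 0,
          volume {z : V × V | t < ‖windowedFourier w f z.1 z.2‖} * ENNReal.ofReal (t ^ (p - 1)) :=
      lintegral_rpow_eq_lintegral_meas_lt_mul _ (ae_of_all _ fun _ => norm_nonneg _)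
        (measurable_windowedFourier hw hfm).norm.aemeasurable (by linarith)
    _ ≤ ENNReal.ofReal p * ∫⁻ t in Set.Ioi 0, ENNReal.ofReal (t ^ (p - 2 - 1)) *
        ∫⁻ a, {a | t < g a}.indicator (fun a => ENNReal.ofReal (g a ^ (2 : ℝ))) a := by
      refine mul_le_mul_right ?_ _
      refine setLIntegral_mono' measurableSet_Ioi fun t ht => ?_
      refine (mul_le_mul_left (weak t ht) _).trans (le_of_eq ?_)
      rw [mul_right_comm, ← ENNReal.ofReal_mul (Real.rpow_nonneg (le_of_lt ht) _),
        ← Real.rpow_add ht]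
      ring_nf
    _ = ENNReal.ofReal p * (ENNReal.ofReal (p - 2)⁻¹ * ∫⁻ a, ENNReal.ofReal (g a ^ p)) := by
      rw [lintegral_rpow_mul_lintegral_indicator_lt hgm (fun a => by positivity) (by norm_num) hp]
    _ = _ := by
      have h0 : 0 < p - 2 := by linarith
      have : ∀ a, ENNReal.ofReal (g a ^ p) = ENNReal.ofReal (2 ^ p) * ‖f a‖ₑ ^ p := by
        intro a
        rw [hg, Real.mul_rpow (by norm_num) (norm_nonneg _), ENNReal.ofReal_mul (by positivity),
          ofReal_norm_rpow _ (by linarith)]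
      simp_rw [this]
      rw [lintegral_const_mul' _ _ ENNReal.ofReal_ne_top, ENNReal.ofReal_mul (by positivity),
        ENNReal.ofReal_mul (by linarith)]
      ring

end ShortTimeFourier

section Paley

/-- If the sublevel sets of `v` grow at most linearly, then `v` is in weak `L¹` for the measure
with density `v⁻²`. -/
theorem lintegral_indicator_lt_rpow_neg_two_le {α : Type*} [MeasurableSpace α] {μ : Measure α}
    [SFinite μ] {v : α → ℝ} (hv : Measurable v) {c : ℝ≥0∞}
    (hc : ∀ t, 0 < t → μ {a | v a < t} ≤ c * ENNReal.ofReal t) {R : ℝ} (hR : 0 < R) :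
    ∫⁻ a, {a | R < v a}.indicator (fun a => ENNReal.ofReal (v a ^ (-2 : ℝ))) a ∂μ ≤
      2 * c * ENNReal.ofReal R⁻¹ := by
  have key : ∀ a, {a | R < v a}.indicator (fun a => ENNReal.ofReal (v a ^ (-2 : ℝ))) a ≤
      ∫⁻ t in Set.Ioi R, {z : ℝ × α | v z.2 < z.1}.indicator
        (fun z => 2 * ENNReal.ofReal (z.1 ^ (-3 : ℝ))) (t, a) := by
    intro a
    by_cases ha : R < v a
    · have e : ∀ t, {z : ℝ × α | v z.2 < z.1}.indicator
          (fun z => 2 * ENNReal.ofReal (z.1 ^ (-3 : ℝ))) (t, a) =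
          (Set.Ioi (v a)).indicator (fun t => 2 * ENNReal.ofReal (t ^ (-3 : ℝ))) t := by
        intro t
        by_cases h : v a < t <;> simp [h]
      simp_rw [e]
      rw [setLIntegral_indicator measurableSet_Ioi, Set.Ioi_inter_Ioi, sup_eq_left.2 ha.le,
        lintegral_const_mul' _ _ (by simp)]
      rw [show (-3 : ℝ) = -2 - 1 by norm_num,
        lintegral_Ioi_rpow_neg (s := 2) (by norm_num) (hR.trans ha)]
      simp only [Set.indicator, Set.mem_ofPred_eq, ha, if_true]
      rw [ENNReal.ofReal_mul (by norm_num), ← mul_assoc]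
      have : (2 : ℝ≥0∞) * ENNReal.ofReal 2⁻¹ = 1 := by
        rw [← ENNReal.ofReal_ofNat, ← ENNReal.ofReal_mul (by norm_num)]
        norm_num
      rw [this, one_mul]
    · simp [Set.indicator, ha]
  have hm : Measurable (fun z : ℝ × α => {z : ℝ × α | v z.2 < z.1}.indicator
      (fun z => 2 * ENNReal.ofReal (z.1 ^ (-3 : ℝ))) z) :=
    Measurable.indicator (by fun_prop) (measurableSet_lt (hv.comp measurable_snd) measurable_fst)
  refine (lintegral_mono key).trans ?_
  rw [lintegral_lintegral_swap (f := fun a t => {z : ℝ × α | v z.2 < z.1}.indicator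
      (fun z => 2 * ENNReal.ofReal (z.1 ^ (-3 : ℝ))) (t, a))
      (hm.comp measurable_swap).aemeasurable]
  calc _ ≤ ∫⁻ t in Set.Ioi R, 2 * c * ENNReal.ofReal (t ^ (-1 - 1 : ℝ)) := by
        refine setLIntegral_mono' measurableSet_Ioi fun t ht => ?_
        have ht0 : 0 < t := hR.trans ht
        have e : ∀ a, {z : ℝ × α | v z.2 < z.1}.indicator
            (fun z => 2 * ENNReal.ofReal (z.1 ^ (-3 : ℝ))) (t, a) =
            {a | v a < t}.indicator (fun _ => 2 * ENNReal.ofReal (t ^ (-3 : ℝ))) a := by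
          intro a
          by_cases h : v a < t <;> simp [h]
        simp_rw [e]
        rw [lintegral_indicator_const (measurableSet_lt hv measurable_const)]
        refine (mul_le_mul_right (hc t ht0) _).trans (le_of_eq ?_)
        have : (-1 - 1 : ℝ) = -3 + 1 := by norm_num
        rw [this, Real.rpow_add ht0, ENNReal.ofReal_mul (by positivity), Real.rpow_one]
        ring
    _ = _ := by
        rw [lintegral_const_mul _ (by fun_prop), lintegral_Ioi_rpow_neg one_pos hR]
        simp [Real.rpow_neg_one]

variable {V : Type*} [NormedAddCommGroup V] [InnerProductSpace ℝ V] [FiniteDimensional ℝ V]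
  [MeasurableSpace V] [BorelSpace V]

theorem fourier_add_apply {f g : V → ℂ} (hf : Integrable f) (hg : Integrable g) (ξ : V) :
    𝓕 (f + g) ξ = 𝓕 f ξ + 𝓕 g ξ :=
  congrFun (VectorFourier.fourierIntegral_add (L := innerₗ V)
    Real.continuous_fourierChar continuous_inner hf hg) ξ

/-- **Paley's inequality**, with respect to a weight `v` whose sublevel sets grow at most
linearly. -/
theorem lintegral_rpow_mul_fourier_le {v : V → ℝ} (hv : Measurable v) (hv0 : ∀ ξ, 0 < v ξ)
    {c : ℝ≥0∞} (hc : ∀ t, 0 < t → volume {ξ | v ξ < t} ≤ c * ENNReal.ofReal t)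
    {q : ℝ} (hq1 : 1 < q) (hq2 : q < 2) {h : V → ℂ} (hhm : Measurable h) (hh : Integrable h)
    (hh2 : MemLp h 2) :
    ∫⁻ ξ, ENNReal.ofReal (v ξ ^ (q - 2)) * ‖𝓕 h ξ‖ₑ ^ q ≤
      ENNReal.ofReal q * (4 * c * ENNReal.ofReal (q - 1)⁻¹ + 16 * ENNReal.ofReal (2 - q)⁻¹) *
        ∫⁻ x, ‖h x‖ₑ ^ q := by
  set w : V → ℝ≥0∞ := fun ξ => ENNReal.ofReal (v ξ ^ (-2 : ℝ)) with hw
  have hwm : Measurable w := by fun_prop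
  set ν : Measure V := volume.withDensity w with hν
  have hFm : ∀ {f : V → ℂ}, Integrable f → Measurable (𝓕 f) := fun hf =>
    (continuous_fourier hf).measurable
  have hTm : ∀ {f : V → ℂ}, Integrable f → Measurable fun ξ => (v ξ : ℂ) * 𝓕 f ξ := by
    intro f hf
    have := hFm hf
    fun_prop
  have hTn : ∀ (f : V → ℂ) ξ, ‖(v ξ : ℂ) * 𝓕 f ξ‖ = v ξ * ‖𝓕 f ξ‖ := by
    intro f ξ
    rw [norm_mul, Complex.norm_real, Real.norm_of_nonneg (hv0 ξ).le]
  have hL : ∀ {r : ℝ}, 0 ≤ r → ∀ {f : V → ℂ}, Integrable f →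
      ∫⁻ ξ, ENNReal.ofReal (‖(v ξ : ℂ) * 𝓕 f ξ‖ ^ r) ∂ν =
        ∫⁻ ξ, ENNReal.ofReal (v ξ ^ (r - 2)) * ‖𝓕 f ξ‖ₑ ^ r := by
    intro r hr f hf
    have := hTm hf
    rw [hν, lintegral_withDensity_eq_lintegral_mul _ hwm (by fun_prop)]
    refine lintegral_congr fun ξ => ?_
    rw [Pi.mul_apply, hTn, Real.mul_rpow (hv0 ξ).le (norm_nonneg _),
      ENNReal.ofReal_mul (Real.rpow_nonneg (hv0 ξ).le _), ofReal_norm_rpow _ hr, hw, ← mul_assoc,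
      ← ENNReal.ofReal_mul (Real.rpow_nonneg (hv0 ξ).le _), ← Real.rpow_add (hv0 ξ)]
    ring_nf
  have weak : ∀ t : ℝ, 0 < t → ν {ξ | t < ‖(v ξ : ℂ) * 𝓕 h ξ‖} ≤
      4 * c * ENNReal.ofReal t⁻¹ *
        (∫⁻ a, {a | t < ‖h a‖}.indicator (fun a => ENNReal.ofReal (‖h a‖ ^ (1 : ℝ))) a) +
      16 * ENNReal.ofReal (t ^ (-2 : ℝ)) *
        ∫⁻ a, {a | 2⁻¹ * ‖h a‖ < t}.indicator
          (fun a => ENNReal.ofReal ((2⁻¹ * ‖h a‖) ^ (2 : ℝ))) a := by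
    intro t ht
    have hs : MeasurableSet {a | t < ‖h a‖} := measurableSet_lt measurable_const hhm.norm
    set h₁ := {a | t < ‖h a‖}.indicator h with hh₁
    set h₂ := {a | t < ‖h a‖}ᶜ.indicator h with hh₂
    have i₁ : Integrable h₁ := hh.indicator hs
    have i₂ : Integrable h₂ := hh.indicator hs.compl
    have hadd : h = h₁ + h₂ := by rw [hh₁, hh₂, Set.indicator_self_add_compl]
    have hsub : {ξ | t < ‖(v ξ : ℂ) * 𝓕 h ξ‖} ⊆
        {ξ | t / 2 < ‖(v ξ : ℂ) * 𝓕 h₁ ξ‖} ∪ {ξ | t / 2 < ‖(v ξ : ℂ) * 𝓕 h₂ ξ‖} := by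
      intro ξ hξ
      by_contra hcon
      simp only [Set.mem_union, Set.mem_ofPred_eq, not_or, not_lt] at hξ hcon
      rw [hadd, fourier_add_apply i₁ i₂, mul_add] at hξ
      have := norm_add_le ((v ξ : ℂ) * 𝓕 h₁ ξ) ((v ξ : ℂ) * 𝓕 h₂ ξ)
      linarith
    refine (measure_mono hsub).trans ((measure_union_le _ _).trans (add_le_add ?_ ?_))
    · have hN : ∫⁻ a, {a | t < ‖h a‖}.indicator (fun a => ENNReal.ofReal (‖h a‖ ^ (1 : ℝ))) a =
          ∫⁻ a, ‖h₁ a‖ₑ := by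
        refine lintegral_congr fun a => ?_
        by_cases ha : t < ‖h a‖ <;> simp [hh₁, Set.indicator, ha]
      rw [hN]
      have hfin : ∫⁻ a, ‖h₁ a‖ₑ ≠ ⊤ := i₁.2.ne
      set N := (∫⁻ a, ‖h₁ a‖ₑ).toReal with hNdef
      have hb : ∀ ξ, ‖𝓕 h₁ ξ‖ ≤ N := fun ξ => by
        have := ENNReal.toReal_mono hfin (enorm_fourier_le h₁ ξ)
        rwa [toReal_enorm] at this
      rcases (show 0 ≤ N from ENNReal.toReal_nonneg).eq_or_lt with h0 | h0
      · have : {ξ | t / 2 < ‖(v ξ : ℂ) * 𝓕 h₁ ξ‖} = ∅ := by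
          ext ξ
          have h1 : ‖𝓕 h₁ ξ‖ = 0 := le_antisymm (h0 ▸ hb ξ) (norm_nonneg _)
          simp only [Set.mem_ofPred_eq, Set.mem_empty_iff_false, iff_false, not_lt, hTn, h1,
            mul_zero]
          positivity
        rw [this]
        simp
      · have hR : 0 < t / 2 / N := by positivity
        have hsub2 : {ξ | t / 2 < ‖(v ξ : ℂ) * 𝓕 h₁ ξ‖} ⊆ {ξ | t / 2 / N < v ξ} := by
          intro ξ hξ
          simp only [Set.mem_ofPred_eq, hTn] at hξ ⊢
          rw [div_lt_iff₀ h0]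
          exact hξ.trans_le (mul_le_mul_of_nonneg_left (hb ξ) (hv0 ξ).le)
        refine (measure_mono hsub2).trans ?_
        have hms : MeasurableSet {ξ | t / 2 / N < v ξ} := measurableSet_lt measurable_const hv
        rw [hν, withDensity_apply _ hms, ← lintegral_indicator hms]
        refine (lintegral_indicator_lt_rpow_neg_two_le hv hc hR).trans (le_of_eq ?_)
        rw [← ENNReal.ofReal_toReal hfin, ← hNdef]
        have : (t / 2 / N)⁻¹ = 2 * (t⁻¹ * N) := by field_simp
        rw [this, ENNReal.ofReal_mul (by norm_num), ENNReal.ofReal_mul (by positivity),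
          ENNReal.ofReal_ofNat]
        ring
    · refine (meas_lt_norm_le (hTm i₂).aemeasurable (half_pos ht) (r := 2) (by norm_num)).trans ?_
      simp_rw [← ofReal_norm_rpow _ (show (0 : ℝ) ≤ 2 by norm_num)]
      rw [hL (by norm_num) i₂]
      simp only [sub_self, Real.rpow_zero, ENNReal.ofReal_one, one_mul]
      rw [lintegral_fourier_sq i₂ (hh2.indicator hs.compl)]
      have h4 : ∀ a, ‖h₂ a‖ₑ ^ (2 : ℝ) ≤ 4 * {a | 2⁻¹ * ‖h a‖ < t}.indicator
          (fun a => ENNReal.ofReal ((2⁻¹ * ‖h a‖) ^ (2 : ℝ))) a := by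
        intro a
        by_cases ha : t < ‖h a‖
        · simp [hh₂, Set.indicator, ha]
        · have ha' : 2⁻¹ * ‖h a‖ < t := by linarith [norm_nonneg (h a)]
          simp only [hh₂, Set.indicator, Set.mem_compl_iff, Set.mem_ofPred_eq, ha, ha',
            not_false_eq_true, if_true]
          rw [← ofReal_norm_rpow _ (by norm_num), ← ENNReal.ofReal_ofNat 4,
            ← ENNReal.ofReal_mul (by norm_num)]
          refine ENNReal.ofReal_le_ofReal (le_of_eq ?_)
          norm_num
          ring
      refine (mul_le_mul_right (lintegral_mono h4) _).trans (le_of_eq ?_)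
      rw [lintegral_const_mul' _ _ (by simp), ← mul_assoc]
      congr 1
      have : (t / 2) ^ (-2 : ℝ) = 4 * t ^ (-2 : ℝ) := by
        rw [Real.rpow_neg (by positivity), Real.rpow_neg (by positivity), Real.rpow_two,
          Real.rpow_two]
        field_simp
        norm_num
      rw [this, ENNReal.ofReal_mul (by norm_num), ENNReal.ofReal_ofNat]
      ring
  have hpos1 : 0 < q - 1 := by linarith
  have hpos2 : 0 < 2 - q := by linarith
  rw [← hL (by linarith) hh, lintegral_rpow_eq_lintegral_meas_lt_mul _
    (ae_of_all _ fun _ => norm_nonneg _) (hTm hh).norm.aemeasurable (by linarith), mul_assoc]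
  refine mul_le_mul_right ?_ _
  have m₁ : Measurable fun t : ℝ =>
      ∫⁻ a, {a | t < ‖h a‖}.indicator (fun a => ENNReal.ofReal (‖h a‖ ^ (1 : ℝ))) a := by
    have : Measurable (fun z : ℝ × V => {z : ℝ × V | z.1 < ‖h z.2‖}.indicator
        (fun z => ENNReal.ofReal (‖h z.2‖ ^ (1 : ℝ))) z) :=
      Measurable.indicator (by fun_prop)
        (measurableSet_lt measurable_fst (by fun_prop))
    exact this.lintegral_prod_right'
  calc ∫⁻ t in Set.Ioi 0, ν {ξ | t < ‖(v ξ : ℂ) * 𝓕 h ξ‖} * ENNReal.ofReal (t ^ (q - 1))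
      ≤ ∫⁻ t in Set.Ioi 0, (4 * c * (ENNReal.ofReal (t ^ (q - 1 - 1)) *
          ∫⁻ a, {a | t < ‖h a‖}.indicator (fun a => ENNReal.ofReal (‖h a‖ ^ (1 : ℝ))) a) +
        16 * (ENNReal.ofReal (t ^ (q - 2 - 1)) *
          ∫⁻ a, {a | 2⁻¹ * ‖h a‖ < t}.indicator
          (fun a => ENNReal.ofReal ((2⁻¹ * ‖h a‖) ^ (2 : ℝ))) a)) := by
        refine setLIntegral_mono' measurableSet_Ioi fun t ht => ?_
        have ht0 : 0 < t := ht
        refine (mul_le_mul_left (weak t ht) _).trans (le_of_eq ?_)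
        have e1 : t ^ (q - 1 - 1) = t⁻¹ * t ^ (q - 1) := by
          rw [← Real.rpow_neg_one, ← Real.rpow_add ht0]; ring_nf
        have e2 : t ^ (q - 2 - 1) = t ^ (-2 : ℝ) * t ^ (q - 1) := by
          rw [← Real.rpow_add ht0]; ring_nf
        rw [e1, e2, ENNReal.ofReal_mul (by positivity), ENNReal.ofReal_mul (by positivity)]
        ring
    _ = 4 * c * (ENNReal.ofReal (q - 1)⁻¹ * (∫⁻ a, ENNReal.ofReal (‖h a‖ ^ q))) +
        16 * (ENNReal.ofReal (2 - q)⁻¹ * ∫⁻ a, ENNReal.ofReal ((2⁻¹ * ‖h a‖) ^ q)) := by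
        rw [lintegral_add_left (by fun_prop), lintegral_const_mul _ (by fun_prop),
          lintegral_const_mul' _ _ (by simp),
          lintegral_rpow_mul_lintegral_indicator_lt hhm.norm (fun a => norm_nonneg _)
            zero_le_one hq1,
          lintegral_rpow_mul_lintegral_indicator_le (by fun_prop) (fun a => by positivity)
            (by linarith) hq2]
    _ ≤ _ := by
        rw [add_mul, mul_assoc (4 * c), mul_assoc 16]
        have h1 : ∀ a, ENNReal.ofReal (‖h a‖ ^ q) ≤ ‖h a‖ₑ ^ q := fun a =>
          (ofReal_norm_rpow _ (by linarith)).le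
        have h2 : ∀ a, ENNReal.ofReal ((2⁻¹ * ‖h a‖) ^ q) ≤ ‖h a‖ₑ ^ q := fun a => by
          refine le_trans (ENNReal.ofReal_le_ofReal ?_) (h1 a)
          exact Real.rpow_le_rpow (by positivity) (by linarith [norm_nonneg (h a)]) (by linarith)
        gcongr with a a
        · exact h1 a
        · exact h2 a

end Paley

section HardyLittlewoodPaley

variable {V : Type*} [NormedAddCommGroup V] [InnerProductSpace ℝ V] [FiniteDimensional ℝ V]
  [MeasurableSpace V] [BorelSpace V]

theorem enorm_fourierInv_le (f : V → ℂ) (x : V) : ‖𝓕⁻ f x‖ₑ ≤ ∫⁻ t, ‖f t‖ₑ := by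
  rw [Real.fourierInv_eq_fourier_neg]
  exact enorm_fourier_le f _

theorem norm_le_of_integrable_fourier {φ : V → ℂ} (hφc : Continuous φ) (hφ : Integrable φ)
    (hψ : Integrable (𝓕 φ)) (x : V) : ‖φ x‖ ≤ (∫⁻ ξ, ‖𝓕 φ ξ‖ₑ).toReal := by
  have h := enorm_fourierInv_le (𝓕 φ) x
  rw [hφc.fourierInv_fourier_eq hφ hψ] at h
  have h2 := ENNReal.toReal_mono hψ.2.ne h
  rwa [toReal_enorm] at h2

/-- The dual form of Paley's inequality. -/
theorem lintegral_rpow_le_lintegral_rpow_mul_fourier {v : V → ℝ} (hv : Measurable v)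
    (hv0 : ∀ ξ, 0 < v ξ)
    {c : ℝ≥0∞} (hc : ∀ t, 0 < t → volume {ξ | v ξ < t} ≤ c * ENNReal.ofReal t)
    {p q : ℝ} (hp : 2 < p) (hpq : p.HolderConjugate q) {φ : V → ℂ} (hφc : Continuous φ)
    (hφ : Integrable φ) (hψ : Integrable (𝓕 φ)) :
    ∫⁻ x, ‖φ x‖ₑ ^ p ≤
      (ENNReal.ofReal q *
          (4 * c * ENNReal.ofReal (q - 1)⁻¹ + 16 * ENNReal.ofReal (2 - q)⁻¹)) ^ (p - 1) *
        ∫⁻ ξ, ENNReal.ofReal (v ξ ^ (p - 2)) * ‖𝓕 φ ξ‖ₑ ^ p := by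
  have hp0 : 0 < p := by linarith
  have hp1 : 0 < p - 1 := by linarith
  have hqe : q = p / (p - 1) := hpq.conjugate_eq
  have hq1 : 1 < q := hpq.symm.lt
  have hq0 : 0 < q := by linarith
  have hq2 : q < 2 := by rw [hqe, div_lt_iff₀ hp1]; linarith
  set K := ENNReal.ofReal q *
    (4 * c * ENNReal.ofReal (q - 1)⁻¹ + 16 * ENNReal.ofReal (2 - q)⁻¹) with hK
  set M := (∫⁻ ξ, ‖𝓕 φ ξ‖ₑ).toReal with hM
  have hb : ∀ x, ‖φ x‖ ≤ M := norm_le_of_integrable_fourier hφc hφ hψ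
  set h : V → ℂ := fun x => ((‖φ x‖ ^ (p - 2) : ℝ) : ℂ) * (starRingEnd ℂ) (φ x) with hh
  have hhc : Continuous h := by
    have : Continuous fun x => ‖φ x‖ ^ (p - 2) :=
      hφc.norm.rpow_const fun x => Or.inr (by linarith)
    rw [hh]
    fun_prop
  have hhn : ∀ x, ‖h x‖ = ‖φ x‖ ^ (p - 1) := by
    intro x
    rw [hh, norm_mul, Complex.norm_real, Real.norm_of_nonneg (by positivity), RCLike.norm_conj]
    nth_rewrite 2 [← Real.rpow_one ‖φ x‖]
    rw [← Real.rpow_add_of_nonneg (norm_nonneg _) (by linarith) zero_le_one]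
    ring_nf
  have hhb : ∀ x, ‖h x‖ ≤ M ^ (p - 1) := fun x => by
    rw [hhn]
    exact Real.rpow_le_rpow (norm_nonneg _) (hb x) hp1.le
  have hhI : Integrable h := by
    rw [hh]
    refine Integrable.bdd_mul (c := M ^ (p - 2)) ?_ ?_ ?_
    · exact (RCLike.conjCLE (K := ℂ)).toContinuousLinearMap.integrable_comp hφ |>.congr
        (ae_of_all _ fun x => rfl)
    · exact (Complex.continuous_ofReal.comp (hφc.norm.rpow_const fun x =>
        Or.inr (by linarith))).aestronglyMeasurable
    · refine ae_of_all _ fun x => ?_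
      rw [Complex.norm_real, Real.norm_of_nonneg (by positivity)]
      exact Real.rpow_le_rpow (norm_nonneg _) (hb x) (by linarith)
  have hmul : ∀ x, φ x * h x = ((‖φ x‖ ^ p : ℝ) : ℂ) := by
    intro x
    have : φ x * h x = ((‖φ x‖ ^ (p - 2) : ℝ) : ℂ) * (φ x * (starRingEnd ℂ) (φ x)) := by
      rw [hh]; ring
    rw [this, Complex.mul_conj, Complex.normSq_eq_norm_sq, ← Complex.ofReal_mul,
      ← Real.rpow_two, ← Real.rpow_add_of_nonneg (norm_nonneg _) (by linarith) zero_le_two]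
    ring_nf
  set k : V → ℂ := fun x => h (-x) with hk
  have hkI : Integrable k := hhI.comp_neg
  have hkc : Continuous k := by fun_prop
  have hk2 : MemLp k 2 := by
    refine (memLp_two_iff_integrable_sq_norm hkc.aestronglyMeasurable).2 ?_
    simp_rw [sq]
    exact hkI.norm.bdd_mul (c := M ^ (p - 1)) hkc.norm.aestronglyMeasurable
      (ae_of_all _ fun x => by simpa using hhb (-x))
  have hdual : ∫ x, φ x * h x = ∫ ξ, 𝓕 φ ξ * 𝓕 k ξ := by
    rw [← integral_fourier_mul_eq_flip hψ hkI, ← integral_neg_eq_self]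
    refine integral_congr_ae (ae_of_all _ fun x => ?_)
    have := congrFun (hφc.fourierInv_fourier_eq hφ hψ) (-x)
    rw [Real.fourierInv_eq_fourier_neg, neg_neg] at this
    simp only [hk, this]
  have hI : Integrable fun x => ‖φ x‖ ^ p := by
    have := (hhI.bdd_mul (c := M) hφc.aestronglyMeasurable (ae_of_all _ hb)).norm
    refine this.congr (ae_of_all _ fun x => ?_)
    simp only [hmul, Complex.norm_real]
    exact Real.norm_of_nonneg (by positivity)
  have hIe : ∫⁻ x, ‖φ x‖ₑ ^ p = ENNReal.ofReal (∫ x, ‖φ x‖ ^ p) := by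
    rw [ofReal_integral_eq_lintegral_ofReal hI (ae_of_all _ fun x => by positivity)]
    simp_rw [ofReal_norm_rpow _ hp0.le]
  set I := ∫⁻ x, ‖φ x‖ₑ ^ p with hIdef
  set A := ∫⁻ ξ, ENNReal.ofReal (v ξ ^ (p - 2)) * ‖𝓕 φ ξ‖ₑ ^ p with hA
  have hkq : ∫⁻ x, ‖k x‖ₑ ^ q = I := by
    rw [hk, lintegral_neg_eq_self (fun x => ‖h x‖ₑ ^ q)]
    refine lintegral_congr fun x => ?_
    rw [← ofReal_norm_rpow _ hq0.le, hhn, ← Real.rpow_mul (norm_nonneg _), hqe,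
      mul_div_cancel₀ _ hp1.ne', ofReal_norm_rpow _ hp0.le]
  have hholder : I ≤ A ^ (1 / p) * (K * I) ^ (1 / q) := by
    calc I = ‖∫ x, φ x * h x‖ₑ := by
          simp_rw [hmul]
          rw [integral_complex_ofReal, ← ofReal_norm, Complex.norm_real,
            Real.norm_of_nonneg (integral_nonneg fun x => by positivity), hIe]
      _ ≤ ∫⁻ ξ, ‖𝓕 φ ξ * 𝓕 k ξ‖ₑ := by
          rw [hdual]
          exact enorm_integral_le_lintegral_enorm _
      _ = ∫⁻ ξ, ((fun ξ => ENNReal.ofReal (v ξ ^ ((p - 2) / p)) * ‖𝓕 φ ξ‖ₑ) *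
            fun ξ => ENNReal.ofReal (v ξ ^ (-((p - 2) / p))) * ‖𝓕 k ξ‖ₑ) ξ := by
          refine lintegral_congr fun ξ => ?_
          have : ENNReal.ofReal (v ξ ^ ((p - 2) / p)) *
              ENNReal.ofReal (v ξ ^ (-((p - 2) / p))) = 1 := by
            rw [← ENNReal.ofReal_mul (Real.rpow_nonneg (hv0 ξ).le _), ← Real.rpow_add (hv0 ξ)]
            simp
          rw [Pi.mul_apply, mul_mul_mul_comm, this, one_mul, enorm_mul]
      _ ≤ _ := by
          have m1 := (continuous_fourier hφ).measurable
          have m2 := (continuous_fourier hkI).measurable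
          refine (ENNReal.lintegral_mul_le_Lp_mul_Lq _ hpq (by fun_prop) (by fun_prop)).trans ?_
          gcongr
          · refine lintegral_mono fun ξ => le_of_eq ?_
            rw [ENNReal.mul_rpow_of_nonneg _ _ hp0.le,
              ENNReal.ofReal_rpow_of_nonneg (Real.rpow_nonneg (hv0 ξ).le _) hp0.le,
              ← Real.rpow_mul (hv0 ξ).le, div_mul_cancel₀ _ hp0.ne']
          · rw [← hkq]
            refine le_trans (lintegral_mono fun ξ => le_of_eq ?_)
              (lintegral_rpow_mul_fourier_le hv hv0 hc hq1 hq2 hkc.measurable hkI hk2)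
            rw [ENNReal.mul_rpow_of_nonneg _ _ hq0.le,
              ENNReal.ofReal_rpow_of_nonneg (Real.rpow_nonneg (hv0 ξ).le _) hq0.le,
              ← Real.rpow_mul (hv0 ξ).le]
            congr 3
            rw [hqe]
            field_simp
            ring
  have hItop : I ≠ ⊤ := by rw [hIe]; exact ENNReal.ofReal_ne_top
  rcases eq_or_ne I 0 with h0 | h0
  · rw [h0]; exact zero_le
  have hsum : 1 / p + 1 / q = 1 := by simpa using hpq.inv_add_inv_eq_one
  have hIq0 : I ^ (1 / q) ≠ 0 := by simp [h0, hItop]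
  have hIqt : I ^ (1 / q) ≠ ⊤ := ENNReal.rpow_ne_top_of_nonneg (by positivity) hItop
  have hroot : I ^ (1 / p) ≤ A ^ (1 / p) * K ^ (1 / q) := by
    rw [ENNReal.mul_rpow_of_nonneg _ _ (by positivity), ← mul_assoc] at hholder
    have hs : I = I ^ (1 / p) * I ^ (1 / q) := by
      rw [← ENNReal.rpow_add _ _ h0 hItop, hsum, ENNReal.rpow_one]
    nth_rewrite 1 [hs] at hholder
    exact (ENNReal.mul_le_mul_iff_left hIq0 hIqt).1 hholder
  calc I = (I ^ (1 / p)) ^ p := by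
        rw [← ENNReal.rpow_mul, one_div_mul_cancel hp0.ne', ENNReal.rpow_one]
    _ ≤ (A ^ (1 / p) * K ^ (1 / q)) ^ p := ENNReal.rpow_le_rpow hroot hp0.le
    _ = _ := by
        rw [ENNReal.mul_rpow_of_nonneg _ _ hp0.le, ← ENNReal.rpow_mul, ← ENNReal.rpow_mul,
          one_div_mul_cancel hp0.ne', ENNReal.rpow_one, mul_comm]
        congr 2
        rw [hqe]
        field_simp

end HardyLittlewoodPaley

section Young

variable {V : Type*} [NormedAddCommGroup V] [InnerProductSpace ℝ V] [FiniteDimensional ℝ V]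
  [MeasurableSpace V] [BorelSpace V]

/-- Young's convolution inequality `L¹ * Lᵖ ⊆ Lᵖ`. -/
theorem lintegral_convolution_rpow_le {k f : V → ℝ≥0∞} (hk : Measurable k) (hf : Measurable f)
    {p : ℝ} (hp : 1 < p) :
    ∫⁻ x, (∫⁻ y, k y * f (x - y)) ^ p ≤ (∫⁻ y, k y) ^ p * ∫⁻ x, f x ^ p := by
  have hp0 : 0 < p := by linarith
  set q := p / (p - 1) with hq
  have hpq : q.HolderConjugate p := (Real.HolderConjugate.conjExponent hp).symm
  have hq0 : 0 < q := hpq.pos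
  have hpt : ∀ x, (∫⁻ y, k y * f (x - y)) ^ p ≤
      (∫⁻ y, k y) ^ (p - 1) * ∫⁻ y, k y * f (x - y) ^ p := by
    intro x
    have h1 : ∫⁻ y, k y * f (x - y) =
        ∫⁻ y, ((fun y => k y ^ (1 / q)) * fun y => k y ^ (1 / p) * f (x - y)) y := by
      refine lintegral_congr fun y => ?_
      rw [Pi.mul_apply, ← mul_assoc, ← ENNReal.rpow_add_of_nonneg _ _ (by positivity)
        (by positivity)]
      have : 1 / q + 1 / p = 1 := by simpa using hpq.inv_add_inv_eq_one
      rw [this, ENNReal.rpow_one]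
    rw [h1]
    refine (ENNReal.rpow_le_rpow (ENNReal.lintegral_mul_le_Lp_mul_Lq _ hpq (by fun_prop)
      (by fun_prop)) hp0.le).trans (le_of_eq ?_)
    rw [ENNReal.mul_rpow_of_nonneg _ _ hp0.le, ← ENNReal.rpow_mul, ← ENNReal.rpow_mul,
      one_div_mul_cancel hp0.ne', ENNReal.rpow_one]
    congr 1
    · congr 1
      · refine lintegral_congr fun y => ?_
        rw [← ENNReal.rpow_mul, one_div_mul_cancel hq0.ne', ENNReal.rpow_one]
      · rw [hq]
        have : p - 1 ≠ 0 := by linarith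
        field_simp
    · refine lintegral_congr fun y => ?_
      rw [ENNReal.mul_rpow_of_nonneg _ _ hp0.le, ← ENNReal.rpow_mul, one_div_mul_cancel hp0.ne',
        ENNReal.rpow_one]
  calc _ ≤ ∫⁻ x, (∫⁻ y, k y) ^ (p - 1) * ∫⁻ y, k y * f (x - y) ^ p := lintegral_mono hpt
    _ = (∫⁻ y, k y) ^ (p - 1) * ((∫⁻ y, k y) * ∫⁻ x, f x ^ p) := by
        rw [lintegral_const_mul _ (Measurable.lintegral_prod_right' (f := fun z : V × V =>
          k z.2 * f (z.1 - z.2) ^ p) (by fun_prop)), lintegral_lintegral_swap (by fun_prop)]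
        congr 1
        rw [← lintegral_mul_const _ hk]
        refine lintegral_congr fun y => ?_
        dsimp only
        rw [lintegral_const_mul _ (by fun_prop), lintegral_sub_right_eq_self (fun x => f x ^ p) y]
    _ = _ := by
        rw [← mul_assoc]
        congr 1
        nth_rewrite 2 [← ENNReal.rpow_one (∫⁻ y, k y)]
        rw [← ENNReal.rpow_add_of_nonneg _ _ (by linarith) zero_le_one]
        ring_nf

theorem continuous_fourierInv {f : V → ℂ} (hf : Integrable f) : Continuous (𝓕⁻ f) := by
  have : 𝓕⁻ f = fun x => 𝓕 f (-x) := funext fun x => Real.fourierInv_eq_fourier_neg f x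
  rw [this]
  exact (continuous_fourier hf).comp continuous_neg

theorem fourierInv_mul_eq_integral {a m : V → ℂ} (ha : Integrable a) (hmc : Continuous m)
    (hm : Integrable m) (hK : Integrable (𝓕 m)) (x : V) :
    𝓕⁻ (fun η => a η * m η) x = ∫ y, 𝓕⁻ m y * 𝓕⁻ a (x - y) := by
  set b : V → ℂ := fun η => Real.fourierChar (inner ℝ η x) • a η with hb
  have hbI : Integrable b := by
    refine (integrable_norm_iff ?_).1 (ha.norm.congr (ae_of_all _ fun η => ?_))
    · exact AEStronglyMeasurable.smul (f := fun η : V => Real.fourierChar (inner ℝ η x))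
        (Real.continuous_fourierChar.comp (by fun_prop)).aestronglyMeasurable ha.1
    · simp [hb]
  have hK' : Integrable (𝓕⁻ m) := hK.comp_neg.congr
    (ae_of_all _ fun y => (Real.fourierInv_eq_fourier_neg m y).symm)
  have h := integral_fourier_mul_eq_flip hK' hbI
  rw [hmc.fourier_fourierInv_eq hm hK] at h
  have e1 : 𝓕⁻ (fun η => a η * m η) x = ∫ η, m η * b η := by
    rw [Real.fourierInv_eq]
    refine integral_congr_ae (ae_of_all _ fun η => ?_)
    simp only [hb, Circle.smul_def, smul_eq_mul]
    ring
  rw [e1, h]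
  refine integral_congr_ae (ae_of_all _ fun y => ?_)
  have : 𝓕 b y = 𝓕⁻ a (x - y) := by
    rw [Real.fourier_eq, Real.fourierInv_eq]
    refine integral_congr_ae (ae_of_all _ fun η => ?_)
    simp only [hb, smul_smul, ← AddChar.map_add_eq_mul, inner_sub_right]
    congr 2
    ring
  simp only [this]

/-- A Fourier multiplier whose kernel is integrable is bounded on `Lᵖ`. -/
theorem lintegral_fourierInv_mul_rpow_le {a m : V → ℂ} (ha : Integrable a) (hmc : Continuous m)
    (hm : Integrable m) (hK : Integrable (𝓕 m)) {p : ℝ} (hp : 1 < p) :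
    ∫⁻ x, ‖𝓕⁻ (fun η => a η * m η) x‖ₑ ^ p ≤
      (∫⁻ y, ‖𝓕 m y‖ₑ) ^ p * ∫⁻ x, ‖𝓕⁻ a x‖ₑ ^ p := by
  have e : ∫⁻ y, ‖𝓕 m y‖ₑ = ∫⁻ y, ‖𝓕⁻ m y‖ₑ := by
    simp_rw [Real.fourierInv_eq_fourier_neg]
    exact (lintegral_neg_eq_self (fun y => ‖𝓕 m y‖ₑ)).symm
  rw [e]
  refine le_trans (lintegral_mono fun x => ENNReal.rpow_le_rpow ?_ (by linarith))
    (lintegral_convolution_rpow_le (continuous_fourierInv hm).measurable.enorm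
      (continuous_fourierInv ha).measurable.enorm hp)
  rw [fourierInv_mul_eq_integral ha hmc hm hK]
  refine (enorm_integral_le_lintegral_enorm _).trans (le_of_eq ?_)
  simp_rw [enorm_mul]

end Young

section Gaussian

variable {V : Type*} [NormedAddCommGroup V]

/-- The Gaussian `e^{-a|t|²}`. -/
def gauss (a : ℝ) (t : V) : ℂ := (Real.exp (-a * ‖t‖ ^ 2) : ℝ)

theorem continuous_gauss (a : ℝ) : Continuous (gauss a : V → ℂ) := by
  unfold gauss
  fun_prop

theorem norm_gauss (a : ℝ) (t : V) : ‖gauss a t‖ = Real.exp (-a * ‖t‖ ^ 2) := by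
  rw [gauss, Complex.norm_real, Real.norm_of_nonneg (Real.exp_pos _).le]

theorem norm_gauss_le_one {a : ℝ} (ha : 0 ≤ a) (t : V) : ‖gauss a t‖ ≤ 1 := by
  rw [norm_gauss, Real.exp_le_one_iff]
  nlinarith [mul_nonneg ha (sq_nonneg ‖t‖)]

variable [InnerProductSpace ℝ V] [FiniteDimensional ℝ V] [MeasurableSpace V] [BorelSpace V]

theorem integrable_exp_neg_mul_sq_norm {a : ℝ} (ha : 0 < a) :
    Integrable fun t : V => Real.exp (-a * ‖t‖ ^ 2) := by
  refine Integrable.of_integral_ne_zero ?_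
  rw [GaussianFourier.integral_rexp_neg_mul_sq_norm ha]
  positivity

theorem integrable_gauss {a : ℝ} (ha : 0 < a) : Integrable (gauss a : V → ℂ) :=
  (integrable_exp_neg_mul_sq_norm ha).ofReal

theorem lintegral_gauss {a : ℝ} (ha : 0 < a) :
    ∫⁻ t : V, ‖gauss a t‖ₑ = ENNReal.ofReal ((π / a) ^ ((Module.finrank ℝ V : ℝ) / 2)) := by
  simp_rw [← ofReal_norm, norm_gauss]
  rw [← ofReal_integral_eq_lintegral_ofReal (integrable_exp_neg_mul_sq_norm ha)
    (ae_of_all _ fun t => (Real.exp_pos _).le), GaussianFourier.integral_rexp_neg_mul_sq_norm ha]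

theorem fourier_gauss_sub {a : ℝ} (ha : 0 < a) (c y : V) :
    𝓕 (fun η => gauss a (η - c)) y = Real.fourierChar (-⟪c, y⟫) •
      (((π / a) ^ ((Module.finrank ℝ V : ℝ) / 2) * Real.exp (-(π ^ 2 / a) * ‖y‖ ^ 2) : ℝ) : ℂ) := by
  have h := congrFun (VectorFourier.fourierIntegral_comp_add_right Real.fourierChar
    (volume : Measure V) (innerₗ V) (gauss a) (-c)) y
  have h1 : VectorFourier.fourierIntegral Real.fourierChar volume (innerₗ V)
      (gauss a ∘ fun v => v + -c) y = 𝓕 (fun η => gauss a (η - c)) y := by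
    simp_rw [sub_eq_add_neg]
    rfl
  have h2 : VectorFourier.fourierIntegral Real.fourierChar volume (innerₗ V) (gauss a) y =
      𝓕 (gauss a : V → ℂ) y := rfl
  have h3 : 𝓕 (gauss a : V → ℂ) y =
      (((π / a) ^ ((Module.finrank ℝ V : ℝ) / 2) * Real.exp (-(π ^ 2 / a) * ‖y‖ ^ 2) : ℝ) : ℂ) := by
    have := fourier_gaussian_innerProductSpace (b := (a : ℂ)) (by simpa using ha) y
    have e : (gauss a : V → ℂ) = fun v => Complex.exp (-(a : ℂ) * (‖v‖ : ℂ) ^ 2) := by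
      ext v; simp [gauss]
    rw [e, this]
    push_cast
    congr 1
    · rw [← Complex.ofReal_div, Complex.ofReal_cpow (by positivity)]
      simp
    · congr 1
      ring
  rw [h1, h2, h3] at h
  rw [h]
  simp

theorem enorm_fourier_gauss_sub {a : ℝ} (ha : 0 < a) (c y : V) :
    ‖𝓕 (fun η => gauss a (η - c)) y‖ₑ =
      ENNReal.ofReal ((π / a) ^ ((Module.finrank ℝ V : ℝ) / 2)) * ‖gauss (π ^ 2 / a) y‖ₑ := by
  rw [fourier_gauss_sub ha, ← ofReal_norm, Circle.norm_smul, Complex.norm_real,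
    Real.norm_of_nonneg (by positivity), ENNReal.ofReal_mul (by positivity), ← ofReal_norm,
    norm_gauss]

theorem lintegral_enorm_fourier_gauss_sub {a : ℝ} (ha : 0 < a) (c : V) :
    ∫⁻ y, ‖𝓕 (fun η => gauss a (η - c)) y‖ₑ = 1 := by
  simp_rw [enorm_fourier_gauss_sub ha]
  rw [lintegral_const_mul' _ _ ENNReal.ofReal_ne_top, lintegral_gauss (by positivity),
    ← ENNReal.ofReal_mul (by positivity), ← Real.mul_rpow (by positivity) (by positivity)]
  have : π / a * (π / (π ^ 2 / a)) = 1 := by field_simp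
  simp [this]

end Gaussian

section BesselKernel

theorem integrableOn_rpow_mul_exp_neg_mul {r b : ℝ} (hr : 0 < r) (hb : 0 < b) :
    IntegrableOn (fun s => s ^ (r - 1) * Real.exp (-(b * s))) (Set.Ioi 0) := by
  refine Integrable.of_integral_ne_zero ?_
  rw [Real.integral_rpow_mul_exp_neg_mul_Ioi hr hb]
  have := Real.Gamma_pos_of_pos hr
  positivity

theorem lintegral_rpow_mul_exp_neg_mul {r b : ℝ} (hr : 0 < r) (hb : 0 < b) :
    ∫⁻ s in Set.Ioi (0 : ℝ), ENNReal.ofReal (s ^ (r - 1) * Real.exp (-(b * s))) =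
      ENNReal.ofReal ((1 / b) ^ r * Real.Gamma r) := by
  rw [← Real.integral_rpow_mul_exp_neg_mul_Ioi hr hb, ofReal_integral_eq_lintegral_ofReal
    (integrableOn_rpow_mul_exp_neg_mul hr hb)]
  filter_upwards [ae_restrict_mem measurableSet_Ioi] with s hs
  have : 0 ≤ s := le_of_lt hs
  positivity

theorem rpow_mul_exp_neg_le {r A : ℝ} (hr : 0 < r) (hA : 0 < A) :
    Real.exp (-A) ≤ r ^ r * A ^ (-r) := by
  have h1 : A / r ≤ Real.exp (A / r) := by linarith [Real.add_one_le_exp (A / r)]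
  have h2 : (A / r) ^ r ≤ Real.exp A := by
    calc (A / r) ^ r ≤ Real.exp (A / r) ^ r := Real.rpow_le_rpow (by positivity) h1 hr.le
      _ = Real.exp A := by rw [← Real.exp_mul, div_mul_cancel₀ _ hr.ne']
  rw [Real.div_rpow hA.le hr.le, div_le_iff₀ (by positivity)] at h2
  rw [Real.exp_neg, Real.rpow_neg hA.le, ← div_eq_mul_inv, inv_eq_one_div,
    div_le_div_iff₀ (Real.exp_pos _) (by positivity)]
  linarith

variable {V : Type*} [NormedAddCommGroup V]

/-- A Gaussian centred at `ξ`, multiplied with the symbol `⟨η⟩^{-2r}` of a Bessel potential. -/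
def besselGauss (r : ℝ) (ξ η : V) : ℂ :=
  (((1 + ‖η‖ ^ 2) ^ (-r) * Real.exp (-π * ‖η - ξ‖ ^ 2) : ℝ) : ℂ)

theorem continuous_besselGauss (r : ℝ) (ξ : V) : Continuous (besselGauss r ξ) := by
  have : Continuous fun η : V => (1 + ‖η‖ ^ 2) ^ (-r) :=
    Continuous.rpow_const (by fun_prop) fun η => Or.inl (by positivity)
  unfold besselGauss
  fun_prop

theorem norm_besselGauss (r : ℝ) (ξ η : V) :
    ‖besselGauss r ξ η‖ = (1 + ‖η‖ ^ 2) ^ (-r) * Real.exp (-π * ‖η - ξ‖ ^ 2) := by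
  rw [besselGauss, Complex.norm_real, Real.norm_of_nonneg (by positivity)]

/-- The phase that remains after completing the square in `s⟨η⟩² + π|η - ξ|²`. -/
def besselPhase (ξ : V) (s : ℝ) : ℝ := s + ‖ξ‖ ^ 2 * (s * π / (s + π))

theorem exp_neg_besselPhase_le (ξ : V) {s : ℝ} (hs : 0 < s) :
    Real.exp (-besselPhase ξ s) ≤ Real.exp (-((1 + ‖ξ‖ ^ 2) / 2 * s)) +
      Real.exp (-(1 + ‖ξ‖ ^ 2)) * Real.exp (-(1 / 2 * s)) := by
  have hpi := Real.pi_gt_three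
  have hsp : 0 < s + π := by positivity
  have hx := sq_nonneg ‖ξ‖
  rcases le_total s π with h | h
  · have h1 : s / 2 ≤ s * π / (s + π) := by
      rw [div_le_div_iff₀ two_pos hsp]; nlinarith
    have h2 : Real.exp (-besselPhase ξ s) ≤ Real.exp (-((1 + ‖ξ‖ ^ 2) / 2 * s)) := by
      rw [Real.exp_le_exp, besselPhase]
      nlinarith [mul_le_mul_of_nonneg_left h1 hx]
    exact h2.trans (le_add_of_nonneg_right (by positivity))
  · have h1 : 1 ≤ s * π / (s + π) := by
      rw [le_div_iff₀ hsp]; nlinarith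
    have h2 : Real.exp (-besselPhase ξ s) ≤
        Real.exp (-(1 + ‖ξ‖ ^ 2)) * Real.exp (-(1 / 2 * s)) := by
      rw [← Real.exp_add, Real.exp_le_exp, besselPhase]
      nlinarith [mul_le_mul_of_nonneg_left h1 hx]
    exact h2.trans (le_add_of_nonneg_left (by positivity))

theorem lintegral_rpow_mul_exp_neg_besselPhase_le {r : ℝ} (hr : 0 < r) (ξ : V) :
    ∫⁻ s in Set.Ioi (0 : ℝ), ENNReal.ofReal (s ^ (r - 1) * Real.exp (-besselPhase ξ s)) ≤
      ENNReal.ofReal (2 ^ r * (1 + r ^ r) * Real.Gamma r * (1 + ‖ξ‖ ^ 2) ^ (-r)) := by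
  set A := 1 + ‖ξ‖ ^ 2 with hA
  have hA0 : 0 < A := by positivity
  have hG := Real.Gamma_pos_of_pos hr
  calc _ ≤ ∫⁻ s in Set.Ioi (0 : ℝ), (ENNReal.ofReal (s ^ (r - 1) * Real.exp (-(A / 2 * s))) +
        ENNReal.ofReal (Real.exp (-A)) *
          ENNReal.ofReal (s ^ (r - 1) * Real.exp (-(1 / 2 * s)))) := by
        refine setLIntegral_mono' measurableSet_Ioi fun s hs => ?_
        have hs0 : 0 < s := hs
        rw [← ENNReal.ofReal_mul (by positivity), ← ENNReal.ofReal_add (by positivity)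
          (by positivity)]
        refine ENNReal.ofReal_le_ofReal ?_
        refine (mul_le_mul_of_nonneg_left (exp_neg_besselPhase_le ξ hs0)
          (by positivity)).trans (le_of_eq ?_)
        rw [← hA]
        ring
    _ = ENNReal.ofReal ((1 / (A / 2)) ^ r * Real.Gamma r) + ENNReal.ofReal (Real.exp (-A)) *
          ENNReal.ofReal ((1 / (1 / 2)) ^ r * Real.Gamma r) := by
        rw [lintegral_add_left (by fun_prop), lintegral_const_mul' _ _ ENNReal.ofReal_ne_top,
          lintegral_rpow_mul_exp_neg_mul hr (by positivity),
          lintegral_rpow_mul_exp_neg_mul hr (by norm_num)]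
    _ ≤ _ := by
        rw [← ENNReal.ofReal_mul (by positivity), ← ENNReal.ofReal_add (by positivity)
          (by positivity)]
        refine ENNReal.ofReal_le_ofReal ?_
        have e1 : (1 / (A / 2)) ^ r = 2 ^ r * A ^ (-r) := by
          rw [one_div_div, Real.div_rpow zero_le_two hA0.le, Real.rpow_neg hA0.le, div_eq_mul_inv]
        have e2 : (1 / (1 / 2) : ℝ) = 2 := by norm_num
        rw [e1, e2]
        have := mul_le_mul_of_nonneg_right (rpow_mul_exp_neg_le hr hA0)
          (show 0 ≤ 2 ^ r * Real.Gamma r by positivity)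
        linarith

theorem Gamma_mul_besselGauss {r : ℝ} (hr : 0 < r) (ξ η : V) :
    ((∫ s in Set.Ioi (0 : ℝ), s ^ (r - 1) * Real.exp (-((1 + ‖η‖ ^ 2) * s)) *
      Real.exp (-π * ‖η - ξ‖ ^ 2) : ℝ) : ℂ) = Real.Gamma r * besselGauss r ξ η := by
  rw [integral_mul_const, Real.integral_rpow_mul_exp_neg_mul_Ioi hr (by positivity), besselGauss,
    ← Complex.ofReal_mul, one_div, Real.inv_rpow (by positivity), Real.rpow_neg (by positivity)]
  congr 1
  ring

variable [InnerProductSpace ℝ V]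

theorem exp_neg_mul_mul_exp_eq (ξ η : V) {s : ℝ} (hs : 0 < s) :
    Real.exp (-((1 + ‖η‖ ^ 2) * s)) * Real.exp (-π * ‖η - ξ‖ ^ 2) =
      Real.exp (-besselPhase ξ s) * Real.exp (-(s + π) * ‖η - (π / (s + π)) • ξ‖ ^ 2) := by
  have hsp : s + π ≠ 0 := by positivity
  rw [← Real.exp_add, ← Real.exp_add, besselPhase, norm_sub_sq_real, norm_sub_sq_real,
    inner_smul_right, norm_smul, Real.norm_of_nonneg (by positivity)]
  congr 1
  field_simp
  ring

variable [FiniteDimensional ℝ V] [MeasurableSpace V] [BorelSpace V]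

theorem integrable_besselGauss {r : ℝ} (hr : 0 ≤ r) (ξ : V) : Integrable (besselGauss r ξ) := by
  refine ((integrable_gauss Real.pi_pos).comp_sub_right ξ).mono
    (continuous_besselGauss r ξ).aestronglyMeasurable (ae_of_all _ fun η => ?_)
  rw [norm_besselGauss, norm_gauss]
  refine mul_le_of_le_one_left (Real.exp_pos _).le ?_
  exact Real.rpow_le_one_of_one_le_of_nonpos (by nlinarith [sq_nonneg ‖η‖]) (by linarith)

theorem Gamma_mul_enorm_fourier_besselGauss_le {r : ℝ} (hr : 0 < r) (ξ y : V) :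
    ENNReal.ofReal (Real.Gamma r) * ‖𝓕 (besselGauss r ξ) y‖ₑ ≤
      ∫⁻ s in Set.Ioi (0 : ℝ), ENNReal.ofReal (s ^ (r - 1) * Real.exp (-besselPhase ξ s)) *
        (ENNReal.ofReal ((π / (s + π)) ^ ((Module.finrank ℝ V : ℝ) / 2)) *
          ‖gauss (π ^ 2 / (s + π)) y‖ₑ) := by
  have hG := Real.Gamma_pos_of_pos hr
  set F : V → ℝ → ℝ := fun η s => s ^ (r - 1) * Real.exp (-((1 + ‖η‖ ^ 2) * s)) *
    Real.exp (-π * ‖η - ξ‖ ^ 2) with hF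
  set H : V → ℝ → ℂ := fun η s => Real.fourierChar (-⟪η, y⟫) • (F η s : ℂ) with hH
  have hHn : ∀ η, ∀ s ∈ Set.Ioi (0 : ℝ), ‖H η s‖ = F η s := by
    intro η s hs
    have : 0 < s := hs
    rw [hH, Circle.norm_smul, Complex.norm_real, Real.norm_of_nonneg (by positivity)]
  have hFI : ∀ η, IntegrableOn (F η) (Set.Ioi 0) := fun η =>
    (integrableOn_rpow_mul_exp_neg_mul hr (by positivity)).mul_const _
  have hHm : AEStronglyMeasurable (Function.uncurry H)
      ((volume : Measure V).prod (volume.restrict (Set.Ioi (0 : ℝ)))) := by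
    refine AEStronglyMeasurable.smul (f := fun z : V × ℝ => Real.fourierChar (-⟪z.1, y⟫)) ?_ ?_
    · exact (Real.continuous_fourierChar.comp (by fun_prop)).aestronglyMeasurable
    · exact Measurable.aestronglyMeasurable (by fun_prop)
  have hHint : Integrable (Function.uncurry H)
      ((volume : Measure V).prod (volume.restrict (Set.Ioi (0 : ℝ)))) := by
    refine (integrable_prod_iff hHm).2 ⟨ae_of_all _ fun η => ?_, ?_⟩
    · simp only [Function.uncurry, hH]
      exact (hFI η).ofReal.smul (Real.fourierChar (-⟪η, y⟫) : ℂ)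
    · refine ((integrable_besselGauss hr.le ξ).norm.const_mul (Real.Gamma r)).congr
        (ae_of_all _ fun η => ?_)
      simp only [Function.uncurry]
      rw [setIntegral_congr_fun measurableSet_Ioi (hHn η)]
      have h := congrArg norm (Gamma_mul_besselGauss hr ξ η)
      rw [norm_mul, Complex.norm_real, Complex.norm_real, Real.norm_of_nonneg hG.le,
        Real.norm_of_nonneg] at h
      · exact h.symm
      · refine setIntegral_nonneg measurableSet_Ioi fun s hs => ?_
        have : 0 < s := hs
        positivity
  have h1 : (Real.Gamma r : ℂ) * 𝓕 (besselGauss r ξ) y =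
      ∫ s in Set.Ioi (0 : ℝ), ∫ η, H η s := by
    rw [← integral_integral_swap hHint, Real.fourier_eq, ← integral_const_mul]
    refine integral_congr_ae (ae_of_all _ fun η => ?_)
    simp only [hH]
    rw [mul_smul_comm, ← Gamma_mul_besselGauss hr, ← integral_complex_ofReal]
    simp only [Circle.smul_def]
    rw [integral_smul]
  have h2 : ENNReal.ofReal (Real.Gamma r) * ‖𝓕 (besselGauss r ξ) y‖ₑ =
      ‖(Real.Gamma r : ℂ) * 𝓕 (besselGauss r ξ) y‖ₑ := by
    rw [enorm_mul, ← ofReal_norm (Real.Gamma r : ℂ), Complex.norm_real, Real.norm_of_nonneg hG.le]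
  rw [h2, h1]
  refine (enorm_integral_le_lintegral_enorm _).trans ?_
  refine setLIntegral_mono' measurableSet_Ioi fun s hs => le_of_eq ?_
  have hs0 : 0 < s := hs
  have h3 : ∫ η, H η s = ((s ^ (r - 1) * Real.exp (-besselPhase ξ s) : ℝ) : ℂ) *
      𝓕 (fun η => gauss (s + π) (η - (π / (s + π)) • ξ)) y := by
    rw [Real.fourier_eq, ← integral_const_mul]
    refine integral_congr_ae (ae_of_all _ fun η => ?_)
    simp only [hH, hF]
    rw [mul_assoc, exp_neg_mul_mul_exp_eq ξ η hs0, ← mul_assoc, Complex.ofReal_mul, mul_smul_comm,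
      gauss]
  rw [h3, enorm_mul, enorm_fourier_gauss_sub (by positivity), ← ofReal_norm,
    Complex.norm_real, Real.norm_of_nonneg (by positivity)]

theorem lintegral_enorm_fourier_besselGauss_le {r : ℝ} (hr : 0 < r) (ξ : V) :
    ∫⁻ y, ‖𝓕 (besselGauss r ξ) y‖ₑ ≤
      ENNReal.ofReal (2 ^ r * (1 + r ^ r) * (1 + ‖ξ‖ ^ 2) ^ (-r)) := by
  have hG := Real.Gamma_pos_of_pos hr
  have hG0 : ENNReal.ofReal (Real.Gamma r) ≠ 0 := by simpa using hG
  rw [← ENNReal.mul_le_mul_iff_right hG0 ENNReal.ofReal_ne_top,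
    ← lintegral_const_mul' _ _ ENNReal.ofReal_ne_top]
  refine (lintegral_mono fun y => Gamma_mul_enorm_fourier_besselGauss_le hr ξ y).trans ?_
  rw [lintegral_lintegral_swap]
  · refine le_trans (le_of_eq ?_) ((lintegral_rpow_mul_exp_neg_besselPhase_le hr ξ).trans
      (le_of_eq ?_))
    · refine setLIntegral_congr_fun measurableSet_Ioi fun s hs => ?_
      have hs0 : 0 < s := hs
      rw [lintegral_const_mul' _ _ ENNReal.ofReal_ne_top]
      simp_rw [← enorm_fourier_gauss_sub (show 0 < s + π by positivity) (0 : V)]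
      rw [lintegral_enorm_fourier_gauss_sub (by positivity), mul_one]
    · rw [← ENNReal.ofReal_mul hG.le]
      congr 1
      ring
  · refine Measurable.aemeasurable ?_
    unfold besselPhase gauss Function.uncurry
    fun_prop

theorem integrable_fourier_besselGauss {r : ℝ} (hr : 0 < r) (ξ : V) :
    Integrable (𝓕 (besselGauss r ξ)) :=
  ⟨(continuous_fourier (integrable_besselGauss hr.le ξ)).aestronglyMeasurable,
    (lintegral_enorm_fourier_besselGauss_le hr ξ).trans_lt ENNReal.ofReal_lt_top⟩

end BesselKernel

section GaussianWindow

theorem enorm_gauss_rpow {V : Type*} [NormedAddCommGroup V] (a : ℝ) {p : ℝ} (hp : 0 ≤ p) (t : V) :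
    ‖gauss a t‖ₑ ^ p = ‖gauss (a * p) t‖ₑ := by
  rw [← ofReal_norm_rpow _ hp, ← ofReal_norm, norm_gauss, norm_gauss, ← Real.exp_mul]
  ring_nf

variable {V : Type*} [NormedAddCommGroup V] [InnerProductSpace ℝ V] [FiniteDimensional ℝ V]
  [MeasurableSpace V] [BorelSpace V]

theorem fourier_fourierChar_smul (g : V → ℂ) (ξ η : V) :
    𝓕 (fun t => Real.fourierChar ⟪t, ξ⟫ • g t) η = 𝓕 g (η - ξ) := by
  rw [Real.fourier_eq, Real.fourier_eq]
  refine integral_congr_ae (ae_of_all _ fun t => ?_)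
  simp only [smul_smul, ← AddChar.map_add_eq_mul, inner_sub_right]
  congr 2
  ring

theorem enorm_windowedFourier_gauss {b : ℝ} (hb : 0 < b) {u : V → ℂ} (huc : Continuous u)
    (hu : Integrable u) (hU : Integrable (𝓕 u)) (x ξ : V) :
    ‖windowedFourier (gauss b) u x ξ‖ₑ =
      ENNReal.ofReal ((π / b) ^ ((Module.finrank ℝ V : ℝ) / 2)) *
        ‖𝓕⁻ (fun η => 𝓕 u η * gauss (π ^ 2 / b) (η - ξ)) x‖ₑ := by
  set g : V → ℂ := fun t => Real.fourierChar ⟪t, ξ⟫ • gauss b (t - -x) with hg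
  have hgI : Integrable g := by
    refine (integrable_norm_iff ?_).1 (((integrable_gauss hb).comp_sub_right (-x)).norm.congr
      (ae_of_all _ fun t => by simp [hg]))
    refine AEStronglyMeasurable.smul (f := fun t : V => Real.fourierChar ⟪t, ξ⟫) ?_ ?_
    · exact (Real.continuous_fourierChar.comp (by fun_prop)).aestronglyMeasurable
    · exact ((continuous_gauss b).comp (by fun_prop)).aestronglyMeasurable
  have h1 : windowedFourier (gauss b) u x ξ = ∫ t, 𝓕 (𝓕 u) t * g t := by
    rw [windowedFourier, Real.fourier_eq, ← integral_neg_eq_self]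
    refine integral_congr_ae (ae_of_all _ fun t => ?_)
    have h := congrFun (huc.fourierInv_fourier_eq hu hU) (-t)
    rw [Real.fourierInv_eq_fourier_neg, neg_neg] at h
    have e : gauss b (-t - x) = gauss b (t - -x) := by
      rw [gauss, gauss, ← norm_neg, neg_sub, sub_neg_eq_add, sub_neg_eq_add, add_comm]
    simp only [hg, h, inner_neg_left, neg_neg, e]
    rw [mul_smul_comm]
  have h2 : ∫ η, 𝓕 u η * 𝓕 g η = Real.fourierChar (-⟪x, ξ⟫) •
      ((((π / b) ^ ((Module.finrank ℝ V : ℝ) / 2) : ℝ) : ℂ) *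
        𝓕⁻ (fun η => 𝓕 u η * gauss (π ^ 2 / b) (η - ξ)) x) := by
    rw [Real.fourierInv_eq, ← integral_const_mul]
    simp only [Circle.smul_def]
    rw [← integral_smul]
    refine integral_congr_ae (ae_of_all _ fun η => ?_)
    simp only [hg]
    rw [fourier_fourierChar_smul, fourier_gauss_sub hb]
    have e : Real.fourierChar (-⟪-x, η - ξ⟫) =
        Real.fourierChar (-⟪x, ξ⟫) * Real.fourierChar ⟪η, x⟫ := by
      rw [← AddChar.map_add_eq_mul, inner_neg_left, inner_sub_right, real_inner_comm η x]
      congr 1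
      ring
    rw [e, Circle.smul_def, Circle.coe_mul, gauss]
    simp only [smul_eq_mul, Complex.ofReal_mul]
    ring
  rw [h1, integral_fourier_mul_eq_flip hU hgI, h2, ← ofReal_norm, Circle.norm_smul, ofReal_norm,
    enorm_mul, ← ofReal_norm, Complex.norm_real, Real.norm_of_nonneg (by positivity)]

theorem integrable_windowedFourier_gauss {b : ℝ} (hb : 0 < b) {u : V → ℂ} (huc : Continuous u)
    (hu : Integrable u) (hU : Integrable (𝓕 u)) (x : V) :
    Integrable (windowedFourier (gauss b) u x) := by
  have hI : Integrable (fun t => u t * gauss b (t - x)) :=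
    integrable_mul_window (continuous_gauss b).measurable (norm_gauss_le_one hb.le) hu x
  refine ⟨(continuous_fourier hI).aestronglyMeasurable, ?_⟩
  have hUm : Measurable (𝓕 u) := (continuous_fourier hu).measurable
  have ha : 0 < π ^ 2 / b := by positivity
  rw [hasFiniteIntegral_iff_enorm]
  calc ∫⁻ ξ, ‖windowedFourier (gauss b) u x ξ‖ₑ
      ≤ ∫⁻ ξ, ENNReal.ofReal ((π / b) ^ ((Module.finrank ℝ V : ℝ) / 2)) *
          ∫⁻ η, ‖𝓕 u η * gauss (π ^ 2 / b) (η - ξ)‖ₑ ^ (1 : ℝ) := by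
        refine lintegral_mono fun ξ => ?_
        rw [enorm_windowedFourier_gauss hb huc hu hU]
        simp_rw [ENNReal.rpow_one]
        exact mul_le_mul_right (enorm_fourierInv_le _ _) _
    _ < ⊤ := by
        rw [lintegral_const_mul' _ _ ENNReal.ofReal_ne_top,
          lintegral_lintegral_enorm_mul_window (continuous_gauss _).measurable hUm zero_le_one]
        simp_rw [ENNReal.rpow_one]
        exact ENNReal.mul_lt_top ENNReal.ofReal_lt_top
          (ENNReal.mul_lt_top hU.2 (integrable_gauss ha).2)

/-- `L^p` control of a function by a weighted norm of its short-time Fourier transform. -/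
theorem lintegral_rpow_le_lintegral_windowedFourier {v : V → ℝ} (hv : Measurable v)
    (hv0 : ∀ ξ, 0 < v ξ)
    {c : ℝ≥0∞} (hc' : c ≠ ⊤) (hc : ∀ t, 0 < t → volume {ξ | v ξ < t} ≤ c * ENNReal.ofReal t)
    {p b : ℝ} (hp : 2 < p) (hb : 0 < b) :
    ∃ C : ℝ≥0∞, C ≠ ⊤ ∧ ∀ u : V → ℂ, Continuous u → Integrable u → Integrable (𝓕 u) →
      ∫⁻ t, ‖u t‖ₑ ^ p ≤ C * ∫⁻ ξ, ENNReal.ofReal (v ξ ^ (p - 2)) *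
        ∫⁻ x, ‖windowedFourier (gauss b) u x ξ‖ₑ ^ p := by
  have hp0 : 0 < p := by linarith
  set q := p / (p - 1) with hq
  have hpq : p.HolderConjugate q := Real.HolderConjugate.conjExponent (by linarith)
  set K := (ENNReal.ofReal q *
    (4 * c * ENNReal.ofReal (q - 1)⁻¹ + 16 * ENNReal.ofReal (2 - q)⁻¹)) ^ (p - 1) with hK
  have hKt : K ≠ ⊤ := by
    refine ENNReal.rpow_ne_top_of_nonneg (by linarith) ?_
    exact ENNReal.mul_ne_top ENNReal.ofReal_ne_top (ENNReal.add_ne_top.2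
      ⟨ENNReal.mul_ne_top (ENNReal.mul_ne_top (by simp) hc') ENNReal.ofReal_ne_top,
        ENNReal.mul_ne_top (by simp) ENNReal.ofReal_ne_top⟩)
  set W := ∫⁻ t : V, ‖gauss b t‖ₑ ^ p with hW
  have hWe : W = ENNReal.ofReal ((π / (b * p)) ^ ((Module.finrank ℝ V : ℝ) / 2)) := by
    rw [hW, ← lintegral_gauss (by positivity)]
    simp_rw [enorm_gauss_rpow b hp0.le]
  have hW0 : W ≠ 0 := by
    rw [hWe]
    have : 0 < (π / (b * p)) ^ ((Module.finrank ℝ V : ℝ) / 2) := by positivity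
    simpa using this
  have hWt : W ≠ ⊤ := by rw [hWe]; exact ENNReal.ofReal_ne_top
  refine ⟨W⁻¹ * K, ENNReal.mul_ne_top (ENNReal.inv_ne_top.2 hW0) hKt, fun u huc hu hU => ?_⟩
  have hγ : Measurable (gauss b : V → ℂ) := (continuous_gauss b).measurable
  have hm := measurable_windowedFourier hγ huc.measurable
  rw [mul_assoc, ← ENNReal.mul_le_iff_le_inv hW0 hWt, mul_comm,
    ← lintegral_lintegral_enorm_mul_window hγ huc.measurable hp0.le]
  calc ∫⁻ x, ∫⁻ t, ‖u t * gauss b (t - x)‖ₑ ^ p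
      ≤ ∫⁻ x, K * ∫⁻ ξ, ENNReal.ofReal (v ξ ^ (p - 2)) *
          ‖windowedFourier (gauss b) u x ξ‖ₑ ^ p := by
        refine lintegral_mono fun x => ?_
        exact lintegral_rpow_le_lintegral_rpow_mul_fourier hv hv0 hc hp hpq
          (huc.mul ((continuous_gauss b).comp (by fun_prop)))
          (integrable_mul_window hγ (norm_gauss_le_one hb.le) hu x)
          (integrable_windowedFourier_gauss hb huc hu hU x)
    _ = K * ∫⁻ ξ, ∫⁻ x, ENNReal.ofReal (v ξ ^ (p - 2)) *
          ‖windowedFourier (gauss b) u x ξ‖ₑ ^ p := by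
        rw [lintegral_const_mul' _ _ hKt, lintegral_lintegral_swap]
        exact Measurable.aemeasurable (((hv.comp measurable_snd).pow_const _).ennreal_ofReal.mul
          (hm.enorm.pow_const p))
    _ = _ := by
        congr 1
        exact lintegral_congr fun ξ => lintegral_const_mul' _ _ ENNReal.ofReal_ne_top

end GaussianWindow

section Sobolev

theorem hasTemperateGrowth_ofReal_one_add_norm_sq_rpow {V : Type*}
    [NormedAddCommGroup V] [InnerProductSpace ℝ V] (s : ℝ) :
    Function.HasTemperateGrowth fun η : V => (((1 + ‖η‖ ^ 2) ^ s : ℝ) : ℂ) := by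
  fun_prop

variable {V : Type*} [NormedAddCommGroup V] [InnerProductSpace ℝ V] [FiniteDimensional ℝ V]
  [MeasurableSpace V] [BorelSpace V]

theorem volume_one_add_norm_sq_rpow_lt_le (hV : 0 < Module.finrank ℝ V) {t : ℝ} (ht : 0 < t) :
    volume {ξ : V | (1 + ‖ξ‖ ^ 2) ^ ((Module.finrank ℝ V : ℝ) / 2) < t} ≤
      volume (Metric.ball (0 : V) 1) * ENNReal.ofReal t := by
  have : Nontrivial V := Module.finrank_pos_iff.1 hV
  set d := Module.finrank ℝ V with hd
  have hd0 : (d : ℝ) ≠ 0 := by positivity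
  have hsub : {ξ : V | (1 + ‖ξ‖ ^ 2) ^ ((d : ℝ) / 2) < t} ⊆ Metric.ball 0 (t ^ (1 / (d : ℝ))) := by
    intro ξ hξ
    simp only [Set.mem_ofPred_eq] at hξ
    rw [mem_ball_zero_iff]
    have h1 : ‖ξ‖ ^ d ≤ (1 + ‖ξ‖ ^ 2) ^ ((d : ℝ) / 2) := by
      have e : ‖ξ‖ ^ d = (‖ξ‖ ^ 2) ^ ((d : ℝ) / 2) := by
        rw [← Real.rpow_natCast, ← Real.rpow_natCast, ← Real.rpow_mul (norm_nonneg _)]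
        congr 1
        push_cast
        ring
      rw [e]
      exact Real.rpow_le_rpow (by positivity) (by linarith) (by positivity)
    refine lt_of_pow_lt_pow_left₀ d (by positivity) ?_
    rw [← Real.rpow_natCast (t ^ (1 / (d : ℝ))), ← Real.rpow_mul ht.le,
      one_div_mul_cancel hd0, Real.rpow_one]
    exact h1.trans_lt hξ
  refine (measure_mono hsub).trans (le_of_eq ?_)
  rw [Measure.addHaar_ball _ _ (by positivity), ← hd, ← Real.rpow_natCast, ← Real.rpow_mul ht.le,
    one_div_mul_cancel hd0, Real.rpow_one, mul_comm]

theorem exists_schwartzMap_fourier_eq (s : ℝ) (f : 𝓢(V, ℂ)) : ∃ u : 𝓢(V, ℂ),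
    (𝓕 (u : V → ℂ) = fun η => (((1 + ‖η‖ ^ 2) ^ s : ℝ) : ℂ) * 𝓕 (f : V → ℂ) η) ∧
    (u : V → ℂ) = 𝓕⁻ fun η => (((1 + ‖η‖ ^ 2) ^ s : ℝ) : ℂ) * 𝓕 (f : V → ℂ) η := by
  set h : 𝓢(V, ℂ) :=
    smulLeftCLM ℂ (fun η : V => (((1 + ‖η‖ ^ 2) ^ s : ℝ) : ℂ)) (𝓕 f) with hh
  have hc : (h : V → ℂ) = fun η => (((1 + ‖η‖ ^ 2) ^ s : ℝ) : ℂ) * 𝓕 (f : V → ℂ) η := by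
    ext η
    rw [hh, smulLeftCLM_apply_apply (hasTemperateGrowth_ofReal_one_add_norm_sq_rpow s),
      fourier_coe, smul_eq_mul]
  refine ⟨𝓕⁻ h, ?_, ?_⟩
  · rw [← fourier_coe, fourier_fourierInv_eq, hc]
  · rw [fourierInv_coe, hc]

/-- The short-time Fourier transform with the Gaussian window `e^{-π|t|²/2}` of a Bessel potential
is controlled by the one of the original function with the window `e^{-π|t|²}`. -/
theorem lintegral_windowedFourier_bessel_le {r p : ℝ} (hr : 0 < r) (hp : 1 < p) {f u : 𝓢(V, ℂ)}
    (hu : 𝓕 (u : V → ℂ) = fun η => (((1 + ‖η‖ ^ 2) ^ (-r) : ℝ) : ℂ) * 𝓕 (f : V → ℂ) η) (ξ : V) :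
    ∫⁻ x, ‖windowedFourier (gauss (π / 2)) u x ξ‖ₑ ^ p ≤
      ENNReal.ofReal ((2 ^ ((Module.finrank ℝ V : ℝ) / 2)) ^ p * (2 ^ r * (1 + r ^ r)) ^ p) *
        (ENNReal.ofReal ((1 + ‖ξ‖ ^ 2) ^ (-(r * p))) *
          ∫⁻ x, ‖windowedFourier (gauss π) f x ξ‖ₑ ^ p) := by
  have hp0 : 0 ≤ p := by linarith
  have hFI : ∀ w : 𝓢(V, ℂ), Integrable (𝓕 (w : V → ℂ)) := fun w => by
    rw [← fourier_coe]
    exact (𝓕 w).integrable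
  set a : V → ℂ := fun η => 𝓕 (f : V → ℂ) η * gauss π (η - ξ) with ha
  have haI : Integrable a := integrable_mul_window (continuous_gauss π).measurable
    (norm_gauss_le_one Real.pi_pos.le) (hFI f) ξ
  have h1 : ∀ x, ‖windowedFourier (gauss π) f x ξ‖ₑ = ‖𝓕⁻ a x‖ₑ := fun x => by
    rw [enorm_windowedFourier_gauss Real.pi_pos f.continuous f.integrable (hFI f),
      div_self Real.pi_ne_zero, Real.one_rpow, ENNReal.ofReal_one, one_mul, sq,
      mul_div_cancel_right₀ _ Real.pi_ne_zero]
  have h2 : ∀ x, ‖windowedFourier (gauss (π / 2)) u x ξ‖ₑ =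
      ENNReal.ofReal (2 ^ ((Module.finrank ℝ V : ℝ) / 2)) *
        ‖𝓕⁻ (fun η => a η * besselGauss r ξ η) x‖ₑ := fun x => by
    have e : π / (π / 2) = 2 := by field_simp
    have e2 : π ^ 2 / (π / 2) = 2 * π := by field_simp
    rw [enorm_windowedFourier_gauss (by positivity) u.continuous u.integrable (hFI u), e, e2, hu]
    congr 3
    refine congrFun (congrArg 𝓕⁻ (funext fun η => ?_)) x
    dsimp only
    have e3 : (gauss (2 * π) (η - ξ) : ℂ) = gauss π (η - ξ) * gauss π (η - ξ) := by
      rw [gauss, gauss, ← Complex.ofReal_mul, ← Real.exp_add]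
      congr 2
      ring
    simp only [e3, ha, besselGauss, Complex.ofReal_mul]
    simp only [gauss]
    ring
  simp_rw [h1, h2]
  simp_rw [ENNReal.mul_rpow_of_nonneg _ _ hp0]
  rw [lintegral_const_mul' _ _ (ENNReal.rpow_ne_top_of_nonneg hp0 ENNReal.ofReal_ne_top),
    ENNReal.ofReal_rpow_of_nonneg (by positivity) hp0, ENNReal.ofReal_mul (by positivity),
    mul_assoc]
  refine mul_le_mul_right ?_ _
  refine (lintegral_fourierInv_mul_rpow_le haI (continuous_besselGauss r ξ)
    (integrable_besselGauss hr.le ξ) (integrable_fourier_besselGauss hr ξ) hp).trans ?_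
  rw [← mul_assoc]
  refine mul_le_mul_left ?_ _
  refine (ENNReal.rpow_le_rpow (lintegral_enorm_fourier_besselGauss_le hr ξ) hp0).trans
    (le_of_eq ?_)
  rw [ENNReal.ofReal_rpow_of_nonneg (by positivity) hp0, Real.mul_rpow (by positivity)
    (by positivity), ENNReal.ofReal_mul (by positivity), ← Real.rpow_mul (by positivity), neg_mul]

/-- `L^p` control of a Bessel potential by the short-time Fourier transform. -/
theorem lintegral_bessel_rpow_le (hV : 0 < Module.finrank ℝ V) {p r : ℝ} (hp : 2 < p)
    (hr : r * p = (Module.finrank ℝ V : ℝ) / 2 * (p - 2)) :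
    ∃ C : ℝ≥0∞, C ≠ ⊤ ∧ ∀ f : 𝓢(V, ℂ),
      ∫⁻ x, ‖𝓕⁻ (fun η => (((1 + ‖η‖ ^ 2) ^ (-r) : ℝ) : ℂ) * 𝓕 (f : V → ℂ) η) x‖ₑ ^ p ≤
        C * ∫⁻ z : V × V, ‖windowedFourier (gauss π) f z.1 z.2‖ₑ ^ p := by
  have hp0 : 0 < p := by linarith
  have hr0 : 0 < r := by
    have : 0 < r * p := by
      rw [hr]
      have : 0 < p - 2 := by linarith
      positivity
    exact pos_of_mul_pos_left this hp0.le
  set v : V → ℝ := fun ξ => (1 + ‖ξ‖ ^ 2) ^ ((Module.finrank ℝ V : ℝ) / 2) with hv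
  have hv0 : ∀ ξ, 0 < v ξ := fun ξ => by positivity
  obtain ⟨C, hCt, hC⟩ := lintegral_rpow_le_lintegral_windowedFourier (v := v) (by fun_prop) hv0
    (c := volume (Metric.ball (0 : V) 1)) measure_ball_lt_top.ne
    (fun t ht => volume_one_add_norm_sq_rpow_lt_le hV ht) hp (b := π / 2) (by positivity)
  refine ⟨C * ENNReal.ofReal ((2 ^ ((Module.finrank ℝ V : ℝ) / 2)) ^ p *
    (2 ^ r * (1 + r ^ r)) ^ p), ENNReal.mul_ne_top hCt ENNReal.ofReal_ne_top, fun f => ?_⟩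
  obtain ⟨u, hu1, hu2⟩ := exists_schwartzMap_fourier_eq (-r) f
  rw [← hu2, mul_assoc]
  have hUI : Integrable (𝓕 (u : V → ℂ)) := by
    rw [← fourier_coe]
    exact (𝓕 u).integrable
  refine (hC u u.continuous u.integrable hUI).trans (mul_le_mul_right ?_ _)
  rw [Measure.volume_eq_prod, lintegral_prod_symm _
    ((measurable_windowedFourier (continuous_gauss π).measurable
      f.continuous.measurable).enorm.pow_const _).aemeasurable,
    ← lintegral_const_mul' _ _ ENNReal.ofReal_ne_top]
  refine lintegral_mono fun ξ => ?_
  refine (mul_le_mul_right (lintegral_windowedFourier_bessel_le hr0 (by linarith) hu1 ξ) _).trans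
    (le_of_eq ?_)
  rw [mul_left_comm, ← mul_assoc (ENNReal.ofReal (v ξ ^ (p - 2))),
    ← ENNReal.ofReal_mul (Real.rpow_nonneg (hv0 ξ).le _)]
  have : v ξ ^ (p - 2) * (1 + ‖ξ‖ ^ 2) ^ (-(r * p)) = 1 := by
    rw [hv, ← Real.rpow_mul (by positivity), ← Real.rpow_add (by positivity), hr]
    simp
  rw [this, ENNReal.ofReal_one, one_mul]

end Sobolev

section Embeddings

variable {d : ℕ}

theorem FT_eq_fourier (f : EuclideanSpace ℝ (Fin d) → ℂ) : FT f = 𝓕 f := by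
  ext ξ
  rw [FT, Real.fourier_eq']
  congr 1 with x
  rw [smul_eq_mul, real_inner_comm]
  congr 2
  push_cast
  ring

theorem IFT_eq_fourierInv (h : EuclideanSpace ℝ (Fin d) → ℂ) : IFT h = 𝓕⁻ h := by
  ext x
  rw [IFT, Real.fourierInv_eq']
  congr 1 with ξ
  rw [smul_eq_mul, real_inner_comm]

theorem STFT_eq_windowedFourier (f : EuclideanSpace ℝ (Fin d) → ℂ)
    (x ξ : EuclideanSpace ℝ (Fin d)) : STFT f x ξ = windowedFourier (gauss π) f x ξ := by
  rw [windowedFourier, ← FT_eq_fourier, STFT, FT]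
  simp only [mul_assoc]
  rfl

theorem eLpNorm_le_of_lintegral_rpow_le {α β : Type*} [MeasurableSpace α] [MeasurableSpace β]
    {μ : Measure α} {ν : Measure β} {F : α → ℂ} {G : β → ℂ} {p : ℝ} (hp : 0 < p) {C : ℝ≥0∞}
    (h : ∫⁻ x, ‖F x‖ₑ ^ p ∂μ ≤ C * ∫⁻ y, ‖G y‖ₑ ^ p ∂ν) :
    eLpNorm F (ENNReal.ofReal p) μ ≤ C ^ (1 / p) * eLpNorm G (ENNReal.ofReal p) ν := by
  have h0 : ENNReal.ofReal p ≠ 0 := by simpa using hp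
  rw [eLpNorm_eq_lintegral_rpow_enorm_toReal h0 ENNReal.ofReal_ne_top,
    eLpNorm_eq_lintegral_rpow_enorm_toReal h0 ENNReal.ofReal_ne_top,
    ENNReal.toReal_ofReal hp.le, ← ENNReal.mul_rpow_of_nonneg _ _ (by positivity)]
  exact ENNReal.rpow_le_rpow h (by positivity)

theorem exists_const_embeddings {p k : ℝ} (hd : 1 ≤ d) (hp : 2 ≤ p)
    (hk : k = 2 * d * (1 / 2 - 1 / p)) : ∃ A B : ℝ≥0∞, A ≠ ⊤ ∧ B ≠ ⊤ ∧
      ∀ f : 𝓢(EuclideanSpace ℝ (Fin d), ℂ),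
        (∫⁻ z : EuclideanSpace ℝ (Fin d) × EuclideanSpace ℝ (Fin d),
            ‖windowedFourier (gauss π) f z.1 z.2‖ₑ ^ p ≤ A * ∫⁻ x, ‖f x‖ₑ ^ p) ∧
        ∫⁻ x, ‖𝓕⁻ (fun η => (((1 + ‖η‖ ^ 2) ^ (-k / 2) : ℝ) : ℂ) *
            𝓕 (f : EuclideanSpace ℝ (Fin d) → ℂ) η) x‖ₑ ^ p ≤
          B * ∫⁻ z : EuclideanSpace ℝ (Fin d) × EuclideanSpace ℝ (Fin d),
            ‖windowedFourier (gauss π) f z.1 z.2‖ₑ ^ p := by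
  have hw := (continuous_gauss (V := EuclideanSpace ℝ (Fin d)) π).measurable
  have hw1 := norm_gauss_le_one (V := EuclideanSpace ℝ (Fin d)) Real.pi_pos.le
  rcases hp.eq_or_lt with rfl | hp
  · have hk0 : k = 0 := by rw [hk]; norm_num
    set W : ℝ≥0∞ := ∫⁻ t : EuclideanSpace ℝ (Fin d), ‖gauss π t‖ₑ ^ (2 : ℝ) with hW
    have hW' : W = ENNReal.ofReal
        ((π / (π * 2)) ^ ((Module.finrank ℝ (EuclideanSpace ℝ (Fin d)) : ℝ) / 2)) := by
      rw [hW, ← lintegral_gauss (by positivity)]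
      simp_rw [enorm_gauss_rpow π (zero_le_two (α := ℝ))]
    have hW0 : W ≠ 0 := by
      rw [hW']
      have : 0 < (π / (π * 2)) ^ ((Module.finrank ℝ (EuclideanSpace ℝ (Fin d)) : ℝ) / 2) := by
        positivity
      simpa using this
    have hWt : W ≠ ⊤ := by rw [hW']; exact ENNReal.ofReal_ne_top
    refine ⟨W, W⁻¹, hWt, ENNReal.inv_ne_top.2 hW0, fun f => ?_⟩
    rw [lintegral_windowedFourier_sq hw hw1 f.continuous.measurable f.integrable (f.memLp 2 volume),
      mul_comm]
    refine ⟨le_rfl, ?_⟩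
    rw [← mul_assoc, ENNReal.inv_mul_cancel hW0 hWt, one_mul, hk0]
    simp only [neg_zero, zero_div, Real.rpow_zero, Complex.ofReal_one, one_mul]
    rw [← fourier_coe, ← fourierInv_coe, fourierInv_fourier_eq]
  · have hr : k / 2 * p = (Module.finrank ℝ (EuclideanSpace ℝ (Fin d)) : ℝ) / 2 * (p - 2) := by
      rw [hk, finrank_euclideanSpace_fin]
      field_simp
    obtain ⟨B, hB, hBf⟩ := lintegral_bessel_rpow_le (V := EuclideanSpace ℝ (Fin d))
      (by rw [finrank_euclideanSpace_fin]; exact hd) hp hr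
    refine ⟨_, B, ENNReal.ofReal_ne_top, hB, fun f => ⟨lintegral_windowedFourier_rpow_le hw hw1 ?_
      f.continuous.measurable f.integrable (f.memLp 2 volume) hp, ?_⟩⟩
    · rw [lintegral_gauss Real.pi_pos, div_self Real.pi_ne_zero, Real.one_rpow, ENNReal.ofReal_one]
    · rw [neg_div]
      exact hBf f

end Embeddings

end

/-- **Embeddings between Lebesgue, modulation and Sobolev spaces** (Kobayashi–Sugimoto):
for `2 ≤ p < ∞` and `k = 2d(1/2 - 1/p)`, the continuous embeddings
`L^p(ℝ^d) ↪ M^p(ℝ^d) ↪ L^p_{-k}(ℝ^d)` hold. -/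
theorem Lp_embeds_modulation_embeds_sobolev
    {d : ℕ} (hd : 1 ≤ d) (p k : ℝ) (hp1 : 2 ≤ p)
    (hk : k = 2 * d * (1 / 2 - 1 / p)) :
    ∃ C : ℝ, 0 < C ∧ ∀ f : SchwartzMap (EuclideanSpace ℝ (Fin d)) ℂ,
      MpNorm p (fun x => f x) ≤
        ENNReal.ofReal C * eLpNorm (fun x => f x) (ENNReal.ofReal p) volume ∧
      sobolevNorm p (-k) (fun x => f x) ≤ ENNReal.ofReal C * MpNorm p (fun x => f x) := by
  have hp0 : 0 < p := by linarith
  obtain ⟨A, B, hA, hB, hAB⟩ := exists_const_embeddings hd hp1 hk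
  have hD : ∀ D : ℝ≥0∞, D ≠ ⊤ → D ^ (1 / p) ≠ ⊤ := fun D hD =>
    ENNReal.rpow_ne_top_of_nonneg (by positivity) hD
  set c : ℝ≥0∞ := A ^ (1 / p) + B ^ (1 / p) with hc
  have hct : c ≠ ⊤ := ENNReal.add_ne_top.2 ⟨hD A hA, hD B hB⟩
  have hcC : c ≤ ENNReal.ofReal (c.toReal + 1) := by
    rw [← ENNReal.ofReal_toReal hct, ENNReal.toReal_ofReal ENNReal.toReal_nonneg]
    exact ENNReal.ofReal_le_ofReal (by linarith)
  refine ⟨c.toReal + 1, by positivity, fun f => ?_⟩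
  obtain ⟨h1, h2⟩ := hAB f
  simp only [MpNorm, sobolevNorm, STFT_eq_windowedFourier, IFT_eq_fourierInv, FT_eq_fourier]
  exact ⟨(eLpNorm_le_of_lintegral_rpow_le hp0 h1).trans
      (mul_le_mul_left (le_self_add.trans hcC) _),
    (eLpNorm_le_of_lintegral_rpow_le hp0 h2).trans
      (mul_le_mul_left (le_add_self.trans hcC) _)⟩
end
end

section
/- Let 1 ≤ p, q ≤ ∞ and s ∈ ℝ, s ≥ 0, and let q' be the conjugate exponent, 1/q + 1/q' = 1. The following are equivalent: (i) there exists C > 0 such that ‖f·h‖_{M^{p,q}_s} ≤ C ‖f‖_{M^{p,q}_s} ‖h‖_{M^{p,q}_s} for all f, h ∈ 𝓢(ℝ^d) (pointwise product); (ii) there exists C > 0 such that ‖f‖_{L^∞} ≤ C ‖f‖_{M^{p,q}_s} for all f ∈ 𝓢(ℝ^d); (iii) either (s = 0 and q = 1) or s > d/q'. -/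
open MeasureTheory Real Filter
open scoped RealInnerProductSpace ENNReal

noncomputable section

/-- The weighted modulation space norm
`‖f‖_{M^{p,q}_s} = ( ∫ ( ∫ |V_g f(x,ξ)|^p dx )^{q/p} ⟨ξ⟩^{qs} dξ )^{1/q}`,
with the usual supremum modification when `q = ∞` (the inner `L^p` norm is `eLpNorm`,
which itself uses the essential supremum when `p = ∞`); here `⟨ξ⟩ = (1+|ξ|²)^{1/2}`. -/
def modNorm {d : ℕ} (p q : ℝ≥0∞) (s : ℝ) (f : EuclideanSpace ℝ (Fin d) → ℂ) : ℝ≥0∞ :=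
  if q = ∞ then
    ⨆ ξ : EuclideanSpace ℝ (Fin d),
      eLpNorm (fun x => STFT f x ξ) p volume * ENNReal.ofReal ((1 + ‖ξ‖ ^ 2) ^ (s / 2))
  else
    (∫⁻ ξ : EuclideanSpace ℝ (Fin d),
        (eLpNorm (fun x => STFT f x ξ) p volume *
          ENNReal.ofReal ((1 + ‖ξ‖ ^ 2) ^ (s / 2))) ^ q.toReal) ^ (1 / q.toReal)

section Auxiliary

open scoped FourierTransform SchwartzMap

section Minkowski

variable {α β : Type*} [MeasurableSpace α] [MeasurableSpace β] {μ : Measure α} {ν : Measure β}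

theorem measurable_eLpNorm_prod_left [SFinite μ] {F : α → β → ℝ≥0∞}
    (hF : Measurable (Function.uncurry F)) (p : ℝ≥0∞) :
    Measurable fun y => eLpNorm (fun x => F x y) p μ := by
  rcases eq_or_ne p 0 with rfl | hp0
  · simp
  rcases eq_or_ne p ∞ with rfl | hp
  · simp only [eLpNorm_exponent_top, eLpNormEssSup, enorm_eq_self]
    refine measurable_of_Ioi fun a => ?_
    have h1 : {p : α × β | a < Function.uncurry F p} = Function.uncurry F ⁻¹' Set.Ioi a := rfl
    have hm : Measurable fun y => μ ((fun x => (x, y)) ⁻¹' (Function.uncurry F ⁻¹' Set.Ioi a)) :=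
      measurable_measure_prodMk_right (hF measurableSet_Ioi)
    have : (fun y => essSup (fun x => F x y) μ) ⁻¹' Set.Ioi a =
        (fun y => μ ((fun x => (x, y)) ⁻¹' (Function.uncurry F ⁻¹' Set.Ioi a))) ⁻¹' {0}ᶜ := by
      ext y
      simp only [Set.mem_preimage, Set.mem_Ioi, Set.mem_compl_iff, Set.mem_singleton_iff]
      rw [← not_le, not_iff_not]
      constructor
      · intro h
        have := (ENNReal.ae_le_essSup (μ := μ) fun x => F x y)
        refine measure_mono_null ?_ this
        intro x hx h'
        exact absurd (lt_of_lt_of_le hx (h'.trans h)) (lt_irrefl _)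
      · intro h
        refine essSup_le_of_ae_le _ ?_
        refine measure_mono_null ?_ h
        intro x hx
        simpa using hx
    rw [this]
    exact hm (measurableSet_singleton _).compl
  · simp only [eLpNorm_eq_lintegral_rpow_enorm_toReal hp0 hp, enorm_eq_self]
    refine Measurable.pow_const ?_ _
    exact Measurable.lintegral_prod_left' (f := fun z : α × β => Function.uncurry F z ^ p.toReal)
      (hF.pow_const _)

theorem lintegral_mul_le_eLpNorm_mul_eLpNorm {f g : α → ℝ≥0∞} (hf : AEMeasurable f μ)
    (hg : AEMeasurable g μ) {p q : ℝ≥0∞} (hpq : 1 / p + 1 / q = 1) :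
    ∫⁻ x, f x * g x ∂μ ≤ eLpNorm f p μ * eLpNorm g q μ := by
  have top : ∀ f g : α → ℝ≥0∞, AEMeasurable f μ →
      ∫⁻ x, f x * g x ∂μ ≤ eLpNorm f 1 μ * eLpNorm g ∞ μ := by
    intro f g hf
    rw [eLpNorm_one_eq_lintegral_enorm, eLpNorm_exponent_top, eLpNormEssSup]
    simp only [enorm_eq_self]
    rw [← lintegral_mul_const'' _ hf]
    refine lintegral_mono_ae ?_
    filter_upwards [ENNReal.ae_le_essSup (μ := μ) g] with x hx
    gcongr
  have hp1 : 1 ≤ p := by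
    have h : p⁻¹ ≤ 1 := by rw [← hpq, one_div]; exact le_self_add
    simpa using h
  have hq1 : 1 ≤ q := by
    have h : q⁻¹ ≤ 1 := by rw [← hpq, one_div q]; exact le_add_self
    simpa using h
  rcases eq_or_ne p ∞ with rfl | hp
  · have : q = 1 := by simpa using hpq
    subst this
    rw [mul_comm]
    simpa only [mul_comm] using top g f hg
  rcases eq_or_ne q ∞ with rfl | hq
  · have : p = 1 := by simpa using hpq
    subst this
    exact top f g hf
  have hc : p.toReal.HolderConjugate q.toReal := by
    refine Real.holderConjugate_iff.2 ⟨?_, ?_⟩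
    · rcases hp1.eq_or_lt with rfl | h
      · exfalso
        have h2 : (1 : ℝ≥0∞) + 1 / q = 1 + 0 := by simpa using hpq
        have := (ENNReal.add_right_inj ENNReal.one_ne_top).1 h2
        simp [hq] at this
      · simpa using (ENNReal.toReal_lt_toReal ENNReal.one_ne_top hp).2 h
    · rw [← ENNReal.toReal_inv, ← ENNReal.toReal_inv, ← ENNReal.toReal_add]
      · simpa using congrArg ENNReal.toReal hpq
      · simpa using (zero_lt_one.trans_le hp1).ne'
      · simpa using (zero_lt_one.trans_le hq1).ne'
  have := ENNReal.lintegral_mul_le_Lp_mul_Lq μ hc hf hg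
  rw [eLpNorm_eq_lintegral_rpow_enorm_toReal (zero_lt_one.trans_le hp1).ne' hp,
    eLpNorm_eq_lintegral_rpow_enorm_toReal (zero_lt_one.trans_le hq1).ne' hq]
  simpa using this

/-- **Minkowski's integral inequality** -/
theorem eLpNorm_lintegral_le [SigmaFinite μ] [SigmaFinite ν] {F : α → β → ℝ≥0∞}
    (hF : Measurable (Function.uncurry F)) {p : ℝ≥0∞} (hp : 1 ≤ p) :
    eLpNorm (fun x => ∫⁻ y, F x y ∂ν) p μ ≤ ∫⁻ y, eLpNorm (fun x => F x y) p μ ∂ν := by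
  have hN := measurable_eLpNorm_prod_left (μ := μ) hF p
  rcases eq_or_ne p ∞ with rfl | hpt
  · simp only [eLpNorm_exponent_top, eLpNormEssSup, enorm_eq_self] at hN ⊢
    refine essSup_le_of_ae_le _ ?_
    have hms : MeasurableSet {z : α × β | F z.1 z.2 ≤ essSup (fun x => F x z.2) μ} :=
      measurableSet_le hF (hN.comp measurable_snd)
    have hae : ∀ᵐ x ∂μ, ∀ᵐ y ∂ν, F x y ≤ essSup (fun x => F x y) μ := by
      refine (Measure.ae_ae_comm hms).2 ?_
      exact ae_of_all _ fun y => ENNReal.ae_le_essSup _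
    filter_upwards [hae] with x hx
    exact lintegral_mono_ae hx
  rcases hp.eq_or_lt with rfl | hp1
  · simp only [eLpNorm_one_eq_lintegral_enorm, enorm_eq_self]
    rw [lintegral_lintegral_swap hF.aemeasurable]
  have hp0 : p ≠ 0 := (zero_lt_one.trans hp1).ne'
  have hr : 1 < p.toReal := by
    simpa using (ENNReal.toReal_lt_toReal ENNReal.one_ne_top hpt).2 hp1
  set r := p.toReal with hrdef
  have hr0 : 0 < r := by linarith
  set H : α → ℝ≥0∞ := fun x => ∫⁻ y, F x y ∂ν with hH
  have hHm : Measurable H := Measurable.lintegral_prod_right' hF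
  set R := ∫⁻ y, eLpNorm (fun x => F x y) p μ ∂ν with hR
  have hpq := Real.HolderConjugate.conjExponent hr
  set r' := r.conjExponent
  have key : ∀ K : α → ℝ≥0∞, Measurable K → K ≤ H → ∫⁻ x, K x ^ r ∂μ ≠ ∞ →
      (∫⁻ x, K x ^ r ∂μ) ^ (1 / r) ≤ R := by
    intro K hK hKH hfin
    set I := ∫⁻ x, K x ^ r ∂μ with hI
    rcases eq_or_ne I 0 with h0 | h0
    · simp [h0, hr0]
    have h1 : I ≤ R * I ^ (1 / r') := by
      calc I ≤ ∫⁻ x, ∫⁻ y, F x y * K x ^ (r - 1) ∂ν ∂μ := by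
            refine lintegral_mono fun x => ?_
            have hFx : Measurable (F x) := hF.comp measurable_prodMk_left
            rw [lintegral_mul_const _ hFx]
            have : K x ^ r = K x * K x ^ (r - 1) := by
              conv_rhs => rw [← ENNReal.rpow_one (K x), ← ENNReal.rpow_mul]
              rw [← ENNReal.rpow_add_of_nonneg _ _ (by norm_num) (by linarith)]
              congr 1; ring
            rw [this]
            gcongr
            exact hKH x
        _ = ∫⁻ y, ∫⁻ x, F x y * K x ^ (r - 1) ∂μ ∂ν := by
            rw [lintegral_lintegral_swap]
            exact (hF.mul ((hK.comp measurable_fst).pow_const _)).aemeasurable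
        _ ≤ ∫⁻ y, eLpNorm (fun x => F x y) p μ * I ^ (1 / r') ∂ν := by
            refine lintegral_mono fun y => ?_
            refine (ENNReal.lintegral_mul_le_Lp_mul_Lq μ hpq
              (hF.comp measurable_prodMk_right).aemeasurable (hK.pow_const _).aemeasurable).trans ?_
            rw [eLpNorm_eq_lintegral_rpow_enorm_toReal hp0 hpt, hI]
            simp only [enorm_eq_self, ← ENNReal.rpow_mul]
            have : (r - 1) * r' = r := hpq.sub_one_mul_conj
            rw [this]
            rfl
        _ = R * I ^ (1 / r') := lintegral_mul_const _ hN
    have h2 : I = I ^ (1 / r) * I ^ (1 / r') := by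
      rw [← ENNReal.rpow_add _ _ h0 hfin, one_div, one_div, hpq.inv_add_inv_eq_one,
        ENNReal.rpow_one]
    have hne : I ^ (1 / r') ≠ 0 := by simp [h0, hfin]
    have hne' : I ^ (1 / r') ≠ ∞ := by
      refine ENNReal.rpow_ne_top_of_nonneg ?_ hfin
      exact one_div_nonneg.2 hpq.symm.nonneg
    conv_lhs at h1 => rw [h2]
    exact (ENNReal.mul_le_mul_iff_left hne hne').1 h1
  rw [eLpNorm_eq_lintegral_rpow_enorm_toReal hp0 hpt]
  simp only [enorm_eq_self]
  change (∫⁻ x, H x ^ r ∂μ) ^ (1 / r) ≤ R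
  let K : ℕ → α → ℝ≥0∞ := fun n => (spanningSets μ n).indicator fun x => min (H x) n
  have hKm : ∀ n, Measurable (K n) := fun n =>
    (hHm.min measurable_const).indicator (measurableSet_spanningSets μ n)
  have hKH : ∀ n, K n ≤ H := fun n x => by
    refine (Set.indicator_le_self _ _ _).trans (min_le_left _ _)
  have hKmono : Monotone K := by
    intro m n hmn x
    by_cases hx : x ∈ spanningSets μ m
    · have hx' : x ∈ spanningSets μ n := monotone_spanningSets μ hmn hx
      simp only [K, Set.indicator_of_mem hx, Set.indicator_of_mem hx']
      gcongr
    · simp [K, Set.indicator_of_notMem hx]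
  have hlim : ∀ x, Tendsto (fun n => K n x ^ r) atTop (nhds (H x ^ r)) := by
    intro x
    refine (ENNReal.continuous_rpow_const.tendsto _).comp ?_
    have h1 : ∀ᶠ n in atTop, K n x = min (H x) n := by
      obtain ⟨N, hN⟩ : ∃ N, x ∈ spanningSets μ N := by
        have : x ∈ ⋃ i, spanningSets μ i := by rw [iUnion_spanningSets]; trivial
        exact Set.mem_iUnion.1 this
      filter_upwards [eventually_ge_atTop N] with n hn
      exact Set.indicator_of_mem (monotone_spanningSets μ hn hN) _
    refine Tendsto.congr' (h1.mono fun _ h => h.symm) ?_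
    simpa using (tendsto_const_nhds (x := H x)).min ENNReal.tendsto_nat_nhds_top
  have hmc := lintegral_tendsto_of_tendsto_of_monotone (μ := μ) (f := fun n x => K n x ^ r)
    (F := fun x => H x ^ r) (fun n => ((hKm n).pow_const _).aemeasurable)
    (ae_of_all _ fun x m n hmn => ENNReal.rpow_le_rpow (hKmono hmn x) hr0.le)
    (ae_of_all _ hlim)
  refine le_of_tendsto ((ENNReal.continuous_rpow_const.tendsto _).comp hmc)
    (Eventually.of_forall fun n => key (K n) (hKm n) (hKH n) ?_)
  have hb : ∫⁻ x, K n x ^ r ∂μ ≤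
      ∫⁻ x, (spanningSets μ n).indicator (fun _ => (n : ℝ≥0∞) ^ r) x ∂μ := by
    refine lintegral_mono fun x => ?_
    by_cases hx : x ∈ spanningSets μ n
    · simp only [K, Set.indicator_of_mem hx]
      gcongr
      exact min_le_right _ _
    · simp [K, Set.indicator_of_notMem hx, hr0]
  refine (hb.trans_lt ?_).ne
  rw [lintegral_indicator_const (measurableSet_spanningSets μ n)]
  exact ENNReal.mul_lt_top (ENNReal.rpow_lt_top_of_nonneg hr0.le (by simp))
    (measure_spanningSets_lt_top μ n)

end Minkowski

section MixedNorm

/-- The `L^q` norm of a nonnegative function, with a genuine supremum for `q = ∞`. -/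
def supLpNorm {V : Type*} [MeasureSpace V] (q : ℝ≥0∞) (F : V → ℝ≥0∞) : ℝ≥0∞ :=
  if q = ∞ then ⨆ ξ, F ξ else (∫⁻ ξ, F ξ ^ q.toReal) ^ (1 / q.toReal)

theorem supLpNorm_eq_eLpNorm {V : Type*} [MeasureSpace V] {q : ℝ≥0∞} (hq : 1 ≤ q) (hq' : q ≠ ∞)
    (F : V → ℝ≥0∞) : supLpNorm q F = eLpNorm F q volume := by
  rw [eLpNorm_eq_lintegral_rpow_enorm_toReal (zero_lt_one.trans_le hq).ne' hq', supLpNorm,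
    if_neg hq']
  simp

theorem eLpNorm_le_supLpNorm {V : Type*} [MeasureSpace V] {q : ℝ≥0∞} (hq : 1 ≤ q)
    (F : V → ℝ≥0∞) : eLpNorm F q volume ≤ supLpNorm q F := by
  rcases eq_or_ne q ∞ with rfl | h
  · rw [eLpNorm_exponent_top, eLpNormEssSup, supLpNorm, if_pos rfl]
    exact essSup_le_of_ae_le _ (ae_of_all _ fun x => by simpa using le_iSup F x)
  · rw [supLpNorm_eq_eLpNorm hq h]

theorem supLpNorm_mono {V : Type*} [MeasureSpace V] (q : ℝ≥0∞) {F G : V → ℝ≥0∞}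
    (h : ∀ x, F x ≤ G x) : supLpNorm q F ≤ supLpNorm q G := by
  unfold supLpNorm
  split_ifs
  · exact iSup_mono h
  · gcongr with x
    exact h x

theorem supLpNorm_const_mul {V : Type*} [MeasureSpace V] {q : ℝ≥0∞} (hq : 1 ≤ q) {c : ℝ≥0∞}
    (hc : c ≠ ∞) (F : V → ℝ≥0∞) : supLpNorm q (fun x => c * F x) = c * supLpNorm q F := by
  unfold supLpNorm
  split_ifs with h
  · rw [ENNReal.mul_iSup]
  · have h0 : 0 < q.toReal := ENNReal.toReal_pos (zero_lt_one.trans_le hq).ne' h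
    simp only [ENNReal.mul_rpow_of_nonneg _ _ h0.le]
    rw [lintegral_const_mul' _ _ (ENNReal.rpow_ne_top_of_nonneg h0.le hc),
      ENNReal.mul_rpow_of_nonneg _ _ (by positivity), ← ENNReal.rpow_mul,
      mul_one_div_cancel h0.ne', ENNReal.rpow_one]

theorem supLpNorm_add_le {V : Type*} [MeasureSpace V] {q : ℝ≥0∞} (hq : 1 ≤ q) {F G : V → ℝ≥0∞}
    (hF : Measurable F) (hG : Measurable G) :
    supLpNorm q (fun x => F x + G x) ≤ supLpNorm q F + supLpNorm q G := by
  by_cases h : q = ∞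
  · simp only [supLpNorm, if_pos h]
    exact iSup_le fun x => add_le_add (le_iSup F x) (le_iSup G x)
  · simp only [supLpNorm, if_neg h]
    refine ENNReal.lintegral_Lp_add_le hF.aemeasurable hG.aemeasurable ?_
    simpa using ENNReal.toReal_mono h hq

variable {V : Type*} [NormedAddCommGroup V] [InnerProductSpace ℝ V] [FiniteDimensional ℝ V]
  [MeasurableSpace V] [BorelSpace V]

theorem supLpNorm_lconvolution_le {q : ℝ≥0∞} (hq : 1 ≤ q) {F K : V → ℝ≥0∞}
    (hF : Measurable F) (hK : Measurable K) :
    supLpNorm q (F ⋆ₗ K) ≤ eLpNorm F q volume * ∫⁻ x, K x := by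
  rw [lconvolution_comm]
  rcases eq_or_ne q ∞ with rfl | h
  · rw [supLpNorm, if_pos rfl]
    refine iSup_le fun ξ => ?_
    rw [lconvolution_def, ← lintegral_const_mul _ hK]
    refine lintegral_mono_ae ?_
    have h1 : ∀ᵐ x : V, F x ≤ eLpNorm F ∞ volume := by
      rw [eLpNorm_exponent_top, eLpNormEssSup]
      simpa using ENNReal.ae_le_essSup (μ := volume) F
    have h2 : MeasurePreserving (fun x : V => -x + ξ) volume volume :=
      (measurePreserving_add_right volume ξ).comp (Measure.measurePreserving_neg volume)
    filter_upwards [h2.quasiMeasurePreserving.ae h1] with x hx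
    rw [mul_comm]
    gcongr
  · rw [supLpNorm_eq_eLpNorm hq h]
    have hm : Measurable (Function.uncurry fun x y : V => K y * F (-y + x)) := by
      unfold Function.uncurry; fun_prop
    refine (eLpNorm_lintegral_le (μ := volume) (ν := volume) hm hq).trans ?_
    rw [← lintegral_const_mul _ hK]
    refine lintegral_mono fun y => ?_
    rw [← supLpNorm_eq_eLpNorm hq h, ← supLpNorm_eq_eLpNorm hq h]
    simp only [supLpNorm, if_neg h]
    have h0 : 0 < q.toReal := ENNReal.toReal_pos (zero_lt_one.trans_le hq).ne' h
    simp only [ENNReal.mul_rpow_of_nonneg _ _ h0.le]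
    rw [lintegral_const_mul _ (by fun_prop),
      lintegral_add_left_eq_self (fun x => F x ^ q.toReal) (-y),
      ENNReal.mul_rpow_of_nonneg _ _ (by positivity), ← ENNReal.rpow_mul,
      mul_one_div_cancel h0.ne', ENNReal.rpow_one, mul_comm]

end MixedNorm

section Weight

variable {V : Type*} [NormedAddCommGroup V]

/-- The weight `⟨ξ⟩^s` with values in `[0, ∞]`. -/
def bracketWeight (s : ℝ) (ξ : V) : ℝ≥0∞ := ENNReal.ofReal ((1 + ‖ξ‖ ^ 2) ^ (s / 2))

@[fun_prop]
theorem measurable_bracketWeight [MeasurableSpace V] [BorelSpace V] (s : ℝ) :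
    Measurable (bracketWeight s : V → ℝ≥0∞) := by
  unfold bracketWeight; fun_prop

theorem bracketWeight_mul_bracketWeight (s t : ℝ) (ξ : V) :
    bracketWeight s ξ * bracketWeight t ξ = bracketWeight (s + t) ξ := by
  unfold bracketWeight
  rw [← ENNReal.ofReal_mul (by positivity), ← Real.rpow_add (by positivity), add_div]

theorem bracketWeight_rpow (s r : ℝ) (hr : 0 ≤ r) (ξ : V) :
    bracketWeight s ξ ^ r = bracketWeight (s * r) ξ := by
  unfold bracketWeight
  rw [ENNReal.ofReal_rpow_of_nonneg (by positivity) hr, ← Real.rpow_mul (by positivity)]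
  ring_nf

theorem bracketWeight_zero (ξ : V) : bracketWeight 0 ξ = 1 := by
  simp [bracketWeight]

theorem one_le_bracketWeight {s : ℝ} (hs : 0 ≤ s) (ξ : V) : 1 ≤ bracketWeight s ξ := by
  unfold bracketWeight
  rw [ENNReal.one_le_ofReal]
  exact Real.one_le_rpow (by nlinarith [sq_nonneg ‖ξ‖]) (by positivity)

theorem bracketWeight_le_one {s : ℝ} (hs : s ≤ 0) (ξ : V) : bracketWeight s ξ ≤ 1 := by
  unfold bracketWeight
  rw [ENNReal.ofReal_le_one]
  exact Real.rpow_le_one_of_one_le_of_nonpos (by nlinarith [sq_nonneg ‖ξ‖]) (by linarith)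

theorem bracketWeight_add_le_mul {s : ℝ} (hs : 0 ≤ s) (a b : V) :
    bracketWeight s (a + b) ≤
      ENNReal.ofReal (2 ^ (s / 2)) * (bracketWeight s a * bracketWeight s b) := by
  unfold bracketWeight
  rw [← ENNReal.ofReal_mul (by positivity), ← ENNReal.ofReal_mul (by positivity),
    ← Real.mul_rpow (by positivity) (by positivity),
    ← Real.mul_rpow (by positivity) (by positivity)]
  gcongr
  have := norm_add_le a b
  nlinarith [norm_nonneg (a + b), sq_nonneg (‖a‖ - ‖b‖), sq_nonneg (‖a‖ * ‖b‖), norm_nonneg a,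
    norm_nonneg b]

theorem bracketWeight_add_le_add {s : ℝ} (hs : 0 ≤ s) (a b : V) :
    bracketWeight s (a + b) ≤
      ENNReal.ofReal (4 ^ (s / 2)) * (bracketWeight s a + bracketWeight s b) := by
  wlog h : ‖b‖ ≤ ‖a‖ generalizing a b
  · rw [add_comm a b, add_comm (bracketWeight s a)]
    exact this b a (le_of_not_ge h)
  refine le_trans ?_ (mul_le_mul_right (le_self_add (b := bracketWeight s b)) _)
  unfold bracketWeight
  rw [← ENNReal.ofReal_mul (by positivity), ← Real.mul_rpow (by positivity) (by positivity)]
  gcongr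
  have := norm_add_le a b
  nlinarith [norm_nonneg (a + b), norm_nonneg a, norm_nonneg b]

end Weight

section WeightedConvolution

variable {V : Type*} [NormedAddCommGroup V] [InnerProductSpace ℝ V] [FiniteDimensional ℝ V]
  [MeasurableSpace V] [BorelSpace V]

theorem supLpNorm_lconvolution_mul_bracketWeight_le {q : ℝ≥0∞} (hq : 1 ≤ q) {s : ℝ} (hs : 0 ≤ s)
    {A B : V → ℝ≥0∞} (hA : Measurable A) (hB : Measurable B) :
    supLpNorm q (fun ξ => (A ⋆ₗ B) ξ * bracketWeight s ξ) ≤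
      ENNReal.ofReal (2 ^ (s / 2)) * (supLpNorm q (fun ξ => A ξ * bracketWeight s ξ) *
        ∫⁻ ξ, B ξ * bracketWeight s ξ) := by
  have h1 : ∀ ξ, (A ⋆ₗ B) ξ * bracketWeight s ξ ≤ ENNReal.ofReal (2 ^ (s / 2)) *
      ((fun ξ => A ξ * bracketWeight s ξ) ⋆ₗ (fun ξ => B ξ * bracketWeight s ξ)) ξ := by
    intro ξ
    simp only [lconvolution_def]
    rw [← lintegral_mul_const _ (by fun_prop), ← lintegral_const_mul _ (by fun_prop)]
    refine lintegral_mono fun η => ?_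
    have := bracketWeight_add_le_mul hs η (-η + ξ)
    rw [add_neg_cancel_left] at this
    refine (mul_le_mul_right this (A η * B (-η + ξ))).trans (le_of_eq ?_)
    ring
  refine (supLpNorm_mono q h1).trans ?_
  rw [supLpNorm_const_mul hq ENNReal.ofReal_ne_top]
  gcongr
  refine (supLpNorm_lconvolution_le hq (by fun_prop) (by fun_prop)).trans ?_
  gcongr
  exact eLpNorm_le_supLpNorm hq _

theorem supLpNorm_lconvolution_mul_bracketWeight_le_add {q : ℝ≥0∞} (hq : 1 ≤ q) {s : ℝ}
    (hs : 0 ≤ s) {A B : V → ℝ≥0∞} (hA : Measurable A) (hB : Measurable B) :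
    supLpNorm q (fun ξ => (A ⋆ₗ B) ξ * bracketWeight s ξ) ≤
      ENNReal.ofReal (4 ^ (s / 2)) *
        (supLpNorm q (fun ξ => A ξ * bracketWeight s ξ) * (∫⁻ ξ, B ξ) +
          supLpNorm q (fun ξ => B ξ * bracketWeight s ξ) * (∫⁻ ξ, A ξ)) := by
  have h1 : ∀ ξ, (A ⋆ₗ B) ξ * bracketWeight s ξ ≤ ENNReal.ofReal (4 ^ (s / 2)) *
      (((fun ξ => A ξ * bracketWeight s ξ) ⋆ₗ B) ξ +
        ((fun ξ => B ξ * bracketWeight s ξ) ⋆ₗ A) ξ) := by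
    intro ξ
    rw [lconvolution_comm (f := fun ξ => B ξ * bracketWeight s ξ)]
    simp only [lconvolution_def]
    rw [← lintegral_mul_const _ (by fun_prop), ← lintegral_add_left (by fun_prop),
      ← lintegral_const_mul _ (by fun_prop)]
    refine lintegral_mono fun η => ?_
    have := bracketWeight_add_le_add hs η (-η + ξ)
    rw [add_neg_cancel_left] at this
    refine (mul_le_mul_right this (A η * B (-η + ξ))).trans (le_of_eq ?_)
    ring
  refine (supLpNorm_mono q h1).trans ?_
  rw [supLpNorm_const_mul hq ENNReal.ofReal_ne_top]
  refine mul_le_mul_right ?_ _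
  refine (supLpNorm_add_le hq (measurable_lconvolution _ (by fun_prop) hB)
    (measurable_lconvolution _ (by fun_prop) hA)).trans (add_le_add ?_ ?_)
  · refine (supLpNorm_lconvolution_le hq (by fun_prop) (by fun_prop)).trans ?_
    gcongr
    exact eLpNorm_le_supLpNorm hq _
  · refine (supLpNorm_lconvolution_le hq (by fun_prop) (by fun_prop)).trans ?_
    gcongr
    exact eLpNorm_le_supLpNorm hq _

theorem lintegral_le_supLpNorm_mul_bracketWeight {q q' : ℝ≥0∞} (hq : 1 ≤ q)
    (hqq : 1 / q + 1 / q' = 1) (s : ℝ) {A : V → ℝ≥0∞} (hA : Measurable A) :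
    ∫⁻ ξ, A ξ ≤ supLpNorm q (fun ξ => A ξ * bracketWeight s ξ) *
      eLpNorm (bracketWeight (-s) : V → ℝ≥0∞) q' volume := by
  calc ∫⁻ ξ, A ξ = ∫⁻ ξ, (A ξ * bracketWeight s ξ) * bracketWeight (-s) ξ := by
        refine lintegral_congr fun ξ => ?_
        rw [mul_assoc, bracketWeight_mul_bracketWeight, add_neg_cancel, bracketWeight_zero, mul_one]
    _ ≤ eLpNorm (fun ξ => A ξ * bracketWeight s ξ) q volume *
        eLpNorm (bracketWeight (-s) : V → ℝ≥0∞) q' volume :=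
        lintegral_mul_le_eLpNorm_mul_eLpNorm (by fun_prop) (by fun_prop) hqq
    _ ≤ _ := by gcongr; exact eLpNorm_le_supLpNorm hq _

theorem lintegral_bracketWeight_neg_lt_top {r : ℝ} (hr : (Module.finrank ℝ V : ℝ) < r) :
    ∫⁻ ξ : V, bracketWeight (-r) ξ < ∞ := by
  have := (integrable_rpow_neg_one_add_norm_sq (E := V) (μ := volume) hr).lintegral_lt_top
  exact this

theorem lintegral_bracketWeight_neg_eq_top (hV : 0 < Module.finrank ℝ V) {r : ℝ} (hr0 : 0 ≤ r)
    (hr : r ≤ (Module.finrank ℝ V : ℝ)) :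
    ∫⁻ ξ : V, bracketWeight (-r) ξ = ∞ := by
  by_contra hne
  have hint : Integrable (fun ξ : V => (1 + ‖ξ‖ ^ 2) ^ (-r / 2)) := by
    refine ⟨?_, ?_⟩
    · exact Measurable.aestronglyMeasurable (by fun_prop)
    · rw [hasFiniteIntegral_iff_ofReal (ae_of_all _ fun x => by positivity)]
      exact lt_top_iff_ne_top.2 hne
  have : Nontrivial V := Module.finrank_pos_iff.1 hV
  have h2 := (integrable_fun_norm_addHaar (E := V) volume
    (f := fun y : ℝ => (1 + y ^ 2) ^ (-r / 2))).1 hint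
  have h3 : IntegrableOn (fun y : ℝ => y ^ (-1 : ℝ)) (Set.Ioi 1) := by
    have h4 := (h2.mono_set (Set.Ioi_subset_Ioi zero_le_one)).const_mul (2 ^ (r / 2))
    refine Integrable.mono' h4 (by fun_prop) ?_
    refine (ae_restrict_iff' measurableSet_Ioi).2 (ae_of_all _ fun y (hy : 1 < y) => ?_)
    have hy0 : 0 < y := by linarith
    rw [Real.norm_of_nonneg (by positivity), smul_eq_mul]
    have e1 : y ^ (-1 : ℝ) ≤ y ^ (Module.finrank ℝ V - 1) * y ^ (-r) := by
      rw [← Real.rpow_natCast, ← Real.rpow_add hy0, Nat.cast_sub hV]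
      apply Real.rpow_le_rpow_of_exponent_le hy.le
      push_cast
      linarith
    have e2 : y ^ (-r) = 2 ^ (r / 2) * (2 * y ^ 2) ^ (-r / 2) := by
      rw [Real.mul_rpow (by positivity) (by positivity), ← mul_assoc,
        ← Real.rpow_add (by positivity), ← Real.rpow_natCast, ← Real.rpow_mul hy0.le]
      ring_nf
      simp
    have e3 : (2 * y ^ 2) ^ (-r / 2) ≤ (1 + y ^ 2) ^ (-r / 2) := by
      apply Real.rpow_le_rpow_of_nonpos (by positivity) (by nlinarith) (by linarith)
    calc _ ≤ _ := e1
      _ = 2 ^ (r / 2) * (y ^ (Module.finrank ℝ V - 1) * (2 * y ^ 2) ^ (-r / 2)) := by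
        rw [e2]; ring
      _ ≤ _ := by gcongr
  rw [integrableOn_Ioi_rpow_iff zero_lt_one] at h3
  exact lt_irrefl _ h3

theorem eLpNorm_bracketWeight_neg_ne_top {q : ℝ≥0∞} (hq : 1 ≤ q) {s : ℝ} (hs : 0 ≤ s)
    (h : q = ∞ ∨ (Module.finrank ℝ V : ℝ) < s * q.toReal) :
    eLpNorm (bracketWeight (-s) : V → ℝ≥0∞) q volume ≠ ∞ := by
  by_cases hq' : q = ∞
  · rw [hq', eLpNorm_exponent_top, eLpNormEssSup]
    refine ne_top_of_le_ne_top ENNReal.one_ne_top (essSup_le_of_ae_le _ (ae_of_all _ fun x => ?_))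
    exact bracketWeight_le_one (by linarith) x
  · have h := h.resolve_left hq'
    rw [← supLpNorm_eq_eLpNorm hq hq', supLpNorm, if_neg hq']
    refine ENNReal.rpow_ne_top_of_nonneg (by positivity) ?_
    simp only [bracketWeight_rpow _ _ ENNReal.toReal_nonneg]
    rw [neg_mul]
    exact (lintegral_bracketWeight_neg_lt_top h).ne

end WeightedConvolution

section Gaussian

variable {V : Type*} [NormedAddCommGroup V]

/-- The Gaussian `t ↦ e^{-a‖t‖²}`. -/
def gaussFun (a : ℝ) (t : V) : ℂ := (Real.exp (-a * ‖t‖ ^ 2) : ℝ)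

@[fun_prop]
theorem continuous_gaussFun (a : ℝ) : Continuous (gaussFun a : V → ℂ) := by
  unfold gaussFun; fun_prop

theorem gaussFun_neg (a : ℝ) (t : V) : gaussFun a (-t) = gaussFun a t := by
  simp [gaussFun]

theorem norm_gaussFun (a : ℝ) (t : V) : ‖gaussFun a t‖ = Real.exp (-a * ‖t‖ ^ 2) := by
  rw [gaussFun, Complex.norm_real, Real.norm_of_nonneg (Real.exp_pos _).le]

theorem norm_gaussFun_le_one {a : ℝ} (ha : 0 ≤ a) (t : V) : ‖gaussFun a t‖ ≤ 1 := by
  rw [norm_gaussFun, Real.exp_le_one_iff]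
  nlinarith [mul_nonneg ha (sq_nonneg ‖t‖)]

@[fun_prop]
theorem measurable_enorm_gaussFun [MeasurableSpace V] [BorelSpace V] (a : ℝ) : Measurable fun t : V => ‖gaussFun a t‖ₑ :=
  (continuous_gaussFun a).enorm.measurable

theorem gaussFun_mul_gaussFun (a b : ℝ) (t : V) :
    gaussFun a t * gaussFun b t = gaussFun (a + b) t := by
  unfold gaussFun
  rw [← Complex.ofReal_mul, ← Real.exp_add]
  ring_nf

variable [InnerProductSpace ℝ V]

theorem hasTemperateGrowth_gaussFun_sub {a : ℝ} (ha : 0 ≤ a) (x : V) :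
    Function.HasTemperateGrowth fun t : V => gaussFun a (t - x) := by
  have h1 : Function.HasTemperateGrowth fun t : V => a * ‖t - x‖ ^ 2 :=
    (Function.HasTemperateGrowth.const a).mul
      ((Function.hasTemperateGrowth_norm_sq V).comp
        (f := fun t : V => t - x) (by fun_prop))
  have h2 : Function.HasTemperateGrowth
      ((fun y : ℝ => Real.exp (-y)) ∘ fun t : V => a * ‖t - x‖ ^ 2) := by
    refine h1.comp' (t := Set.Ioi (-1)) ?_ (uniqueDiffOn_Ioi _) (by fun_prop) ?_
    · rintro _ ⟨t, rfl⟩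
      have : 0 ≤ a * ‖t - x‖ ^ 2 := by positivity
      exact lt_of_lt_of_le (by norm_num) this
    · intro N
      refine ⟨0, Real.exp 1, (Real.exp_pos _).le, fun n _ y hy => ?_⟩
      have hy' : -1 < y := hy
      rw [norm_iteratedFDerivWithin_eq_norm_iteratedDerivWithin,
        iteratedDerivWithin_eq_iteratedDeriv (uniqueDiffOn_Ioi _) (by fun_prop) hy]
      rw [iteratedDeriv_comp_neg n Real.exp y]
      simp only [iteratedDeriv_eq_iterate, Real.iter_deriv_exp, norm_smul, norm_pow, norm_neg,
        norm_one, one_pow, one_mul, pow_zero, mul_one, Real.norm_eq_abs, Real.abs_exp]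
      exact Real.exp_le_exp.2 (by linarith)
  have h3 := Function.Complex.hasTemperateGrowth_ofReal.comp h2
  refine (congrArg Function.HasTemperateGrowth (funext fun t => ?_)).mp h3
  simp [gaussFun]

theorem exists_schwartzMap_eq_mul_gaussFun_sub {a : ℝ} (ha : 0 ≤ a) (f : 𝓢(V, ℂ)) (x : V) :
    ∃ φ : 𝓢(V, ℂ), ⇑φ = fun t => f t * gaussFun a (t - x) := by
  refine ⟨SchwartzMap.smulLeftCLM ℂ (fun t => gaussFun a (t - x)) f, funext fun t => ?_⟩
  rw [SchwartzMap.smulLeftCLM_apply_apply (hasTemperateGrowth_gaussFun_sub ha x), smul_eq_mul,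
    mul_comm]

theorem exists_schwartzMap_eq_mul (f h : 𝓢(V, ℂ)) :
    ∃ φ : 𝓢(V, ℂ), ⇑φ = fun t => f t * h t :=
  ⟨SchwartzMap.smulLeftCLM ℂ f h, funext fun t => by
    rw [SchwartzMap.smulLeftCLM_apply_apply f.hasTemperateGrowth, smul_eq_mul]⟩

theorem gaussFun_mul_gaussFun_sub {a b : ℝ} (h : a + b ≠ 0) (x y t : V) :
    gaussFun a (t - x) * gaussFun b (t - y) =
      Real.exp (-(a * b / (a + b)) * ‖x - y‖ ^ 2) *
        gaussFun (a + b) (t + -((a + b)⁻¹ • (a • x + b • y))) := by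
  unfold gaussFun
  rw [← Complex.ofReal_mul, ← Complex.ofReal_mul, ← Real.exp_add, ← Real.exp_add]
  congr 2
  simp only [← real_inner_self_eq_norm_sq, inner_sub_left, inner_sub_right, inner_add_left,
    inner_add_right, inner_neg_left, inner_neg_right, inner_smul_left, inner_smul_right,
    real_inner_comm x t, real_inner_comm y t, real_inner_comm x y]
  simp
  field_simp
  ring

variable [FiniteDimensional ℝ V] [MeasurableSpace V] [BorelSpace V]

theorem integrable_gaussFun {a : ℝ} (ha : 0 < a) : Integrable (gaussFun a : V → ℂ) := by
  have := GaussianFourier.integrable_cexp_neg_mul_sq_norm_add (V := V) (b := (a : ℂ))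
    (by simpa using ha) 0 0
  refine this.congr (ae_of_all _ fun t => ?_)
  simp [gaussFun]

theorem norm_fourier_comp_add_right (f : V → ℂ) (m ζ : V) :
    ‖𝓕 (fun t => f (t + m)) ζ‖ = ‖𝓕 f ζ‖ := by
  have := congrFun (VectorFourier.fourierIntegral_comp_add_right Real.fourierChar volume (innerₗ V)
    f m) ζ
  change ‖VectorFourier.fourierIntegral Real.fourierChar volume (innerₗ V) (f ∘ fun v => v + m) ζ‖ = _
  rw [this, Circle.norm_smul]
  rfl

theorem norm_fourier_gaussFun_mul_gaussFun {a b : ℝ} (h : 0 < a + b) (x y ζ : V) :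
    ‖𝓕 (fun t => gaussFun a (t - x) * gaussFun b (t - y)) ζ‖ =
      (π / (a + b)) ^ (Module.finrank ℝ V / 2 : ℝ) *
        (Real.exp (-(a * b / (a + b)) * ‖x - y‖ ^ 2) *
        Real.exp (-(π ^ 2 / (a + b)) * ‖ζ‖ ^ 2)) := by
  have h1 : 𝓕 (fun t => gaussFun a (t - x) * gaussFun b (t - y)) ζ =
      Real.exp (-(a * b / (a + b)) * ‖x - y‖ ^ 2) *
        𝓕 (fun t => gaussFun (a + b) (t + -((a + b)⁻¹ • (a • x + b • y)))) ζ := by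
    simp_rw [gaussFun_mul_gaussFun_sub h.ne', Real.fourier_eq, ← mul_smul_comm]
    rw [integral_const_mul]
  rw [h1, norm_mul, norm_fourier_comp_add_right, Complex.norm_real,
    Real.norm_of_nonneg (Real.exp_pos _).le]
  have h2 := fourier_gaussian_innerProductSpace (V := V) (b := ((a + b : ℝ) : ℂ))
    (by simpa using h) ζ
  have h3 : (fun v : V => Complex.exp (-((a + b : ℝ) : ℂ) * ‖v‖ ^ 2)) = gaussFun (a + b) := by
    ext v; simp [gaussFun]
  rw [h3] at h2
  rw [h2, norm_mul, Complex.norm_exp]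
  have h4 : ‖((π : ℂ) / ((a + b : ℝ) : ℂ)) ^ ((Module.finrank ℝ V : ℂ) / 2)‖ =
      (π / (a + b)) ^ (Module.finrank ℝ V / 2 : ℝ) := by
    rw [← Complex.ofReal_div, Complex.norm_cpow_eq_rpow_re_of_pos (by positivity)]
    simp
  have h5 : (-(π : ℂ) ^ 2 * ‖ζ‖ ^ 2 / ((a + b : ℝ) : ℂ)).re = -(π ^ 2 / (a + b)) * ‖ζ‖ ^ 2 := by
    have : (-(π : ℂ) ^ 2 * ‖ζ‖ ^ 2 / ((a + b : ℝ) : ℂ)) =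
      ((-(π ^ 2 / (a + b)) * ‖ζ‖ ^ 2 : ℝ) : ℂ) := by push_cast; ring
    rw [this, Complex.ofReal_re]
  rw [h4, h5]
  ring

theorem enorm_fourier_fourierInv_mul_le {U v : V → ℂ} (hU : Integrable U) (hv : Integrable v)
    (ξ : V) :
    ‖𝓕 (fun t => 𝓕⁻ U t * v t) ξ‖ₑ ≤ ((fun η => ‖U η‖ₑ) ⋆ₗ fun η => ‖𝓕 v η‖ₑ) ξ := by
  have hv' : Integrable fun t => 𝐞 (-⟪t, ξ⟫) • v t := by
    refine hv.mono (Continuous.aestronglyMeasurable (by fun_prop) |>.smul hv.1) (ae_of_all _ ?_)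
    simp [Circle.norm_smul]
  have h1 : 𝓕 (fun t => 𝓕⁻ U t * v t) ξ = ∫ η, U η * 𝓕 v (ξ - η) := by
    have := VectorFourier.integral_fourierIntegral_smul_eq_flip (μ := volume) (ν := volume)
      (L := -innerₗ V) (e := Real.fourierChar) Real.continuous_fourierChar
      (by exact continuous_inner.neg) hU hv'
    have e1 : 𝓕 (fun t => 𝓕⁻ U t * v t) ξ = ∫ t, VectorFourier.fourierIntegral 𝐞 volume (-innerₗ V) U t •
        (𝐞 (-⟪t, ξ⟫) • v t) := by
      rw [Real.fourier_eq]
      refine integral_congr_ae (ae_of_all _ fun t => ?_)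
      simp only [smul_eq_mul, mul_smul_comm]
      rfl
    rw [e1, this]
    refine integral_congr_ae (ae_of_all _ fun η => ?_)
    simp only [smul_eq_mul]
    congr 1
    rw [Real.fourier_eq]
    refine integral_congr_ae (ae_of_all _ fun t => ?_)
    simp only [LinearMap.flip_apply, LinearMap.neg_apply, innerₗ_apply_apply, smul_smul,
      ← AddChar.map_add_eq_mul, inner_sub_right]
    congr 2
    rw [real_inner_comm t η]; ring
  rw [h1, lconvolution_def]
  refine (enorm_integral_le_lintegral_enorm _).trans (le_of_eq ?_)
  refine lintegral_congr fun η => ?_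
  rw [enorm_mul, sub_eq_neg_add]

end Gaussian

section Convolution

variable {V : Type*} [NormedAddCommGroup V] [InnerProductSpace ℝ V] [FiniteDimensional ℝ V]
  [MeasurableSpace V] [BorelSpace V]
variable {A : V → V → ℝ≥0∞} {G K : V → ℝ≥0∞}

theorem measurable_lconvolution_slice (hA : Measurable (Function.uncurry A)) (hG : Measurable G) :
    Measurable fun z : V × V => ((fun y => A y z.2) ⋆ₗ G) z.1 := by
  simp only [lconvolution_def]
  refine Measurable.lintegral_prod_right' (f := fun z : (V × V) × V =>
    A z.2 z.1.2 * G (-z.2 + z.1.1)) ?_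
  exact (hA.comp (measurable_snd.prodMk (measurable_snd.comp measurable_fst))).mul
    (hG.comp (by fun_prop))

theorem lintegral_lintegral_mul_eq (hA : Measurable (Function.uncurry A)) (hG : Measurable G)
    (hK : Measurable K) (D : ℝ≥0∞) (x ξ : V) :
    ∫⁻ y, ∫⁻ η, A y η * (D * (G (-y + x) * K (-η + ξ))) =
      D * ∫⁻ η, ((fun y => A y η) ⋆ₗ G) x * K (-η + ξ) := by
  have hA' : ∀ η, Measurable fun y => A y η := fun η =>
    hA.comp (measurable_id.prodMk (measurable_const (a := η)))
  have hG' : Measurable fun y => G (-y + x) := hG.comp (by fun_prop)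
  have hK' : Measurable fun η => K (-η + ξ) := hK.comp (by fun_prop)
  rw [lintegral_lintegral_swap, ← lintegral_const_mul]
  · refine lintegral_congr fun η => ?_
    rw [lconvolution_def, ← lintegral_mul_const, ← lintegral_const_mul]
    · refine lintegral_congr fun y => ?_
      ring
    · exact ((hA' η).mul hG').mul_const _
    · exact (hA' η).mul hG'
  · exact ((measurable_lconvolution_slice hA hG).comp
      ((measurable_const (a := x)).prodMk measurable_id)).mul hK'
  · exact (hA.mul (((hG'.comp measurable_fst).mul (hK'.comp measurable_snd)).const_mul D)).aemeasurable

theorem eLpNorm_lintegral_lconvolution_mul_le (hA : Measurable (Function.uncurry A)) (hG : Measurable G)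
    (hK : Measurable K) (ξ : V) {p : ℝ≥0∞} (hp : 1 ≤ p) :
    eLpNorm (fun x => ∫⁻ η, ((fun y => A y η) ⋆ₗ G) x * K (-η + ξ)) p volume ≤
      (∫⁻ y, G y) * ((fun η => eLpNorm (fun y => A y η) p volume) ⋆ₗ K) ξ := by
  have hA' : ∀ η, Measurable fun y => A y η := fun η =>
    hA.comp (measurable_id.prodMk (measurable_const (a := η)))
  have hK' : Measurable fun η => K (-η + ξ) := hK.comp (by fun_prop)
  have hc := measurable_lconvolution_slice hA hG
  have hmul : ∀ η, eLpNorm (fun x => ((fun y => A y η) ⋆ₗ G) x * K (-η + ξ)) p volume ≤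
      K (-η + ξ) * eLpNorm ((fun y => A y η) ⋆ₗ G) p volume := fun η =>
    eLpNorm_le_mul_eLpNorm_of_ae_le_mul'' p
      (hc.comp (measurable_id.prodMk (measurable_const (a := η)))).aestronglyMeasurable
      (ae_of_all _ fun x => by simp [mul_comm])
  refine (eLpNorm_lintegral_le (hc.mul (hK'.comp measurable_snd)) hp).trans ?_
  have hm : Measurable fun η => eLpNorm (fun y => A y η) p volume * K (-η + ξ) :=
    (measurable_eLpNorm_prod_left hA p).mul hK'
  rw [lconvolution_def, ← lintegral_const_mul _ hm]
  refine lintegral_mono fun η => (hmul η).trans ?_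
  calc _ ≤ K (-η + ξ) * (eLpNorm (fun y => A y η) p volume * ∫⁻ y, G y) :=
        mul_le_mul_right ((eLpNorm_le_supLpNorm hp _).trans
          (supLpNorm_lconvolution_le hp (hA' η) hG)) _
    _ = _ := by ring

theorem lintegral_lconvolution_mul_le (hA : Measurable (Function.uncurry A)) (hG : Measurable G)
    (hK : Measurable K) (x ξ : V) {p p' : ℝ≥0∞} (hp : 1 / p + 1 / p' = 1) :
    ∫⁻ η, ((fun y => A y η) ⋆ₗ G) x * K (-η + ξ) ≤
      eLpNorm G p' volume * ((fun η => eLpNorm (fun y => A y η) p volume) ⋆ₗ K) ξ := by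
  have hA' : ∀ η, Measurable fun y => A y η := fun η =>
    hA.comp (measurable_id.prodMk (measurable_const (a := η)))
  have hK' : Measurable fun η => K (-η + ξ) := hK.comp (by fun_prop)
  have hG' : Measurable fun y => G (-y + x) := hG.comp (by fun_prop)
  have hGn : eLpNorm (fun y => G (-y + x)) p' volume = eLpNorm G p' volume := by
    have hmp : MeasurePreserving (fun y : V => -y + x) :=
      (measurePreserving_add_right volume x).comp (Measure.measurePreserving_neg volume)
    exact eLpNorm_comp_measurePreserving hG.aestronglyMeasurable hmp
  have hm : Measurable fun η => eLpNorm (fun y => A y η) p volume * K (-η + ξ) :=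
    (measurable_eLpNorm_prod_left hA p).mul hK'
  rw [lconvolution_def, ← lintegral_const_mul _ hm]
  refine lintegral_mono fun η => ?_
  calc _ ≤ eLpNorm (fun y => A y η) p volume * eLpNorm (fun y => G (-y + x)) p' volume *
        K (-η + ξ) :=
        mul_le_mul_left (lintegral_mul_le_eLpNorm_mul_eLpNorm (hA' η).aemeasurable
          hG'.aemeasurable hp) _
    _ = _ := by rw [hGn]; ring

end Convolution

section ShortTimeFourier

variable {V : Type*} [NormedAddCommGroup V] [InnerProductSpace ℝ V] [FiniteDimensional ℝ V]
  [MeasurableSpace V] [BorelSpace V]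

/-- The short-time Fourier transform with window `gaussFun a`. -/
def gaussSTFT (a : ℝ) (f : V → ℂ) (x ξ : V) : ℂ := 𝓕 (fun t => f t * gaussFun a (t - x)) ξ

theorem continuous_gaussSTFT {a : ℝ} (ha : 0 ≤ a) (f : 𝓢(V, ℂ)) :
    Continuous fun z : V × V => gaussSTFT a f z.1 z.2 := by
  simp only [gaussSTFT, Real.fourier_eq]
  refine continuous_of_dominated (bound := fun t => ‖f t‖) (fun z => ?_) (fun z => ?_)
    f.integrable.norm (ae_of_all _ fun t => ?_)
  · have := f.continuous
    exact Continuous.aestronglyMeasurable (by fun_prop)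
  · refine ae_of_all _ fun t => ?_
    rw [Circle.norm_smul, norm_mul]
    exact mul_le_of_le_one_right (norm_nonneg _) (norm_gaussFun_le_one ha _)
  · fun_prop

theorem lintegral_enorm_gaussFun_ne_top {a : ℝ} (ha : 0 < a) : ∫⁻ t : V, ‖gaussFun a t‖ₑ ≠ ∞ :=
  (integrable_gaussFun ha).2.ne

theorem eLpNorm_gaussFun_ne_top {a : ℝ} (ha : 0 < a) (p : ℝ≥0∞) :
    eLpNorm (fun t : V => ‖gaussFun a t‖ₑ) p volume ≠ ∞ := by
  rw [eLpNorm_enorm]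
  by_cases hp0 : p = 0
  · simp [hp0]
  by_cases hp : p = ∞
  · rw [hp]
    exact ((memLp_top_of_bound (continuous_gaussFun a).aestronglyMeasurable 1
      (ae_of_all _ (norm_gaussFun_le_one ha.le))).2).ne
  · rw [eLpNorm_eq_lintegral_rpow_enorm_toReal hp0 hp]
    have hr : 0 < p.toReal := ENNReal.toReal_pos hp0 hp
    have h1 : ∀ t : V, ‖gaussFun a t‖ₑ ^ p.toReal = ‖gaussFun (a * p.toReal) t‖ₑ := by
      intro t
      rw [← ofReal_norm, ← ofReal_norm, norm_gaussFun, norm_gaussFun,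
        ENNReal.ofReal_rpow_of_nonneg (Real.exp_pos _).le hr.le, ← Real.exp_mul]
      ring_nf
    simp_rw [h1]
    exact ENNReal.rpow_ne_top_of_nonneg (by positivity)
      (lintegral_enorm_gaussFun_ne_top (mul_pos ha hr))

theorem enorm_fourier_schwartzMap_mul_le (f : 𝓢(V, ℂ)) {v : V → ℂ} (hv : Integrable v) (ξ : V) :
    ‖𝓕 (fun t => f t * v t) ξ‖ₑ ≤ ((fun η => ‖𝓕 (f : V → ℂ) η‖ₑ) ⋆ₗ fun η => ‖𝓕 v η‖ₑ) ξ := by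
  have h1 : 𝓕⁻ (𝓕 (f : V → ℂ)) = f := by
    rw [← SchwartzMap.fourier_coe, ← SchwartzMap.fourierInv_coe, FourierTransform.fourierInv_fourier_eq]
  have h2 : Integrable (𝓕 (f : V → ℂ)) := by
    rw [← SchwartzMap.fourier_coe]
    exact (𝓕 f).integrable
  have := enorm_fourier_fourierInv_mul_le h2 hv ξ
  rwa [h1] at this

theorem integral_gaussFun_ne_zero {a : ℝ} (ha : 0 < a) : ∫ t : V, gaussFun a t ≠ 0 := by
  unfold gaussFun
  rw [integral_complex_ofReal, Complex.ofReal_ne_zero]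
  have hi : Integrable fun t : V => Real.exp (-a * ‖t‖ ^ 2) := by
    have := (integrable_gaussFun (V := V) ha).norm
    simpa only [norm_gaussFun] using this
  exact (integral_exp_pos hi).ne'

theorem integral_gaussFun_mul_gaussSTFT {a b : ℝ} (ha : 0 < a) (hb : 0 < b) (f : 𝓢(V, ℂ))
    (x ξ : V) :
    (∫ y : V, gaussFun (a + a) y) * gaussSTFT b f x ξ =
      ∫ y, 𝓕 (fun t => (f t * gaussFun a (t - y)) *
        (gaussFun a (t - y) * gaussFun b (t - x))) ξ := by
  set F : V → ℂ := fun t => Real.fourierChar (-⟪t, ξ⟫) • (f t * gaussFun b (t - x)) with hF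
  have hFi : Integrable F := by
    obtain ⟨φ, hφ⟩ := exists_schwartzMap_eq_mul_gaussFun_sub hb.le f x
    have h := φ.integrable (μ := volume)
    rw [hφ] at h
    refine h.mono ?_ (ae_of_all _ fun t => by rw [hF, Circle.norm_smul])
    exact (Continuous.aestronglyMeasurable (by fun_prop)).smul h.1
  have h1 : Integrable (Function.uncurry fun y t : V => F t * gaussFun (a + a) (y - t)) :=
    hFi.convolution_integrand (ContinuousLinearMap.mul ℝ ℂ) (integrable_gaussFun (by linarith))
  have h2 : ∀ t, ∫ y, F t * gaussFun (a + a) (y - t) = F t * ∫ y : V, gaussFun (a + a) y := by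
    intro t
    rw [integral_const_mul, integral_sub_right_eq_self]
  have h3 : ∀ y t, F t * gaussFun (a + a) (y - t) = Real.fourierChar (-⟪t, ξ⟫) •
      ((f t * gaussFun a (t - y)) * (gaussFun a (t - y) * gaussFun b (t - x))) := by
    intro y t
    rw [← neg_sub t y, gaussFun_neg, ← gaussFun_mul_gaussFun, hF]
    simp only [smul_mul_assoc]
    congr 1
    ring
  calc _ = ∫ t, F t * ∫ y : V, gaussFun (a + a) y := by
        rw [integral_mul_const, mul_comm, gaussSTFT, Real.fourier_eq]
    _ = ∫ t, ∫ y, F t * gaussFun (a + a) (y - t) := by simp_rw [h2]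
    _ = ∫ y, ∫ t, F t * gaussFun (a + a) (y - t) := (integral_integral_swap h1).symm
    _ = _ := by simp_rw [h3, Real.fourier_eq]

/-- The `L^p` norm of the short-time Fourier transform in its first variable. -/
def stftSlice (p : ℝ≥0∞) (a : ℝ) (f : V → ℂ) (ξ : V) : ℝ≥0∞ :=
  eLpNorm (fun x => gaussSTFT a f x ξ) p volume

theorem measurable_stftSlice (p : ℝ≥0∞) {a : ℝ} (ha : 0 ≤ a) (f : 𝓢(V, ℂ)) :
    Measurable (stftSlice p a f) := by
  have := measurable_eLpNorm_prod_left (μ := volume) (F := fun x ξ => ‖gaussSTFT a f x ξ‖ₑ)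
    (continuous_gaussSTFT ha f).enorm.measurable p
  simp only [eLpNorm_enorm] at this
  exact this

theorem exists_enorm_gaussSTFT_le {a b : ℝ} (ha : 0 < a) (hb : 0 < b) :
    ∃ C : ℝ≥0∞, C ≠ ∞ ∧ ∃ r > 0, ∃ c > 0, ∀ (f : 𝓢(V, ℂ)) (x ξ : V),
      ‖gaussSTFT b f x ξ‖ₑ ≤ C * ∫⁻ η, ((fun y => ‖gaussSTFT a f y η‖ₑ) ⋆ₗ
        fun y => ‖gaussFun r y‖ₑ) x * ‖gaussFun c (-η + ξ)‖ₑ := by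
  set I : ℂ := ∫ y : V, gaussFun (a + a) y with hI
  have hI0 : I ≠ 0 := integral_gaussFun_ne_zero (by linarith)
  set D : ℝ≥0∞ := ENNReal.ofReal ((π / (a + b)) ^ (Module.finrank ℝ V / 2 : ℝ)) with hD
  refine ⟨‖I‖ₑ⁻¹ * D, ENNReal.mul_ne_top (by simpa using hI0) ENNReal.ofReal_ne_top,
    a * b / (a + b), by positivity, π ^ 2 / (a + b), by positivity, fun f x ξ => ?_⟩
  have h1 := integral_gaussFun_mul_gaussSTFT ha hb f x ξ
  have h2 : ∀ y η, ‖𝓕 (fun t => gaussFun a (t - y) * gaussFun b (t - x)) η‖ₑ =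
      D * (‖gaussFun (a * b / (a + b)) (-y + x)‖ₑ * ‖gaussFun (π ^ 2 / (a + b)) η‖ₑ) := by
    intro y η
    simp only [← ofReal_norm]
    rw [norm_fourier_gaussFun_mul_gaussFun (by positivity), ENNReal.ofReal_mul (by positivity),
      ENNReal.ofReal_mul (by positivity), norm_gaussFun, norm_gaussFun, norm_sub_rev,
      sub_eq_neg_add]
  have hm : Measurable (Function.uncurry fun y η => ‖gaussSTFT a f y η‖ₑ) :=
    (continuous_gaussSTFT ha.le f).enorm.measurable
  rw [mul_assoc, ← ENNReal.div_eq_inv_mul,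
    ENNReal.le_div_iff_mul_le (by simp [hI0]) (by simp), mul_comm, ← enorm_mul, h1]
  refine (enorm_integral_le_lintegral_enorm _).trans ?_
  calc _ ≤ ∫⁻ y, ∫⁻ η, ‖gaussSTFT a f y η‖ₑ *
        (D * (‖gaussFun (a * b / (a + b)) (-y + x)‖ₑ *
          ‖gaussFun (π ^ 2 / (a + b)) (-η + ξ)‖ₑ)) := by
        refine lintegral_mono fun y => ?_
        obtain ⟨φ, hφ⟩ := exists_schwartzMap_eq_mul_gaussFun_sub ha.le f y
        have hv : Integrable fun t : V => gaussFun a (t - y) * gaussFun b (t - x) :=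
          ((integrable_gaussFun hb).comp_sub_right x).bdd_mul
            (Continuous.aestronglyMeasurable (by fun_prop))
            (ae_of_all _ fun t => norm_gaussFun_le_one ha.le _)
        have := enorm_fourier_schwartzMap_mul_le φ hv ξ
        rw [hφ] at this
        refine this.trans (le_of_eq ?_)
        rw [lconvolution_def]
        simp only [h2]
        rfl
    _ = _ := lintegral_lintegral_mul_eq hm (measurable_enorm_gaussFun _)
      (measurable_enorm_gaussFun _) D x ξ

theorem exists_stftSlice_le {a b : ℝ} (ha : 0 < a) (hb : 0 < b) {p : ℝ≥0∞} (hp : 1 ≤ p) :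
    ∃ C : ℝ≥0∞, C ≠ ∞ ∧ ∃ c > 0, ∀ (f : 𝓢(V, ℂ)) (ξ : V),
      stftSlice p b f ξ ≤ C * (stftSlice p a f ⋆ₗ fun η => ‖gaussFun c η‖ₑ) ξ ∧
      ∀ x, ‖gaussSTFT b f x ξ‖ₑ ≤ C * (stftSlice p a f ⋆ₗ fun η => ‖gaussFun c η‖ₑ) ξ := by
  obtain ⟨C, hC, r, hr, c, hc, h⟩ := exists_enorm_gaussSTFT_le (V := V) ha hb
  have : Fact (1 ≤ p) := ⟨hp⟩
  have hpp : 1 / p + 1 / ENNReal.conjExponent p = 1 := by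
    simpa using ENNReal.HolderConjugate.inv_add_inv_eq_one p (ENNReal.conjExponent p)
  set E₁ := ∫⁻ y : V, ‖gaussFun r y‖ₑ with hE₁
  set E₂ := eLpNorm (fun y : V => ‖gaussFun r y‖ₑ) (ENNReal.conjExponent p) volume with hE₂
  have hE₁t : E₁ ≠ ∞ := lintegral_enorm_gaussFun_ne_top hr
  have hE₂t : E₂ ≠ ∞ := eLpNorm_gaussFun_ne_top hr _
  refine ⟨C * (E₁ + E₂), ENNReal.mul_ne_top hC (ENNReal.add_ne_top.2 ⟨hE₁t, hE₂t⟩), c, hc,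
    fun f ξ => ?_⟩
  have hm : Measurable (Function.uncurry fun y η => ‖gaussSTFT a f y η‖ₑ) :=
    (continuous_gaussSTFT ha.le f).enorm.measurable
  have hG := measurable_enorm_gaussFun (V := V) r
  have hK := measurable_enorm_gaussFun (V := V) c
  have hN : ∀ η, eLpNorm (fun y => ‖gaussSTFT a f y η‖ₑ) p volume = stftSlice p a f η :=
    fun η => eLpNorm_enorm _
  constructor
  · have h1 := eLpNorm_lintegral_lconvolution_mul_le hm hG hK ξ hp
    simp only [hN] at h1
    lift C to NNReal using hC
    rw [stftSlice, mul_assoc]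
    refine (eLpNorm_le_mul_eLpNorm_of_ae_le_mul'
      (g := fun x => ∫⁻ η, ((fun y => ‖gaussSTFT a f y η‖ₑ) ⋆ₗ fun y => ‖gaussFun r y‖ₑ) x *
        ‖gaussFun c (-η + ξ)‖ₑ) (ae_of_all _ fun x => h f x ξ) p).trans ?_
    refine mul_le_mul_right (h1.trans ?_) _
    exact mul_le_mul_left le_self_add _
  · intro x
    have h1 := lintegral_lconvolution_mul_le hm hG hK x ξ hpp
    simp only [hN] at h1
    rw [mul_assoc]
    refine (h f x ξ).trans (mul_le_mul_right (h1.trans ?_) _)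
    exact mul_le_mul_left le_add_self _

end ShortTimeFourier

section ProductEstimate

variable {V : Type*} [NormedAddCommGroup V] [InnerProductSpace ℝ V] [FiniteDimensional ℝ V]
  [MeasurableSpace V] [BorelSpace V]

/-- The modulation space norm computed with the window `gaussFun π`. -/
def gaussModNorm (p q : ℝ≥0∞) (s : ℝ) (f : V → ℂ) : ℝ≥0∞ :=
  supLpNorm q fun ξ => stftSlice p π f ξ * bracketWeight s ξ

theorem lintegral_gaussFun_mul_bracketWeight_ne_top {c : ℝ} (hc : 0 < c) {s : ℝ} (hs : 0 ≤ s) :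
    ∫⁻ ξ : V, ‖gaussFun c ξ‖ₑ * bracketWeight s ξ ≠ ∞ := by
  set ε : ℝ := min 1 (c / (s + 1)) with hε
  have hε0 : 0 < ε := by positivity
  have hε1 : ε ≤ 1 := min_le_left _ _
  have hε2 : ε * (s / 2) ≤ c / 2 := by
    have h1 : ε ≤ c / (s + 1) := min_le_right _ _
    rw [le_div_iff₀ (by positivity)] at h1
    nlinarith
  have key : ∀ ξ : V, ‖gaussFun c ξ‖ₑ * bracketWeight s ξ ≤
      ENNReal.ofReal (ε⁻¹ ^ (s / 2)) * ‖gaussFun (c / 2) ξ‖ₑ := by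
    intro ξ
    simp only [← ofReal_norm, norm_gaussFun, bracketWeight]
    rw [← ENNReal.ofReal_mul (by positivity), ← ENNReal.ofReal_mul (by positivity)]
    refine ENNReal.ofReal_le_ofReal ?_
    have h1 : 1 + ‖ξ‖ ^ 2 ≤ ε⁻¹ * Real.exp (ε * ‖ξ‖ ^ 2) := by
      rw [inv_mul_eq_div, le_div_iff₀ hε0]
      have := Real.add_one_le_exp (ε * ‖ξ‖ ^ 2)
      nlinarith
    calc Real.exp (-c * ‖ξ‖ ^ 2) * (1 + ‖ξ‖ ^ 2) ^ (s / 2)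
        ≤ Real.exp (-c * ‖ξ‖ ^ 2) * (ε⁻¹ * Real.exp (ε * ‖ξ‖ ^ 2)) ^ (s / 2) := by gcongr
      _ = ε⁻¹ ^ (s / 2) * Real.exp (-c * ‖ξ‖ ^ 2 + ε * (s / 2) * ‖ξ‖ ^ 2) := by
        rw [Real.mul_rpow (by positivity) (by positivity), ← Real.exp_mul, Real.exp_add]
        ring_nf
      _ ≤ _ := by
        gcongr
        nlinarith [sq_nonneg ‖ξ‖]
  refine ne_top_of_le_ne_top ?_ (lintegral_mono key)
  rw [lintegral_const_mul _ (by fun_prop)]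
  exact ENNReal.mul_ne_top ENNReal.ofReal_ne_top (lintegral_enorm_gaussFun_ne_top (by positivity))

theorem enorm_gaussSTFT_mul_le {a b : ℝ} (ha : 0 ≤ a) (hb : 0 ≤ b) (f h : 𝓢(V, ℂ)) (x ξ : V) :
    ‖gaussSTFT (a + b) (fun t => f t * h t) x ξ‖ₑ ≤
      ((fun η => ‖gaussSTFT a f x η‖ₑ) ⋆ₗ fun η => ‖gaussSTFT b h x η‖ₑ) ξ := by
  obtain ⟨φ, hφ⟩ := exists_schwartzMap_eq_mul_gaussFun_sub ha f x
  obtain ⟨ψ, hψ⟩ := exists_schwartzMap_eq_mul_gaussFun_sub hb h x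
  have := enorm_fourier_schwartzMap_mul_le φ ψ.integrable ξ
  rw [hφ, hψ] at this
  refine (le_of_eq ?_).trans this
  rw [gaussSTFT]
  have h1 : (fun t => f t * h t * gaussFun (a + b) (t - x)) =
      fun t => (f t * gaussFun a (t - x)) * (h t * gaussFun b (t - x)) := by
    ext1 t
    rw [← gaussFun_mul_gaussFun]
    ring
  rw [h1]

theorem exists_stftSlice_mul_le {p : ℝ≥0∞} (hp : 1 ≤ p) :
    ∃ C : ℝ≥0∞, C ≠ ∞ ∧ ∃ c > 0, ∀ f h : 𝓢(V, ℂ), ∀ ξ,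
      stftSlice p π (fun t => f t * h t) ξ ≤ C * ((stftSlice p π f ⋆ₗ fun η => ‖gaussFun c η‖ₑ) ⋆ₗ
        (stftSlice p π h ⋆ₗ fun η => ‖gaussFun c η‖ₑ)) ξ := by
  obtain ⟨C, hC, c, hc, hle⟩ := exists_stftSlice_le (V := V) pi_pos (half_pos pi_pos) hp
  refine ⟨C * C, ENNReal.mul_ne_top hC hC, c, hc, fun f h ξ => ?_⟩
  set M : 𝓢(V, ℂ) → V → ℝ≥0∞ := fun f => stftSlice p π f ⋆ₗ fun η => ‖gaussFun c η‖ₑ with hM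
  have hMm : ∀ f, Measurable (M f) := fun f =>
    measurable_lconvolution _ (measurable_stftSlice p pi_pos.le f) (measurable_enorm_gaussFun c)
  have hMm' : Measurable fun η => M h (-η + ξ) := (hMm h).comp (by fun_prop)
  have hm : Measurable (Function.uncurry fun x η => ‖gaussSTFT (π / 2) f x η‖ₑ) :=
    (continuous_gaussSTFT (by positivity) f).enorm.measurable
  have h1 : ∀ x, ‖gaussSTFT π (fun t => f t * h t) x ξ‖ₑ ≤
      ∫⁻ η, ‖gaussSTFT (π / 2) f x η‖ₑ * (C * M h (-η + ξ)) := by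
    intro x
    have := enorm_gaussSTFT_mul_le (half_pos pi_pos).le (half_pos pi_pos).le f h x ξ
    rw [add_halves] at this
    refine this.trans (lintegral_mono fun η => ?_)
    exact mul_le_mul_right ((hle h _).2 x) _
  have h2 : ∀ η, eLpNorm (fun x => ‖gaussSTFT (π / 2) f x η‖ₑ * (C * M h (-η + ξ))) p volume ≤
      (C * M h (-η + ξ)) * stftSlice p (π / 2) f η := by
    intro η
    refine (eLpNorm_le_mul_eLpNorm_of_ae_le_mul'' p
      (g := fun x => ‖gaussSTFT (π / 2) f x η‖ₑ) (c := C * M h (-η + ξ))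
      (hm.comp (measurable_id.prodMk (measurable_const (a := η)))).aestronglyMeasurable
      (ae_of_all _ fun x => by simp [mul_comm])).trans ?_
    rw [eLpNorm_enorm]
    rfl
  calc stftSlice p π (fun t => f t * h t) ξ
      ≤ eLpNorm (fun x => ∫⁻ η, ‖gaussSTFT (π / 2) f x η‖ₑ * (C * M h (-η + ξ))) p volume :=
        eLpNorm_mono_enorm fun x => by simpa using h1 x
    _ ≤ ∫⁻ η, eLpNorm (fun x => ‖gaussSTFT (π / 2) f x η‖ₑ * (C * M h (-η + ξ))) p volume :=
        eLpNorm_lintegral_le (hm.mul ((hMm'.comp measurable_snd).const_mul C)) hp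
    _ ≤ ∫⁻ η, (C * M h (-η + ξ)) * (C * M f η) :=
        lintegral_mono fun η => (h2 η).trans (mul_le_mul_right (hle f η).1 _)
    _ = _ := by
        have hm2 : Measurable fun η => M f η * M h (-η + ξ) := (hMm f).mul hMm'
        change _ = C * C * (M f ⋆ₗ M h) ξ
        rw [lconvolution_def, ← lintegral_const_mul _ hm2]
        refine lintegral_congr fun η => ?_
        ring

theorem exists_gaussModNorm_mul_le {p q q' : ℝ≥0∞} (hp : 1 ≤ p) (hq : 1 ≤ q)
    (hqq : 1 / q + 1 / q' = 1) {s : ℝ} (hs : 0 ≤ s)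
    (hw : eLpNorm (bracketWeight (-s) : V → ℝ≥0∞) q' volume ≠ ∞) :
    ∃ C : ℝ≥0∞, C ≠ ∞ ∧ ∀ f h : 𝓢(V, ℂ), gaussModNorm p q s (fun t => f t * h t) ≤
      C * (gaussModNorm p q s f * gaussModNorm p q s h) := by
  obtain ⟨C, hC, c, hc, hle⟩ := exists_stftSlice_mul_le (V := V) hp
  set W := eLpNorm (bracketWeight (-s) : V → ℝ≥0∞) q' volume with hW
  set D := ENNReal.ofReal (2 ^ (s / 2)) *
    ∫⁻ ξ : V, ‖gaussFun c ξ‖ₑ * bracketWeight s ξ with hD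
  have hDt : D ≠ ∞ := ENNReal.mul_ne_top ENNReal.ofReal_ne_top
    (lintegral_gaussFun_mul_bracketWeight_ne_top hc hs)
  set M : 𝓢(V, ℂ) → V → ℝ≥0∞ := fun f => stftSlice p π f ⋆ₗ fun η => ‖gaussFun c η‖ₑ with hM
  have hMm : ∀ f, Measurable (M f) := fun f =>
    measurable_lconvolution _ (measurable_stftSlice p pi_pos.le f) (measurable_enorm_gaussFun c)
  have h1 : ∀ f, supLpNorm q (fun ξ => M f ξ * bracketWeight s ξ) ≤ gaussModNorm p q s f * D := by
    intro f
    refine (supLpNorm_lconvolution_mul_bracketWeight_le hq hs (measurable_stftSlice p pi_pos.le f)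
      (measurable_enorm_gaussFun c)).trans (le_of_eq ?_)
    rw [hD, gaussModNorm]
    ring
  have h2 : ∀ f, ∫⁻ ξ, M f ξ ≤ gaussModNorm p q s f * D * W := fun f =>
    (lintegral_le_supLpNorm_mul_bracketWeight hq hqq s (hMm f)).trans
      (mul_le_mul_left (h1 f) _)
  refine ⟨C * (ENNReal.ofReal (4 ^ (s / 2)) * (2 * (D * D * W))), by finiteness, fun f h => ?_⟩
  calc gaussModNorm p q s (fun t => f t * h t)
      ≤ supLpNorm q fun ξ => C * ((M f ⋆ₗ M h) ξ * bracketWeight s ξ) := by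
        refine supLpNorm_mono q fun ξ => ?_
        rw [← mul_assoc]
        exact mul_le_mul_left (hle f h ξ) _
    _ = C * supLpNorm q fun ξ => (M f ⋆ₗ M h) ξ * bracketWeight s ξ :=
        supLpNorm_const_mul hq hC _
    _ ≤ C * (ENNReal.ofReal (4 ^ (s / 2)) *
        ((gaussModNorm p q s f * D) * (gaussModNorm p q s h * D * W) +
          (gaussModNorm p q s h * D) * (gaussModNorm p q s f * D * W))) := by
        refine mul_le_mul_right ((supLpNorm_lconvolution_mul_bracketWeight_le_add hq hs (hMm f)
          (hMm h)).trans (mul_le_mul_right (add_le_add ?_ ?_) _)) _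
        · exact mul_le_mul' (h1 f) (h2 h)
        · exact mul_le_mul' (h1 h) (h2 f)
    _ = _ := by ring

end ProductEstimate

section BoundedOfAlgebra

open scoped ComplexConjugate

theorem enorm_integral_eq_lintegral_enorm_of_eq_norm {α : Type*} [MeasurableSpace α]
    {μ : Measure α} {F : α → ℂ} (hF : Integrable F μ) (h : ∀ t, F t = (‖F t‖ : ℂ)) :
    ‖∫ t, F t ∂μ‖ₑ = ∫⁻ t, ‖F t‖ₑ ∂μ := by
  rw [integral_congr_ae (ae_of_all _ h), integral_complex_ofReal, ← ofReal_norm,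
    Complex.norm_real, Real.norm_of_nonneg (integral_nonneg fun t => norm_nonneg _),
    ofReal_integral_norm_eq_lintegral_enorm hF]

variable {V : Type*} [NormedAddCommGroup V] [InnerProductSpace ℝ V] [FiniteDimensional ℝ V]
  [MeasurableSpace V] [BorelSpace V]

theorem supLpNorm_comp_neg (q : ℝ≥0∞) (F : V → ℝ≥0∞) :
    supLpNorm q (fun ξ => F (-ξ)) = supLpNorm q F := by
  unfold supLpNorm
  split_ifs
  · exact (Equiv.neg V).iSup_comp (g := F)
  · rw [lintegral_neg_eq_self (fun ξ => F ξ ^ q.toReal)]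

theorem gaussSTFT_conj (a : ℝ) (f : V → ℂ) (x ξ : V) :
    gaussSTFT a (fun t => conj (f t)) x ξ = conj (gaussSTFT a f x (-ξ)) := by
  simp only [gaussSTFT, Real.fourier_eq]
  rw [← integral_conj]
  refine integral_congr_ae (ae_of_all _ fun t => ?_)
  simp only [Circle.smul_def, smul_eq_mul, map_mul, gaussFun, Complex.conj_ofReal,
    inner_neg_right, neg_neg, ← Circle.coe_inv_eq_conj, ← AddChar.map_neg_eq_inv]

theorem gaussModNorm_conj (p q : ℝ≥0∞) (s : ℝ) (f : V → ℂ) :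
    gaussModNorm p q s (fun t => conj (f t)) = gaussModNorm p q s f := by
  unfold gaussModNorm
  rw [← supLpNorm_comp_neg]
  congr 1
  ext1 ξ
  simp only [bracketWeight, norm_neg, stftSlice, gaussSTFT_conj, neg_neg]
  congr 1
  refine eLpNorm_congr_enorm_ae (ae_of_all _ fun x => ?_)
  exact RCLike.enorm_conj _

theorem exists_enorm_gaussSTFT_zero_le {p q : ℝ≥0∞} (hp : 1 ≤ p) (hq : 1 ≤ q) {s : ℝ}
    (hs : 0 ≤ s) : ∃ K : ℝ≥0∞, K ≠ ∞ ∧ ∀ (f : 𝓢(V, ℂ)) (x : V),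
      ‖gaussSTFT (π / 2) f x 0‖ₑ ≤ K * gaussModNorm p q s f := by
  obtain ⟨C, hC, c, hc, hle⟩ := exists_stftSlice_le (V := V) pi_pos (half_pos pi_pos) hp
  have : Fact (1 ≤ q) := ⟨hq⟩
  have hqq : 1 / q + 1 / ENNReal.conjExponent q = 1 := by
    simpa using ENNReal.HolderConjugate.inv_add_inv_eq_one q (ENNReal.conjExponent q)
  refine ⟨C * eLpNorm (fun η : V => ‖gaussFun c η‖ₑ) (ENNReal.conjExponent q) volume,
    ENNReal.mul_ne_top hC (eLpNorm_gaussFun_ne_top hc _), fun f x => ?_⟩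
  have hm := measurable_stftSlice p pi_pos.le f
  refine ((hle f 0).2 x).trans ?_
  rw [mul_assoc, lconvolution_def]
  refine mul_le_mul_right ?_ _
  calc ∫⁻ η, stftSlice p π f η * ‖gaussFun c (-η + 0)‖ₑ
      = ∫⁻ η, stftSlice p π f η * ‖gaussFun c η‖ₑ := by simp only [add_zero, gaussFun_neg]
    _ ≤ eLpNorm (stftSlice p π f) q volume *
        eLpNorm (fun η : V => ‖gaussFun c η‖ₑ) (ENNReal.conjExponent q) volume :=
        lintegral_mul_le_eLpNorm_mul_eLpNorm hm.aemeasurable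
          (measurable_enorm_gaussFun c).aemeasurable hqq
    _ ≤ gaussModNorm p q s f *
        eLpNorm (fun η : V => ‖gaussFun c η‖ₑ) (ENNReal.conjExponent q) volume := by
        refine mul_le_mul_left ((eLpNorm_le_supLpNorm hq _).trans
          (supLpNorm_mono q fun ξ => ?_)) _
        exact le_mul_of_one_le_right' (one_le_bracketWeight hs ξ)
    _ = _ := mul_comm _ _

theorem exists_schwartzMap_eq_normSq_pow {p q : ℝ≥0∞} {s : ℝ} {C : ℝ≥0∞}
    (h : ∀ f h : 𝓢(V, ℂ), gaussModNorm p q s (fun t => f t * h t) ≤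
      C * (gaussModNorm p q s f * gaussModNorm p q s h)) (f : 𝓢(V, ℂ)) (n : ℕ) :
    ∃ φ : 𝓢(V, ℂ), (⇑φ = fun t => (conj (f t) * f t) ^ (n + 1)) ∧
      C * gaussModNorm p q s φ ≤ (C * gaussModNorm p q s f) ^ (2 * (n + 1)) := by
  have hconj : ∃ φ : 𝓢(V, ℂ), ⇑φ = fun t => conj (f t) :=
    ⟨f.postcompCLM (Complex.conjCLE : ℂ →L[ℝ] ℂ), rfl⟩
  obtain ⟨g, hg⟩ := hconj
  obtain ⟨φ, hφ⟩ := exists_schwartzMap_eq_mul g f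
  have hφn : C * gaussModNorm p q s φ ≤ (C * gaussModNorm p q s f) ^ 2 := by
    rw [hφ]
    refine (mul_le_mul_right (h g f) C).trans (le_of_eq ?_)
    rw [hg, gaussModNorm_conj]
    ring
  induction n with
  | zero => exact ⟨φ, by simp [hφ, hg], by simpa using hφn⟩
  | succ n ih =>
    obtain ⟨ψ, hψ, hψn⟩ := ih
    obtain ⟨χ, hχ⟩ := exists_schwartzMap_eq_mul ψ φ
    refine ⟨χ, ?_, ?_⟩
    · rw [hχ]
      ext1 t
      simp only [hψ, hφ, hg]
      ring
    · rw [hχ]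
      calc _ ≤ C * (C * (gaussModNorm p q s ψ * gaussModNorm p q s φ)) :=
            mul_le_mul_right (h ψ φ) C
        _ = (C * gaussModNorm p q s ψ) * (C * gaussModNorm p q s φ) := by ring
        _ ≤ _ := mul_le_mul' hψn hφn
        _ = _ := by ring

theorem enorm_le_of_gaussModNorm_mul_le {p q : ℝ≥0∞} (hp : 1 ≤ p) (hq : 1 ≤ q) {s : ℝ}
    (hs : 0 ≤ s) {C : ℝ≥0∞} (hC : C ≠ 0)
    (h : ∀ f h : 𝓢(V, ℂ), gaussModNorm p q s (fun t => f t * h t) ≤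
      C * (gaussModNorm p q s f * gaussModNorm p q s h)) (f : 𝓢(V, ℂ)) (x : V) :
    ‖f x‖ₑ ≤ C * gaussModNorm p q s f := by
  by_contra! hlt
  set M := C * gaussModNorm p q s f with hM
  obtain ⟨K, hK, hlow⟩ := exists_enorm_gaussSTFT_zero_le (V := V) (p := p) (q := q) hp hq hs
  obtain ⟨c, hMc, hcf⟩ := exists_between hlt
  have hc0 : c ≠ 0 := (bot_le.trans_lt hMc).ne'
  have hct : c ≠ ∞ := hcf.ne_top
  set U : Set V := {t | c < ‖f t‖ₑ} with hU
  have hUo : IsOpen U := isOpen_lt continuous_const f.continuous.enorm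
  set δ := ∫⁻ t in U, ‖gaussFun (π / 2) (t - x)‖ₑ with hδ
  have hgm : Measurable fun t => ‖gaussFun (π / 2) (t - x)‖ₑ :=
    (measurable_enorm_gaussFun _).comp (measurable_sub_const x)
  have hδ0 : δ ≠ 0 := by
    intro h0
    rw [hδ, lintegral_eq_zero_iff hgm] at h0
    have h1 : ∀ᵐ t ∂volume.restrict U, False := h0.mono fun t ht => by
      have h2 : 0 < ‖gaussFun (π / 2) (t - x)‖ := by
        rw [norm_gaussFun]; exact Real.exp_pos _
      have h3 : ‖gaussFun (π / 2) (t - x)‖ₑ = 0 := ht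
      rw [enorm_eq_zero] at h3
      simp [h3] at h2
    have h2 : volume U = 0 := by simpa [ae_iff] using h1
    exact (hUo.measure_pos volume ⟨x, hcf⟩).ne' h2
  have key : ∀ n : ℕ, C * δ ≤ K * ((M / c) ^ 2) ^ (n + 1) := by
    intro n
    obtain ⟨φ, hφ, hφn⟩ := exists_schwartzMap_eq_normSq_pow h f n
    obtain ⟨ψ, hψ⟩ := exists_schwartzMap_eq_mul_gaussFun_sub (half_pos pi_pos).le φ x
    have hr : ∀ t, ψ t = (‖ψ t‖ : ℂ) := by
      intro t
      have : ψ t = ((‖f t‖ ^ (2 * (n + 1)) * Real.exp (-(π / 2) * ‖t - x‖ ^ 2) : ℝ) : ℂ) := by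
        simp only [hψ, hφ, Complex.conj_mul', gaussFun]
        push_cast
        ring
      rw [this, Complex.norm_real, Real.norm_of_nonneg (by positivity)]
    have h1 : ‖gaussSTFT (π / 2) φ x 0‖ₑ = ∫⁻ t, ‖ψ t‖ₑ := by
      rw [← enorm_integral_eq_lintegral_enorm_of_eq_norm ψ.integrable hr, hψ, gaussSTFT,
        Real.fourier_eq]
      simp
    have h2 : c ^ (2 * (n + 1)) * δ ≤ ∫⁻ t, ‖ψ t‖ₑ := by
      rw [hδ, ← lintegral_const_mul _ hgm]
      refine (setLIntegral_mono' hUo.measurableSet fun t ht => ?_).trans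
        (setLIntegral_le_lintegral U _)
      have ht' : c ≤ ‖f t‖ₑ := le_of_lt ht
      simp only [hψ, hφ, enorm_mul, enorm_pow, RCLike.enorm_conj]
      rw [← pow_two, ← pow_mul]
      gcongr
    have h3 : c ^ (2 * (n + 1)) * (C * δ) ≤ K * M ^ (2 * (n + 1)) := by
      calc _ = C * (c ^ (2 * (n + 1)) * δ) := by ring
        _ ≤ C * (K * gaussModNorm p q s φ) :=
          mul_le_mul_right (h2.trans (h1 ▸ hlow φ x)) C
        _ = K * (C * gaussModNorm p q s φ) := by ring
        _ ≤ _ := mul_le_mul_right hφn K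
    rw [← pow_mul, div_eq_mul_inv, mul_pow, ← ENNReal.inv_pow, ← mul_assoc, ← div_eq_mul_inv,
      ENNReal.le_div_iff_mul_le (by simp [hc0]) (by simp [hct]), mul_comm]
    exact h3
  have hlim : Tendsto (fun n : ℕ => K * ((M / c) ^ 2) ^ (n + 1)) atTop (nhds 0) := by
    have h1 : (M / c) ^ 2 < 1 := by
      refine pow_lt_one₀ bot_le ?_ two_ne_zero
      exact ENNReal.div_lt_of_lt_mul' (by simpa using hMc)
    have h2 := (ENNReal.tendsto_pow_atTop_nhds_zero_of_lt_one h1).comp (tendsto_add_atTop_nat 1)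
    simpa using ENNReal.Tendsto.const_mul h2 (Or.inr hK)
  have := ge_of_tendsto' hlim key
  exact (mul_ne_zero hC hδ0) (le_antisymm this bot_le)

end BoundedOfAlgebra

section WeightCondition

/-- Smooth compactly supported functions squeezed between `⟨·⟩^{-r}` on a ball and `⟨·⟩^{-r}`. -/
theorem exists_schwartzMap_bracketWeight_cutoff {V : Type*} [NormedAddCommGroup V]
    [InnerProductSpace ℝ V] [FiniteDimensional ℝ V] (r : ℝ) {R : ℝ} (hR : 0 < R) :
    ∃ A : 𝓢(V, ℂ), (∀ η, A η = (‖A η‖ : ℂ)) ∧ (∀ η, ‖A η‖ₑ ≤ bracketWeight (-r) η) ∧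
      ∀ η ∈ Metric.ball (0 : V) R, ‖A η‖ₑ = bracketWeight (-r) η := by
  let χ : ContDiffBump (0 : V) := ⟨R, R + 1, hR, by linarith⟩
  set F : V → ℂ := fun η => ((χ η * (1 + ‖η‖ ^ 2) ^ (-r / 2) : ℝ) : ℂ) with hF
  have hn : ∀ η, ‖F η‖ = χ η * (1 + ‖η‖ ^ 2) ^ (-r / 2) := fun η => by
    rw [hF, Complex.norm_real, Real.norm_of_nonneg]
    exact mul_nonneg χ.nonneg (by positivity)
  have hs : HasCompactSupport F := by
    refine χ.hasCompactSupport.mono' (subset_trans (fun η hη => ?_) (subset_tsupport _))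
    contrapose! hη
    simp only [Function.mem_support, not_not] at hη ⊢
    simp [hF, hη]
  have hsm : ContDiff ℝ (⊤ : ℕ∞) F := by
    refine Complex.ofRealCLM.contDiff.comp (χ.contDiff.mul ?_)
    refine ContDiff.rpow_const_of_ne ?_ fun η => by positivity
    exact contDiff_const.add (contDiff_norm_sq ℝ)
  refine ⟨hs.toSchwartzMap hsm, fun η => ?_, fun η => ?_, fun η hη => ?_⟩
  · change F η = (‖F η‖ : ℂ)
    rw [hn]
  · change ‖F η‖ₑ ≤ _
    rw [← ofReal_norm, hn]
    exact ENNReal.ofReal_le_ofReal (mul_le_of_le_one_left (by positivity) χ.le_one)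
  · change ‖F η‖ₑ = _
    rw [← ofReal_norm, hn, χ.one_of_mem_closedBall (Metric.ball_subset_closedBall hη), one_mul]
    rfl

variable {V : Type*} [NormedAddCommGroup V] [InnerProductSpace ℝ V] [FiniteDimensional ℝ V]
  [MeasurableSpace V] [BorelSpace V]

theorem exists_gaussModNorm_le_of_fourier {p q : ℝ≥0∞} (hq : 1 ≤ q) {s : ℝ} (hs : 0 ≤ s) :
    ∃ K : ℝ≥0∞, K ≠ ∞ ∧ ∀ A : 𝓢(V, ℂ), ∃ f : 𝓢(V, ℂ), f 0 = ∫ η, A η ∧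
      gaussModNorm p q s f ≤ K * supLpNorm q fun ξ => ‖A ξ‖ₑ * bracketWeight s ξ := by
  have hr : 0 < π * π / (π + π) := by positivity
  have hc : 0 < π ^ 2 / (π + π) := by positivity
  set r := π * π / (π + π) with hr_def
  set c := π ^ 2 / (π + π) with hc_def
  set D : ℝ≥0∞ := ENNReal.ofReal ((π / (π + π)) ^ (Module.finrank ℝ V / 2 : ℝ)) with hD
  set E := eLpNorm (fun y : V => ‖gaussFun r y‖ₑ) p volume with hE
  have hEt : E ≠ ∞ := eLpNorm_gaussFun_ne_top hr p
  have hDt : D ≠ ∞ := ENNReal.ofReal_ne_top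
  refine ⟨(D * E) * (ENNReal.ofReal (2 ^ (s / 2)) *
      ∫⁻ ξ : V, ‖gaussFun c ξ‖ₑ * bracketWeight s ξ),
    ENNReal.mul_ne_top (ENNReal.mul_ne_top hDt hEt) (ENNReal.mul_ne_top ENNReal.ofReal_ne_top
      (lintegral_gaussFun_mul_bracketWeight_ne_top hc hs)), fun A => ?_⟩
  obtain ⟨f, hf⟩ := exists_schwartzMap_eq_mul_gaussFun_sub pi_pos.le (𝓕⁻ A) 0
  have hAm : Measurable fun η => ‖A η‖ₑ := A.continuous.enorm.measurable
  refine ⟨f, ?_, ?_⟩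
  · rw [hf]
    simp only [SchwartzMap.fourierInv_coe, Real.fourierInv_eq]
    simp [gaussFun]
  have h1 : ∀ x ξ, ‖gaussSTFT π f x ξ‖ₑ ≤ (D * ((fun η => ‖A η‖ₑ) ⋆ₗ
      fun η => ‖gaussFun c η‖ₑ) ξ) * ‖gaussFun r x‖ₑ := by
    intro x ξ
    have hv : Integrable fun t : V => gaussFun π (t - 0) * gaussFun π (t - x) :=
      ((integrable_gaussFun pi_pos).comp_sub_right x).bdd_mul
        (Continuous.aestronglyMeasurable (by fun_prop))
        (ae_of_all _ fun t => norm_gaussFun_le_one pi_pos.le _)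
    have h2 : ∀ η, ‖𝓕 (fun t : V => gaussFun π (t - 0) * gaussFun π (t - x)) η‖ₑ =
        D * (‖gaussFun r x‖ₑ * ‖gaussFun c η‖ₑ) := by
      intro η
      simp only [← ofReal_norm]
      rw [norm_fourier_gaussFun_mul_gaussFun (by positivity), ENNReal.ofReal_mul (by positivity),
        ENNReal.ofReal_mul (by positivity), norm_gaussFun, norm_gaussFun, zero_sub, norm_neg]
    have h3 := enorm_fourier_schwartzMap_mul_le (𝓕⁻ A) hv ξ
    rw [← SchwartzMap.fourier_coe, FourierTransform.fourier_fourierInv_eq] at h3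
    have h4 : gaussSTFT π f x ξ =
        𝓕 (fun t => (𝓕⁻ A) t * (gaussFun π (t - 0) * gaussFun π (t - x))) ξ := by
      rw [gaussSTFT, hf]
      simp only [mul_assoc]
    rw [h4]
    refine h3.trans (le_of_eq ?_)
    have hm : Measurable fun η => ‖A η‖ₑ * ‖gaussFun c (-η + ξ)‖ₑ :=
      hAm.mul ((measurable_enorm_gaussFun c).comp (measurable_neg.add_const ξ))
    rw [lconvolution_def, lconvolution_def, mul_right_comm, ← lintegral_const_mul _ hm]
    refine lintegral_congr fun η => ?_
    rw [h2]
    ring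
  have h2 : ∀ ξ, stftSlice p π f ξ ≤ (D * E) * ((fun η => ‖A η‖ₑ) ⋆ₗ
      fun η => ‖gaussFun c η‖ₑ) ξ := by
    intro ξ
    refine (eLpNorm_le_mul_eLpNorm_of_ae_le_mul'' p (g := fun x => ‖gaussFun r x‖ₑ)
      (measurable_enorm_gaussFun r).aestronglyMeasurable
      (ae_of_all _ fun x => by simpa using h1 x ξ)).trans (le_of_eq ?_)
    rw [hE]
    ring
  calc gaussModNorm p q s f
      ≤ supLpNorm q fun ξ => (D * E) * (((fun η => ‖A η‖ₑ) ⋆ₗ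
          fun η => ‖gaussFun c η‖ₑ) ξ * bracketWeight s ξ) := by
        refine supLpNorm_mono q fun ξ => ?_
        rw [← mul_assoc]
        exact mul_le_mul_left (h2 ξ) _
    _ = (D * E) * supLpNorm q fun ξ => ((fun η => ‖A η‖ₑ) ⋆ₗ
          fun η => ‖gaussFun c η‖ₑ) ξ * bracketWeight s ξ :=
        supLpNorm_const_mul hq (ENNReal.mul_ne_top hDt hEt) _
    _ ≤ _ := by
        rw [mul_assoc (D * E) _ (supLpNorm q _)]
        refine mul_le_mul_right ((supLpNorm_lconvolution_mul_bracketWeight_le hq hs hAm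
          (measurable_enorm_gaussFun c)).trans (le_of_eq ?_)) _
        ring

theorem one_div_toReal_add_one_div_toReal {q q' : ℝ≥0∞} (hqq : 1 / q + 1 / q' = 1) :
    1 / q.toReal + 1 / q'.toReal = 1 := by
  have h1 : 1 / q ≠ ∞ := ne_top_of_le_ne_top ENNReal.one_ne_top (hqq.le.trans' le_self_add)
  have h2 : 1 / q' ≠ ∞ := ne_top_of_le_ne_top ENNReal.one_ne_top (hqq.le.trans' le_add_self)
  simpa only [ENNReal.toReal_add h1 h2, ENNReal.toReal_div, ENNReal.toReal_one] using
    congrArg ENNReal.toReal hqq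

theorem ENNReal.le_rpow_of_le_mul_rpow {I B : ℝ≥0∞} (hI : I ≠ ∞) {a b : ℝ} (hb : 0 < b)
    (hab : 1 / a + 1 / b = 1) (h : I ≤ B * I ^ (1 / a)) : I ≤ B ^ b := by
  rcases eq_or_ne I 0 with rfl | hI0
  · exact bot_le
  have h1 : I ^ (1 / b) ≤ B := by
    rw [eq_sub_of_add_eq' hab, sub_eq_add_neg, ENNReal.rpow_add _ _ hI0 hI, ENNReal.rpow_one]
    calc I * I ^ (-(1 / a)) ≤ B * I ^ (1 / a) * I ^ (-(1 / a)) := mul_le_mul_left h _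
      _ = B := by rw [mul_assoc, ← ENNReal.rpow_add _ _ hI0 hI, add_neg_cancel,
        ENNReal.rpow_zero, mul_one]
  calc I = (I ^ (1 / b)) ^ b := by rw [← ENNReal.rpow_mul, one_div_mul_cancel hb.ne',
        ENNReal.rpow_one]
    _ ≤ B ^ b := ENNReal.rpow_le_rpow h1 hb.le

theorem supLpNorm_mul_bracketWeight_le {q q' : ℝ≥0∞} (hq : 1 ≤ q) (hqq : 1 / q + 1 / q' = 1)
    (hq' : q' ≠ ∞) (s : ℝ) {F : V → ℝ≥0∞} (hF : ∀ ξ, F ξ ≤ bracketWeight (-(s * q'.toReal)) ξ) :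
    (supLpNorm q fun ξ => F ξ * bracketWeight s ξ) ≤ (∫⁻ ξ, F ξ) ^ (1 / q.toReal) := by
  have hr := one_div_toReal_add_one_div_toReal hqq
  rcases eq_or_ne q ∞ with rfl | hqt
  · have h1 : q'.toReal = 1 := by simpa using hr
    rw [supLpNorm, if_pos rfl]
    refine iSup_le fun ξ => ?_
    calc F ξ * bracketWeight s ξ ≤ bracketWeight (-s) ξ * bracketWeight s ξ :=
          mul_le_mul_left (by simpa [h1] using hF ξ) _
      _ ≤ _ := by simp [bracketWeight_mul_bracketWeight, bracketWeight_zero]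
  have hQ : 1 ≤ q.toReal := by simpa using ENNReal.toReal_mono hqt hq
  have hQ' : 0 < q'.toReal := by
    refine ENNReal.toReal_pos ?_ hq'
    rintro rfl
    simp at hqq
  have hQQ : q'.toReal * (q.toReal - 1) = q.toReal := by
    field_simp at hr
    linarith
  rw [supLpNorm, if_neg hqt]
  gcongr with ξ
  rw [ENNReal.mul_rpow_of_nonneg _ _ (by positivity), bracketWeight_rpow s _ (by positivity)]
  calc F ξ ^ q.toReal * bracketWeight (s * q.toReal) ξ
      = F ξ * (F ξ ^ (q.toReal - 1) * bracketWeight (s * q.toReal) ξ) := by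
        rw [← mul_assoc]
        congr 1
        conv_lhs => rw [← add_sub_cancel 1 q.toReal,
          ENNReal.rpow_add_of_nonneg _ _ zero_le_one (by linarith), ENNReal.rpow_one]
    _ ≤ F ξ * (bracketWeight (-(s * q'.toReal)) ξ ^ (q.toReal - 1) *
          bracketWeight (s * q.toReal) ξ) := by
        exact mul_le_mul_right (mul_le_mul_left
          (ENNReal.rpow_le_rpow (hF ξ) (sub_nonneg.2 hQ)) _) _
    _ = F ξ := by
        rw [bracketWeight_rpow _ _ (by linarith), bracketWeight_mul_bracketWeight, neg_mul,
          mul_assoc, hQQ, neg_add_cancel, bracketWeight_zero, mul_one]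

theorem finrank_lt_of_enorm_le_gaussModNorm (hV : 0 < Module.finrank ℝ V) {p q q' : ℝ≥0∞}
    (hq : 1 < q) (hqq : 1 / q + 1 / q' = 1) {s : ℝ} (hs : 0 ≤ s) {C : ℝ≥0∞} (hC : C ≠ ∞)
    (h : ∀ f : 𝓢(V, ℂ), ‖f 0‖ₑ ≤ C * gaussModNorm p q s f) :
    (Module.finrank ℝ V : ℝ) < s * q'.toReal := by
  by_contra! hle
  have hq'0 : q' ≠ 0 := by
    rintro rfl
    simp at hqq
  have hq't : q' ≠ ∞ := by
    rintro rfl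
    simp at hqq
    simp [hqq] at hq
  have ht0 : 0 < q'.toReal := ENNReal.toReal_pos hq'0 hq't
  obtain ⟨K, hK, hKf⟩ := exists_gaussModNorm_le_of_fourier (V := V) (p := p) hq.le hs
  set r := s * q'.toReal with hr
  have hbound : ∀ n : ℕ, ∫⁻ η in Metric.ball (0 : V) (n + 1), bracketWeight (-r) η ≤
      (C * K) ^ q'.toReal := by
    intro n
    obtain ⟨A, hA1, hA2, hA3⟩ := exists_schwartzMap_bracketWeight_cutoff (V := V) r
      (R := n + 1) (by positivity)
    obtain ⟨f, hf0, hfm⟩ := hKf A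
    set I := ∫⁻ η, ‖A η‖ₑ with hI
    have hIt : I ≠ ∞ := A.integrable.2.ne
    have h1 : I ≤ C * (K * supLpNorm q fun ξ => ‖A ξ‖ₑ * bracketWeight s ξ) := by
      have := h f
      rw [hf0, enorm_integral_eq_lintegral_enorm_of_eq_norm A.integrable hA1] at this
      exact this.trans (mul_le_mul_right hfm C)
    have h2 : (supLpNorm q fun ξ => ‖A ξ‖ₑ * bracketWeight s ξ) ≤ I ^ (1 / q.toReal) :=
      supLpNorm_mul_bracketWeight_le hq.le hqq hq't s hA2
    have h3 : I ≤ (C * K) ^ q'.toReal := by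
      refine ENNReal.le_rpow_of_le_mul_rpow hIt ht0 (one_div_toReal_add_one_div_toReal hqq) ?_
      rw [mul_assoc]
      exact h1.trans (mul_le_mul_right (mul_le_mul_right h2 K) C)
    refine le_trans ?_ h3
    rw [← setLIntegral_congr_fun measurableSet_ball hA3]
    exact setLIntegral_le_lintegral _ _
  have htop := lintegral_bracketWeight_neg_eq_top hV (by positivity : 0 ≤ r) hle
  have hun : ⋃ n : ℕ, Metric.ball (0 : V) (n + 1) = Set.univ := by
    refine Set.eq_univ_of_forall fun x => Set.mem_iUnion.2 ?_
    obtain ⟨n, hn⟩ := exists_nat_gt ‖x‖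
    exact ⟨n, by simpa using hn.trans (by simp)⟩
  have hdir : Directed (· ⊆ ·) fun n : ℕ => Metric.ball (0 : V) (n + 1) :=
    Monotone.directed_le fun m n hmn => Metric.ball_subset_ball (by gcongr)
  have h4 := setLIntegral_iUnion_of_directed (μ := volume) (bracketWeight (-r) : V → ℝ≥0∞) hdir
  rw [hun, setLIntegral_univ, htop] at h4
  have h5 : (∞ : ℝ≥0∞) ≤ (C * K) ^ q'.toReal := h4 ▸ iSup_le hbound
  exact (ENNReal.rpow_ne_top_of_nonneg ht0.le (ENNReal.mul_ne_top hC hK)) (top_le_iff.1 h5)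

end WeightCondition

section Bridge

variable {d : ℕ}

theorem STFT_eq_gaussSTFT (f : EuclideanSpace ℝ (Fin d) → ℂ) (x ξ : EuclideanSpace ℝ (Fin d)) :
    STFT f x ξ = gaussSTFT π f x ξ := by
  rw [STFT, gaussSTFT, Real.fourier_eq]
  refine integral_congr_ae (ae_of_all _ fun t => ?_)
  simp only [Circle.smul_def, Real.fourierChar_apply, smul_eq_mul, ← mul_assoc,
    real_inner_comm ξ t]
  congr 3
  push_cast
  ring

theorem modNorm_eq_gaussModNorm (p q : ℝ≥0∞) (s : ℝ) (f : EuclideanSpace ℝ (Fin d) → ℂ) :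
    modNorm p q s f = gaussModNorm p q s f := by
  simp only [modNorm, gaussModNorm, supLpNorm, stftSlice, bracketWeight, STFT_eq_gaussSTFT]

theorem toReal_natCast_div_lt_iff {q : ℝ≥0∞} (hq0 : q ≠ 0) (hq : q ≠ ∞) (n : ℕ) (s : ℝ) :
    ((n : ℝ≥0∞) / q).toReal < s ↔ (n : ℝ) < s * q.toReal := by
  rw [ENNReal.toReal_div, ENNReal.toReal_natCast, div_lt_iff₀ (ENNReal.toReal_pos hq0 hq)]

theorem Continuous.enorm_le_eLpNorm_top {X E : Type*} [TopologicalSpace X] [MeasureSpace X]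
    [Measure.IsOpenPosMeasure (volume : Measure X)] [NormedAddCommGroup E] {f : X → E}
    (hf : Continuous f) (x : X) : ‖f x‖ₑ ≤ eLpNorm f ∞ volume := by
  have h : Dense {x | ‖f x‖ₑ ≤ eLpNorm f ∞ volume} := by
    refine Measure.dense_of_ae (μ := volume) ?_
    rw [eLpNorm_exponent_top]
    exact enorm_ae_le_eLpNormEssSup f volume
  have hc : IsClosed {x | ‖f x‖ₑ ≤ eLpNorm f ∞ volume} :=
    isClosed_le hf.enorm continuous_const
  exact hc.closure_subset (h x)

end Bridge

end Auxiliary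

/-- **Characterization of the Banach algebra property for modulation spaces**
(Reich–Sickel): for `1 ≤ p, q ≤ ∞` and `s ≥ 0`, with `1/q + 1/q' = 1`, the following
are equivalent: (i) `M^{p,q}_s(ℝ^d)` is a Banach algebra for pointwise multiplication;
(ii) `M^{p,q}_s(ℝ^d) ↪ L^∞(ℝ^d)`; (iii) either `s = 0` and `q = 1`, or `s > d/q'`. -/
theorem modulation_banach_algebra_iff
    {d : ℕ} (hd : 1 ≤ d) (p q q' : ℝ≥0∞) (hp : 1 ≤ p) (hq : 1 ≤ q)
    (hq' : 1 / q + 1 / q' = 1) (s : ℝ) (hs : 0 ≤ s) :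
    ((∃ C : ℝ, 0 < C ∧ ∀ f h : SchwartzMap (EuclideanSpace ℝ (Fin d)) ℂ,
        modNorm p q s (fun x => f x * h x) ≤
          ENNReal.ofReal C * (modNorm p q s (fun x => f x) * modNorm p q s (fun x => h x))) ↔
      (∃ C : ℝ, 0 < C ∧ ∀ f : SchwartzMap (EuclideanSpace ℝ (Fin d)) ℂ,
        eLpNorm (fun x => f x) ∞ volume ≤ ENNReal.ofReal C * modNorm p q s (fun x => f x))) ∧
    ((∃ C : ℝ, 0 < C ∧ ∀ f : SchwartzMap (EuclideanSpace ℝ (Fin d)) ℂ,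
        eLpNorm (fun x => f x) ∞ volume ≤ ENNReal.ofReal C * modNorm p q s (fun x => f x)) ↔
      ((s = 0 ∧ q = 1) ∨ ((d : ℝ≥0∞) / q').toReal < s)) := by
  have hq'1 : 1 ≤ q' := by
    have : 1 / q' ≤ 1 := hq'.le.trans' le_add_self
    simpa using this
  have hq'0 : q' ≠ 0 := (zero_lt_one.trans_le hq'1).ne'
  have hq'top : q = 1 ↔ q' = ∞ := by
    constructor
    · rintro rfl
      have h : (1 : ℝ≥0∞) + 1 / q' = 1 + 0 := by simpa using hq'
      simpa using (ENNReal.add_right_inj ENNReal.one_ne_top).1 h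
    · rintro rfl
      simpa using hq'
  simp only [modNorm_eq_gaussModNorm]
  have h12 : (∃ C : ℝ, 0 < C ∧ ∀ f h : SchwartzMap (EuclideanSpace ℝ (Fin d)) ℂ,
        gaussModNorm p q s (fun x => f x * h x) ≤ ENNReal.ofReal C *
          (gaussModNorm p q s (fun x => f x) * gaussModNorm p q s (fun x => h x))) →
      ∃ C : ℝ, 0 < C ∧ ∀ f : SchwartzMap (EuclideanSpace ℝ (Fin d)) ℂ,
        eLpNorm (fun x => f x) ∞ volume ≤
          ENNReal.ofReal C * gaussModNorm p q s (fun x => f x) := by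
    rintro ⟨C, hC, h⟩
    refine ⟨C, hC, fun f => ?_⟩
    rw [eLpNorm_exponent_top]
    exact essSup_le_of_ae_le _ (ae_of_all _
      (enorm_le_of_gaussModNorm_mul_le hp hq hs (by simpa using hC) h f))
  have h23 : (∃ C : ℝ, 0 < C ∧ ∀ f : SchwartzMap (EuclideanSpace ℝ (Fin d)) ℂ,
        eLpNorm (fun x => f x) ∞ volume ≤
          ENNReal.ofReal C * gaussModNorm p q s (fun x => f x)) →
      (s = 0 ∧ q = 1) ∨ ((d : ℝ≥0∞) / q').toReal < s := by
    rintro ⟨C, hC, h⟩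
    rcases eq_or_ne q 1 with hq1 | hq1
    · rcases hs.eq_or_lt with hs0 | hs0
      · exact Or.inl ⟨hs0.symm, hq1⟩
      · exact Or.inr (by simpa [hq'top.1 hq1] using hs0)
    · refine Or.inr ((toReal_natCast_div_lt_iff hq'0 (fun h => hq1 (hq'top.2 h)) d s).2 ?_)
      have := finrank_lt_of_enorm_le_gaussModNorm (V := EuclideanSpace ℝ (Fin d)) (p := p)
        (by simpa using Nat.lt_of_succ_le hd) (lt_of_le_of_ne hq hq1.symm) hq' hs ENNReal.ofReal_ne_top
        fun f => (f.continuous.enorm_le_eLpNorm_top 0).trans (h f)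
      simpa using this
  have h31 : (s = 0 ∧ q = 1) ∨ ((d : ℝ≥0∞) / q').toReal < s →
      ∃ C : ℝ, 0 < C ∧ ∀ f h : SchwartzMap (EuclideanSpace ℝ (Fin d)) ℂ,
        gaussModNorm p q s (fun x => f x * h x) ≤ ENNReal.ofReal C *
          (gaussModNorm p q s (fun x => f x) * gaussModNorm p q s (fun x => h x)) := by
    intro h
    have hw : eLpNorm (bracketWeight (V := EuclideanSpace ℝ (Fin d)) (-s)) q' volume ≠ ∞ := by
      refine eLpNorm_bracketWeight_neg_ne_top hq'1 hs ?_
      rw [finrank_euclideanSpace_fin]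
      by_cases ht : q' = ∞
      · exact Or.inl ht
      · rcases h with h | h
        · exact absurd (hq'top.1 h.2) ht
        · exact Or.inr ((toReal_natCast_div_lt_iff hq'0 ht d s).1 h)
    obtain ⟨C, hC, hCm⟩ := exists_gaussModNorm_mul_le (V := EuclideanSpace ℝ (Fin d))
      hp hq hq' hs hw
    refine ⟨C.toReal + 1, by positivity, fun f h => (hCm f h).trans ?_⟩
    refine mul_le_mul_left ?_ _
    exact (ENNReal.ofReal_toReal hC).symm.le.trans (ENNReal.ofReal_le_ofReal (by linarith))
  exact ⟨⟨h12, h31 ∘ h23⟩, ⟨h23, h12 ∘ h31⟩⟩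
end
end
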